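/- arXiv:1604.06304 — 2 statements merged into one kernel-verified Lean document; each statement's English description precedes it below -/
import Mathlib

section
/- For θ, θ' ∈ ℝ^{|m|}, the exponential family densities f_θ = exp(θ·φ_m - ψ(θ))1_△ satisfy: (a) ‖log(f_θ/f_{θ'})‖_∞ ≤ 2√d κ_m ‖θ-θ'‖; (b) KL(f_θ‖f_{θ'}) ≤ (d/2) exp(‖log f_θ‖_∞ + √d κ_m ‖θ-θ'‖) ‖θ-θ'‖²; (c) KL(f_θ‖f_{θ'}) ≥ (1/(2d)) exp(-‖log f_θ‖_∞ - 2√d κ_m ‖θ-θ'‖) ‖θ-θ'‖². -/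
open MeasureTheory Real

def simplexD (d : ℕ) : Set (Fin d → ℝ) :=
  {x | (∀ i, x i ∈ Set.Icc (0:ℝ) 1) ∧ ∀ i j : Fin d, i ≤ j → x i ≤ x j}

noncomputable def qMeas (d i : ℕ) : Measure ℝ :=
  volume.withDensity (fun t => ENNReal.ofReal
    (Set.indicator (Set.Icc (0:ℝ) 1)
      (fun s => (1-s)^(d-i) * s^(i-1) / ((d-i).factorial * (i-1).factorial)) t))

noncomputable def jacobiP (a b k : ℕ) (t : ℝ) : ℝ :=
  (-1)^k / ((2:ℝ)^k * (k.factorial : ℝ) * ((1-t)^a * (1+t)^b)) *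
    iteratedDeriv k (fun s => (1-s)^a * (1+s)^b * (1-s^2)^k) t

noncomputable def phiB (d i k : ℕ) (t : ℝ) : ℝ :=
  Real.sqrt ((((2*k+d) * k.factorial * (k+d-1).factorial : ℕ) : ℝ) /
      (((k+d-i).factorial * (k+i-1).factorial : ℕ) : ℝ)) *
  Real.sqrt (((d-i).factorial * (i-1).factorial : ℕ) : ℝ) *
  jacobiP (d-i) (i-1) k (2*t-1)

noncomputable def lincomb (d : ℕ) (m : Fin d → ℕ) (θ : (i : Fin d) → Fin (m i) → ℝ)
    (x : Fin d → ℝ) : ℝ :=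
  ∑ i, ∑ k, θ i k * phiB d (i.1+1) (k.1+1) (x i)

noncomputable def psiFun (d : ℕ) (m : Fin d → ℕ) (θ : (i : Fin d) → Fin (m i) → ℝ) : ℝ :=
  Real.log (∫ x in simplexD d, Real.exp (lincomb d m θ x))

noncomputable def fdens (d : ℕ) (m : Fin d → ℕ) (θ : (i : Fin d) → Fin (m i) → ℝ)
    (x : Fin d → ℝ) : ℝ :=
  Real.exp (lincomb d m θ x - psiFun d m θ)

noncomputable def Amap (d : ℕ) (m : Fin d → ℕ) (θ : (i : Fin d) → Fin (m i) → ℝ) :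
    (i : Fin d) → Fin (m i) → ℝ :=
  fun i k => ∫ x in simplexD d, phiB d (i.1+1) (k.1+1) (x i) * fdens d m θ x

noncomputable def eunorm (d : ℕ) (m : Fin d → ℕ) (θ : (i : Fin d) → Fin (m i) → ℝ) : ℝ :=
  Real.sqrt (∑ i, ∑ k, (θ i k)^2)


lemma xA_alt (k : ℕ) (p : Polynomial ℝ) (hp : p.natDegree < k) :
    ∑ v ∈ Finset.range (k+1), (-1:ℝ)^v * (k.choose v) * p.eval (v:ℝ) = 0 := by
  have h := congrFun (Polynomial.fwdDiff_iter_eq_zero_of_degree_lt hp) 0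
  rw [fwdDiff_iter_eq_sum_shift] at h
  have h2 : ∑ v ∈ Finset.range (k+1), (-1:ℝ)^v * (k.choose v) * p.eval (v:ℝ)
      = (-1:ℝ)^k * ∑ v ∈ Finset.range (k+1), ((-1:ℤ)^(k-v) * (k.choose v)) • p.eval (0 + v • (1:ℝ)) := by
    rw [Finset.mul_sum]
    refine Finset.sum_congr rfl fun v hv => ?_
    have hv' : v ≤ k := by simpa [Nat.lt_succ_iff] using hv
    obtain ⟨r, rfl⟩ := Nat.exists_eq_add_of_le hv'
    have h3 : ((-1:ℝ)^r * (-1)^r) = 1 := by rw [← mul_pow]; simp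
    simp only [Nat.add_sub_cancel_left, zero_add, nsmul_eq_mul, mul_one, zsmul_eq_mul, pow_add]
    push_cast
    linear_combination (-(-1:ℝ)^v * ((v+r).choose v) * p.eval (v:ℝ)) * h3
  rw [h2, h]; simp

lemma xA_inv (k : ℕ) (c : ℝ) (hc : 0 < c) :
    ∑ v ∈ Finset.range (k+1), (-1:ℝ)^v * (k.choose v) * (1 / (v + c))
      = k.factorial / ∏ r ∈ Finset.range (k+1), (c + r) := by
  have key : ∀ k : ℕ, ∀ c : ℝ, 0 < c → (fwdDiff (1:ℝ))^[k] (fun x : ℝ => 1 / x) c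
      = (-1)^k * (k.factorial / ∏ r ∈ Finset.range (k+1), (c + r)) := by
    intro k
    induction k with
    | zero => intro c hc; simp
    | succ k ih =>
      intro c hc
      rw [Function.iterate_succ_apply', fwdDiff, ih c hc, ih (c+1) (by linarith)]
      have e1 : ∏ r ∈ Finset.range (k+1+1), (c + (r:ℝ)) = (∏ r ∈ Finset.range k, (c + 1 + (r:ℝ))) * (c+k+1) * c := by
        rw [Finset.prod_range_succ', Finset.prod_range_succ]
        push_cast; simp only [add_zero, add_assoc, add_comm, add_left_comm]
      have e2 : ∏ r ∈ Finset.range (k+1), (c + (r:ℝ)) = (∏ r ∈ Finset.range k, (c + 1 + (r:ℝ))) * c := by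
        rw [Finset.prod_range_succ']
        push_cast; simp only [add_zero, add_assoc, add_comm, add_left_comm]
      have e3 : ∏ r ∈ Finset.range (k+1), (c + 1 + (r:ℝ)) = (∏ r ∈ Finset.range k, (c + 1 + (r:ℝ))) * (c+k+1) := by
        rw [Finset.prod_range_succ]; ring
      have hP : (0:ℝ) < ∏ r ∈ Finset.range k, (c + 1 + (r:ℝ)) := Finset.prod_pos fun r _ => by positivity
      rw [e1, e2, e3, Nat.factorial_succ]
      generalize (∏ r ∈ Finset.range k, (c + 1 + (r:ℝ))) = P at *
      have : c + k + 1 ≠ 0 := by positivity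
      push_cast
      field_simp
      ring
  have h := key k c hc
  rw [fwdDiff_iter_eq_sum_shift] at h
  have h2 : ∑ v ∈ Finset.range (k+1), (-1:ℝ)^v * (k.choose v) * (1 / (v + c))
      = (-1:ℝ)^k * ∑ v ∈ Finset.range (k+1), ((-1:ℤ)^(k-v) * (k.choose v)) • (1 / (c + v • (1:ℝ))) := by
    rw [Finset.mul_sum]
    refine Finset.sum_congr rfl fun v hv => ?_
    have hv' : v ≤ k := by simpa [Nat.lt_succ_iff] using hv
    obtain ⟨r, rfl⟩ := Nat.exists_eq_add_of_le hv'
    have h3 : ((-1:ℝ)^r * (-1)^r) = 1 := by rw [← mul_pow]; simp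
    simp only [Nat.add_sub_cancel_left, nsmul_eq_mul, mul_one, zsmul_eq_mul, pow_add]
    push_cast
    rw [add_comm c]
    linear_combination (-(-1:ℝ)^v * ((v+r).choose v) * (1 / (v + c))) * h3
  rw [h2, h, ← mul_assoc, ← mul_pow]; simp

/-- rising product polynomial -/
noncomputable def xAris (c : ℝ) (n : ℕ) : Polynomial ℝ :=
  ∏ r ∈ Finset.range n, (Polynomial.X + Polynomial.C (c + r))

lemma xAris_deg (c : ℝ) (n : ℕ) : (xAris c n).natDegree ≤ n := by
  unfold xAris
  refine (Polynomial.natDegree_prod_le _ _).trans ?_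
  refine (Finset.sum_le_sum (g := fun _ => 1) fun r _ => ?_).trans (by simp)
  exact (Polynomial.natDegree_X_add_C _).le

lemma xAris_eval (c n v : ℕ) : (xAris ((c:ℝ)+1) n).eval (v:ℝ) = ((c+v+n).factorial : ℝ) / (c+v).factorial := by
  rw [eq_div_iff (by positivity)]
  induction n with
  | zero => simp [xAris]
  | succ n ih =>
    rw [xAris, Finset.prod_range_succ, Polynomial.eval_mul, ← xAris, mul_right_comm, ih]
    rw [← add_assoc, Nat.factorial_succ]; push_cast
    simp; ring

lemma xA_S0 (k e j l : ℕ) (hl : l < k) :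
    ∑ v ∈ Finset.range (k+1), (-1:ℝ)^v * (k.choose v) *
      ((((k+v+e).factorial : ℝ) / (e+1+v+l).factorial) * (((j+v+l).factorial : ℝ) / (j+v).factorial)) = 0 := by
  obtain ⟨r, rfl⟩ := Nat.exists_eq_add_of_lt hl
  rw [← xA_alt (l+r+1) (xAris (((e+1+l:ℕ):ℝ)+1) r * xAris ((j:ℝ)+1) l)]
  · refine Finset.sum_congr rfl fun v _ => ?_
    rw [Polynomial.eval_mul, xAris_eval, xAris_eval,
      show l+r+1+v+e = e+1+l+v+r by ring, show e+1+v+l = e+1+l+v by ring]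
  · refine (Polynomial.natDegree_mul_le).trans_lt ?_
    have := xAris_deg (((e+1+l:ℕ):ℝ)+1) r
    have := xAris_deg ((j:ℝ)+1) l
    omega

lemma xA_neg (j a k : ℕ) : (xAris ((j:ℝ)+1) k).eval (-((j+a+1+k : ℕ):ℝ)) =
    (-1)^k * ((a+k).factorial / a.factorial : ℝ) := by
  have : (xAris ((j:ℝ)+1) k).eval (-((j+a+1+k : ℕ):ℝ)) = (-1)^k * (xAris ((a:ℝ)+1) k).eval ((0:ℕ):ℝ) := by
    simp only [xAris, Polynomial.eval_prod]
    rw [← Finset.prod_range_reflect]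
    rw [show (-1:ℝ)^k = ∏ r ∈ Finset.range k, (-1:ℝ) by simp, ← Finset.prod_mul_distrib]
    refine Finset.prod_congr rfl fun r hr => ?_
    have hr' := Finset.mem_range.1 hr
    obtain ⟨s, rfl⟩ := Nat.exists_eq_add_of_lt hr'
    rw [show r + s + 1 - 1 - r = s by omega]
    simp; ring
  rw [this, xAris_eval]; simp

lemma xA_S1 (k a j : ℕ) :
    ∑ v ∈ Finset.range (k+1), (-1:ℝ)^v * (k.choose v) *
      ((((k+v+(j+a)).factorial : ℝ) / ((j+a)+1+v+k).factorial) * (((j+v+k).factorial : ℝ) / (j+v).factorial))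
      = (-1)^k * ((a+k).factorial / a.factorial : ℝ) * (k.factorial * (j+a+k).factorial / (j+a+1+2*k).factorial) := by
  set p := xAris ((j:ℝ)+1) k with hp
  set c : ℝ := ((j+a+1+k : ℕ):ℝ) with hc
  have hcp : 0 < c := by rw [hc]; positivity
  set q := p /ₘ (Polynomial.X - Polynomial.C (-c)) with hq
  have hdiv : ∀ v : ℝ, p.eval v = p.eval (-c) + (v + c) * q.eval v := by
    intro v
    have := Polynomial.modByMonic_add_div p (Polynomial.X - Polynomial.C (-c))
    rw [Polynomial.modByMonic_X_sub_C_eq_C_eval] at this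
    conv_lhs => rw [← this]
    simp [hq]
  have hterm : ∀ v ∈ Finset.range (k+1), (-1:ℝ)^v * (k.choose v) *
      ((((k+v+(j+a)).factorial : ℝ) / ((j+a)+1+v+k).factorial) * (((j+v+k).factorial : ℝ) / (j+v).factorial))
      = p.eval (-c) * ((-1:ℝ)^v * (k.choose v) * (1/(v+c))) + (-1:ℝ)^v * (k.choose v) * q.eval (v:ℝ) := by
    intro v _
    rw [← xAris_eval, ← hp, hdiv v]
    have h1 : (((j+a)+1+v+k).factorial : ℝ) = (v + c) * (k+v+(j+a)).factorial := by
      rw [show j+a+1+v+k = (k+v+(j+a)) + 1 by ring, Nat.factorial_succ, hc]; push_cast; ring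
    rw [h1]
    have : (v:ℝ) + c ≠ 0 := by positivity
    have : ((k+v+(j+a)).factorial : ℝ) ≠ 0 := by positivity
    field_simp
  rw [Finset.sum_congr rfl hterm, Finset.sum_add_distrib, ← Finset.mul_sum, xA_inv k c hcp, hc, hp, xA_neg, ← hc]
  have hq0 : ∑ v ∈ Finset.range (k+1), (-1:ℝ)^v * (k.choose v) * q.eval (v:ℝ) = 0 := by
    rcases Nat.eq_zero_or_pos k with rfl | hk
    · have : q = 0 := by
        rw [hq, Polynomial.divByMonic_eq_zero_iff (Polynomial.monic_X_sub_C _)]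
        simp [hp, xAris]
      simp [this]
    · apply xA_alt
      rw [hq, Polynomial.natDegree_divByMonic _ (Polynomial.monic_X_sub_C _), Polynomial.natDegree_X_sub_C]
      have := xAris_deg ((j:ℝ)+1) k
      rw [hp]; omega
  rw [hq0, add_zero]
  have h2 : ∏ r ∈ Finset.range (k+1), (c + (r:ℝ)) = (j+a+1+2*k).factorial / (j+a+k).factorial := by
    have := xAris_eval (j+a+k) (k+1) 0
    rw [xAris, Polynomial.eval_prod] at this
    rw [show j+a+1+2*k = j+a+k+0+(k+1) by ring, show (j+a+k).factorial = (j+a+k+0).factorial by simp, ← this]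
    refine Finset.prod_congr rfl fun r _ => ?_
    rw [hc]; push_cast; simp; ring
  rw [h2]
  have : ((j+a+k).factorial : ℝ) ≠ 0 := by positivity
  have : ((j+a+1+2*k).factorial : ℝ) ≠ 0 := by positivity
  field_simp
noncomputable def xR (a b k : ℕ) (x : ℝ) : ℝ :=
  ∑ j ∈ Finset.range (k+1), ((k+a).choose (k-j) : ℝ) * ((k+b).choose j) * ((x-1)^j * x^(k-j))

noncomputable def xT (e b k : ℕ) (x : ℝ) : ℝ :=
  ∑ n ∈ Finset.range (k+1), (-1:ℝ)^n * ((k+b).choose (k-n)) * ((k+n+e).choose n) * x^n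

lemma xB_iter (F : Polynomial ℝ) (k : ℕ) (t : ℝ) :
    iteratedDeriv k (fun s => F.eval s) t = (Polynomial.derivative^[k] F).eval t := by
  induction k generalizing F with
  | zero => simp
  | succ k ih =>
    rw [iteratedDeriv_succ', Function.iterate_succ_apply, ← ih]
    congr 1
    ext s
    simp

lemma xB_jac (a b k : ℕ) (x : ℝ) (hx : (1-(2*x-1))^a * (1+(2*x-1))^b ≠ 0) :
    jacobiP a b k (2*x-1) = xR a b k x := by
  unfold jacobiP xR
  set t := 2*x-1 with ht
  have hF : (fun s : ℝ => (1-s)^a * (1+s)^b * (1-s^2)^k) = fun s =>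
      (Polynomial.C ((-1)^(a+k)) * ((Polynomial.X - Polynomial.C (1:ℝ))^(a+k) * (Polynomial.X + Polynomial.C (1:ℝ))^(b+k))).eval s := by
    ext s
    simp only [Polynomial.eval_mul, Polynomial.eval_pow, Polynomial.eval_C, Polynomial.eval_sub, Polynomial.eval_add, Polynomial.eval_X]
    rw [← mul_assoc, ← mul_pow, show -1 * (s - 1) = 1 - s by ring, show 1 - s^2 = (1-s)*(1+s) by ring, mul_pow, pow_add, pow_add, add_comm s 1]
    ring
  rw [hF, xB_iter, Polynomial.iterate_derivative_C_mul, Polynomial.iterate_derivative_mul,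
    Polynomial.eval_mul, Polynomial.eval_C, Polynomial.eval_finsetSum, Finset.mul_sum, Finset.mul_sum]
  refine Finset.sum_congr rfl fun j hj => ?_
  have hj' : j ≤ k := by simpa [Nat.lt_succ_iff] using hj
  obtain ⟨r, rfl⟩ := Nat.exists_eq_add_of_le hj'
  rw [Polynomial.iterate_derivative_X_add_pow, Polynomial.iterate_derivative_X_sub_pow,
    show j + r - j = r by omega, show a + (j+r) - r = a + j by omega, show b + (j+r) - j = b + r by omega]
  simp only [Polynomial.eval_mul, Polynomial.eval_pow, Polynomial.eval_C, Polynomial.eval_sub, Polynomial.eval_add, Polynomial.eval_X,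
    nsmul_eq_mul, Polynomial.eval_natCast]
  have h1 : ((j+r).choose j : ℝ) * ((a+(j+r)).descFactorial r) * ((b+(j+r)).descFactorial j)
      = ((j+r).factorial) * ((j+r+a).choose r) * ((j+r+b).choose j) := by
    rw [Nat.descFactorial_eq_factorial_mul_choose, Nat.descFactorial_eq_factorial_mul_choose]
    have := Nat.choose_mul_factorial_mul_factorial (Nat.le_add_right j r)
    rw [Nat.add_sub_cancel_left] at this
    rw [← this, add_comm a, add_comm b]; push_cast; ring
  have h2 : (t-1)^(a+j) = (-1)^a * (1-t)^a * (2^j * (x-1)^j) := by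
    rw [← mul_pow, ← mul_pow, pow_add, ht]; congr 2 <;> ring
  have h3 : (t+1)^(b+r) = (1+t)^b * (2^r * x^r) := by
    rw [← mul_pow, pow_add, ht]; congr 2 <;> ring
  have h4 : ((-1:ℝ)^(a+(j+r))) * (-1)^a * (-1)^(j+r) = 1 := by
    rw [pow_add]
    have : ∀ n : ℕ, (-1:ℝ)^n * (-1)^n = 1 := fun n => by rw [← mul_pow]; simp
    calc _ = ((-1:ℝ)^a * (-1)^a) * ((-1)^(j+r) * (-1)^(j+r)) := by ring
      _ = 1 := by rw [this, this]; simp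
  rw [h2, h3]
  set W := (1-t)^a with hW
  set V := (1+t)^b with hV
  have hW0 : W ≠ 0 := left_ne_zero_of_mul hx
  have hV0 : V ≠ 0 := right_ne_zero_of_mul hx
  have hk : ((j+r).factorial : ℝ) ≠ 0 := by positivity
  rw [div_mul_eq_mul_div, div_eq_iff (by positivity)]
  calc _ = (((-1:ℝ)^(a+(j+r))) * (-1)^a * (-1)^(j+r)) * (((j+r).choose j : ℝ) * ((a+(j+r)).descFactorial r) * ((b+(j+r)).descFactorial j)) * W * V * (2^j*2^r) * ((x-1)^j * x^r) := by ring
    _ = _ := by rw [h4, h1, ← pow_add]; ring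

lemma xB_RT (a b k : ℕ) (x : ℝ) : xR a b k x = (-1)^k * xT (a+b) b k x := by
  unfold xR xT
  have h1 : ∀ j ∈ Finset.range (k+1), ((k+a).choose (k-j) : ℝ) * ((k+b).choose j) * ((x-1)^j * x^(k-j))
      = ∑ r ∈ Finset.range (k+1), (-1)^r * x^(k-r) * (((k+a).choose (k-j) : ℝ) * ((k+b).choose j) * (j.choose r)) := by
    intro j hj
    have hj' : j ≤ k := by simpa [Nat.lt_succ_iff] using hj
    have : ∑ r ∈ Finset.range (k+1), (-1)^r * x^(k-r) * (((k+a).choose (k-j) : ℝ) * ((k+b).choose j) * (j.choose r))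
        = ∑ r ∈ Finset.range (j+1), (-1)^r * x^(k-r) * (((k+a).choose (k-j) : ℝ) * ((k+b).choose j) * (j.choose r)) := by
      symm
      apply Finset.sum_subset
      · intro r hr; simp at *; omega
      · intro r _ hr
        rw [Nat.choose_eq_zero_of_lt (show j < r by simpa using hr)]; simp
    rw [this, sub_eq_neg_add, add_pow, Finset.sum_mul, Finset.mul_sum]
    refine Finset.sum_congr rfl fun r hr => ?_
    have hr' : r ≤ j := by simpa [Nat.lt_succ_iff] using hr
    rw [show k - r = (j-r) + (k-j) by omega, pow_add]; ring
  rw [Finset.sum_congr rfl h1, Finset.sum_comm, Finset.mul_sum, ← Finset.sum_range_reflect]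
  refine Finset.sum_congr rfl fun n hn => ?_
  have hn' : n ≤ k := by simpa [Nat.lt_succ_iff] using hn
  obtain ⟨r, rfl⟩ := Nat.exists_eq_add_of_le hn'
  rw [show n + r + 1 - 1 - n = r by omega, show n + r - r = n by omega, show n + r - n = r by omega]
  rw [← Finset.mul_sum]
  have h2 : ∑ j ∈ Finset.range (n+r+1), ((n+r+a).choose (n+r-j)) * ((n+r+b).choose j) * (j.choose r)
      = ((n+r+b).choose r) * ((n+r+n+(a+b)).choose n) := by
    rw [show n+r+n+(a+b) = (n+b) + (n+r+a) by ring, Nat.add_choose_eq (n+b) (n+r+a), Finset.Nat.sum_antidiagonal_eq_sum_range_succ_mk, Finset.mul_sum,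
      show n+r+1 = r + (n+1) by ring, Finset.sum_range_add]
    rw [Finset.sum_eq_zero (s := Finset.range r), zero_add]
    · refine Finset.sum_congr rfl fun j hj => ?_
      have hj' : j ≤ n := by simpa [Nat.lt_succ_iff] using hj
      rw [mul_assoc, Nat.choose_mul (by omega), show n + r - (r+j) = n - j by omega, show r + j - r = j by omega,
        show n+r+b-r = n+b by omega]
      ring
    · intro j hj
      rw [Nat.choose_eq_zero_of_lt (show j < r by simpa using hj)]; simp
  have h3 : ∑ j ∈ Finset.range (n+r+1), ((n+r+a).choose (n+r-j) : ℝ) * ((n+r+b).choose j) * (j.choose r)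
      = ((n+r+b).choose r) * ((n+r+n+(a+b)).choose n) := by exact_mod_cast h2
  rw [h3]
  have h4 : (-1:ℝ)^r = (-1)^(n+r) * (-1)^n := by
    have : (-1:ℝ)^n * (-1)^n = 1 := by rw [← mul_pow]; simp
    rw [pow_add]; linear_combination (-(-1:ℝ)^r) * this
  rw [h4]; ring
lemma xT_zero (e b k : ℕ) : xT e b k 0 = (k+b).choose k := by
  unfold xT
  rw [Finset.sum_range_succ']
  simp

lemma xT_one (a b k : ℕ) : (xT (a+b) b k 1)^2 = ((k+a).choose k : ℝ)^2 := by
  have h := xB_RT a b k 1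
  have h2 : xR a b k 1 = (k+a).choose k := by
    unfold xR
    rw [Finset.sum_range_succ']
    simp
  rw [h2] at h
  rw [h, mul_pow, ← pow_mul, mul_comm k 2, pow_mul]; simp

noncomputable def xTc (e b k n : ℕ) : ℝ := (-1:ℝ)^n * ((k+b).choose (k-n)) * ((k+n+e).choose n)

noncomputable def xT1 (e b k : ℕ) (x : ℝ) : ℝ :=
  ∑ n ∈ Finset.range (k+1), xTc e b k n * (n * x^(n-1))

noncomputable def xT2 (e b k : ℕ) (x : ℝ) : ℝ :=
  ∑ n ∈ Finset.range (k+1), xTc e b k n * (n * (((n-1:ℕ):ℝ) * x^(n-1-1)))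

lemma xT_hd (e b k : ℕ) (x : ℝ) : HasDerivAt (xT e b k) (xT1 e b k x) x := by
  unfold xT xT1
  refine HasDerivAt.fun_sum fun n _ => ?_
  exact (hasDerivAt_pow n x).const_mul _

lemma xT1_hd (e b k : ℕ) (x : ℝ) : HasDerivAt (xT1 e b k) (xT2 e b k x) x := by
  unfold xT1 xT2
  refine HasDerivAt.fun_sum fun n _ => ?_
  exact ((hasDerivAt_pow (n-1) x).const_mul _).const_mul _

lemma xTc_rec (e b k n : ℕ) (hn : n < k) :
    xTc e b k (n+1) * ((n+1) * (n+1+b)) = xTc e b k n * ((n-k) * (n+k+e+1)) := by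
  obtain ⟨r, rfl⟩ := Nat.exists_eq_add_of_lt hn
  unfold xTc
  rw [show n + r + 1 - (n+1) = r by omega, show n + r + 1 - n = r+1 by omega]
  have h1 : (n+r+1+b).choose (r+1) * (r+1) = (n+r+1+b).choose r * (n+1+b) := by
    rw [Nat.choose_succ_right_eq]; congr 1; omega
  have h2 : (n+r+1+(n+1)+e).choose (n+1) * (n+1) = (n+r+1+(n+1)+e) * (n+r+1+n+e).choose n := by
    rw [show n+r+1+(n+1)+e = (n+r+1+n+e)+1 by ring, ← Nat.add_one_mul_choose_eq]
  have h1' : ((n+r+1+b).choose (r+1) : ℝ) * (r+1) = (n+r+1+b).choose r * (n+1+b) := by exact_mod_cast h1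
  have h2' : ((n+r+1+(n+1)+e).choose (n+1) : ℝ) * (n+1) = (n+r+1+(n+1)+e) * (n+r+1+n+e).choose n := by exact_mod_cast h2
  push_cast
  rw [pow_succ]
  calc _ = -(-1:ℝ)^n * (((n+r+1+b).choose r * (n+1+b)) * (((n+r+1+(n+1)+e).choose (n+1) : ℝ) * (n+1))) := by ring
    _ = _ := by rw [← h1', h2']; ring

lemma xT_ode (e b k : ℕ) (x : ℝ) :
    x*(1-x) * xT2 e b k x + ((b+1) - (e+2)*x) * xT1 e b k x + k*(k+e+1) * xT e b k x = 0 := by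
  have hT : xT e b k x = ∑ n ∈ Finset.range (k+1), xTc e b k n * x^n := rfl
  rw [hT]
  unfold xT1 xT2
  rw [Finset.mul_sum, Finset.mul_sum, Finset.mul_sum, ← Finset.sum_add_distrib, ← Finset.sum_add_distrib]
  have h1 : ∀ n ∈ Finset.range (k+1), x*(1-x) * (xTc e b k n * (n * (((n-1:ℕ):ℝ) * x^(n-1-1))))
      + ((b+1) - (e+2)*x) * (xTc e b k n * (n * x^(n-1))) + k*(k+e+1) * (xTc e b k n * x^n)
      = xTc e b k n * (n * (n+b)) * x^(n-1) - xTc e b k n * ((n-k)*(n+k+e+1)) * x^n := by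
    intro n _
    rcases n with _ | _ | n
    · simp; ring
    · simp; ring
    · rw [show n+1+1-1-1 = n by omega, show n+1+1-1 = n+1 by omega]
      push_cast; ring
  rw [Finset.sum_congr rfl h1, Finset.sum_sub_distrib, Finset.sum_range_succ', Finset.sum_range_succ (n := k), sub_eq_zero]
  simp only [Nat.cast_zero, zero_mul, mul_zero, add_zero, sub_self]
  refine Finset.sum_congr rfl fun n hn => ?_
  rw [← xTc_rec e b k n (Finset.mem_range.1 hn)]
  push_cast; simp

lemma xT_sup (a b k : ℕ) (hk : 1 ≤ k) (x : ℝ) (h0 : 0 ≤ x) (h1 : x ≤ 1) :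
    (xT (a+b) b k x)^2 ≤ max (((k+b).choose k : ℝ)^2) (((k+a).choose k : ℝ)^2) := by
  set e := a + b with he
  set K : ℝ := k*(k+e+1) with hK
  have hKp : 0 < K := by
    have : (0:ℝ) < k := by exact_mod_cast hk
    positivity
  set f : ℝ → ℝ := fun x => K * (xT e b k x)^2 + x*(1-x) * (xT1 e b k x)^2 with hf
  have hd : ∀ x, HasDerivAt f ((xT1 e b k x)^2 * (2*(e+1)*x - (2*b+1))) x := by
    intro x
    have d1 := ((xT_hd e b k x).pow 2).const_mul K
    have d2 := ((hasDerivAt_id x).mul ((hasDerivAt_const x (1:ℝ)).sub (hasDerivAt_id x))).mul ((xT1_hd e b k x).pow 2)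
    have d3 := d1.add d2
    refine d3.congr_deriv ?_
    have ho := xT_ode e b k x
    rw [← hK] at ho
    simp
    linear_combination (2 * xT1 e b k x) * ho
  have hfc : Continuous f := continuous_iff_continuousAt.2 fun x => (hd x).continuousAt
  have hfd : Differentiable ℝ f := fun x => (hd x).differentiableAt
  have hfx : K * (xT e b k x)^2 ≤ f x := by
    have : 0 ≤ x*(1-x) * (xT1 e b k x)^2 := mul_nonneg (mul_nonneg h0 (by linarith)) (sq_nonneg _)
    simp only [hf]; linarith
  have hf0 : f 0 = K * ((k+b).choose k : ℝ)^2 := by simp [hf, xT_zero]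
  have hf1 : f 1 = K * ((k+a).choose k : ℝ)^2 := by simp [hf, he, xT_one]
  have hmax : f x ≤ max (f 0) (f 1) := by
    rcases le_total (2*((e:ℝ)+1)*x) (2*b+1) with hx | hx
    · apply le_max_of_le_left
      have : AntitoneOn f (Set.Icc 0 x) := by
        apply antitoneOn_of_deriv_nonpos (convex_Icc _ _) hfc.continuousOn hfd.differentiableOn
        intro y hy
        rw [interior_Icc] at hy
        rw [(hd y).deriv]
        refine mul_nonpos_of_nonneg_of_nonpos (sq_nonneg _) ?_
        have : 2*((e:ℝ)+1)*y ≤ 2*((e:ℝ)+1)*x := mul_le_mul_of_nonneg_left hy.2.le (by positivity)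
        linarith
      exact this ⟨le_refl _, h0⟩ ⟨h0, le_refl _⟩ h0
    · apply le_max_of_le_right
      have : MonotoneOn f (Set.Icc x 1) := by
        apply monotoneOn_of_deriv_nonneg (convex_Icc _ _) hfc.continuousOn hfd.differentiableOn
        intro y hy
        rw [interior_Icc] at hy
        rw [(hd y).deriv]
        refine mul_nonneg (sq_nonneg _) ?_
        have : 2*((e:ℝ)+1)*x ≤ 2*((e:ℝ)+1)*y := mul_le_mul_of_nonneg_left hy.1.le (by positivity)
        linarith
      exact this ⟨le_refl _, h1⟩ ⟨h1, le_refl _⟩ h1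
  rw [hf0, hf1, ← mul_max_of_nonneg _ _ hKp.le] at hmax
  exact le_of_mul_le_mul_left (hfx.trans hmax) hKp

/-- squared normalization constant -/
noncomputable def xN (a b k : ℕ) : ℝ :=
  ((2*k+(a+b+1)) * k.factorial * (k+a+b).factorial : ℝ) / ((k+a).factorial * (k+b).factorial) * (a.factorial * b.factorial)

lemma xN_pos (a b k : ℕ) : 0 < xN a b k := by unfold xN; positivity

lemma xN_symm (a b k : ℕ) : xN a b k = xN b a k := by
  unfold xN; rw [show k + a + b = k+b+a by ring]; ring

lemma xN_bound (a b k : ℕ) : xN a b k * ((k+b).choose k : ℝ)^2 ≤ 2 * (a+b+1).factorial * ((k+(a+b+1) : ℕ) : ℝ)^(2*(a+b+1)-1) := by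
  have hc : ((k+b).choose k : ℝ) = (k+b).factorial / (k.factorial * b.factorial) := by
    rw [Nat.cast_add_choose]
  set D : ℝ := ((k+(a+b+1) : ℕ) : ℝ) with hD
  have hD1 : 1 ≤ D := by rw [hD]; exact_mod_cast (by omega)
  have f1 : ((k+a+b).factorial : ℝ) ≤ (k+a).factorial * D^b := by
    rw [← Nat.factorial_mul_ascFactorial]; push_cast
    refine mul_le_mul_of_nonneg_left ?_ (by positivity)
    have := Nat.ascFactorial_le_pow_add (k+a) b
    calc ((((k+a+1).ascFactorial b : ℕ)) : ℝ) ≤ (((k+a+b)^b : ℕ) : ℝ) := by exact_mod_cast this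
      _ ≤ D^b := by push_cast; rw [hD]; push_cast; exact pow_le_pow_left₀ (by positivity) (by linarith) _
  have f2 : ((k+b).factorial : ℝ) ≤ k.factorial * D^b := by
    rw [← Nat.factorial_mul_ascFactorial]; push_cast
    refine mul_le_mul_of_nonneg_left ?_ (by positivity)
    have := Nat.ascFactorial_le_pow_add k b
    calc ((((k+1).ascFactorial b : ℕ)) : ℝ) ≤ (((k+b)^b : ℕ) : ℝ) := by exact_mod_cast this
      _ ≤ D^b := by push_cast; rw [hD]; push_cast; gcongr; linarith [(Nat.cast_nonneg a : (0:ℝ) ≤ a)]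
  have f3 : (a.factorial : ℝ) ≤ (a+b+1).factorial * b.factorial := by
    have h1 : a.factorial ≤ (a+b+1).factorial := Nat.factorial_le (by omega)
    have h2 : 1 ≤ b.factorial := Nat.factorial_pos b
    exact_mod_cast h1.trans (Nat.le_mul_of_pos_right _ h2)
  have f4 : (2*k+(a+b+1) : ℝ) ≤ 2 * D := by rw [hD]; push_cast; linarith [(Nat.cast_nonneg a : (0:ℝ) ≤ a), (Nat.cast_nonneg b : (0:ℝ) ≤ b)]
  have heq : xN a b k * ((k+b).choose k : ℝ)^2 = (2*k+(a+b+1)) * ((k+a+b).factorial / (k+a).factorial) * ((k+b).factorial / k.factorial) * (a.factorial / b.factorial) := by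
    rw [hc]; unfold xN
    have : (k.factorial : ℝ) ≠ 0 := by positivity
    have : (b.factorial : ℝ) ≠ 0 := by positivity
    have : ((k+a).factorial : ℝ) ≠ 0 := by positivity
    have : ((k+b).factorial : ℝ) ≠ 0 := by positivity
    field_simp
  rw [heq]
  have g1 : ((k+a+b).factorial : ℝ) / (k+a).factorial ≤ D^b := by rw [div_le_iff₀' (by positivity)]; exact f1
  have g2 : ((k+b).factorial : ℝ) / k.factorial ≤ D^b := by rw [div_le_iff₀' (by positivity)]; exact f2
  have g3 : (a.factorial : ℝ) / b.factorial ≤ (a+b+1).factorial := by rw [div_le_iff₀ (by positivity)]; exact f3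
  calc _ ≤ (2 * D) * D^b * D^b * (a+b+1).factorial := by gcongr
    _ = 2 * (a+b+1).factorial * D^(2*b+1) := by ring
    _ ≤ _ := by
      gcongr
      omega

lemma xphi_sq (a b k : ℕ) (x : ℝ) : (phiB (a+b+1) (b+1) k x)^2 = xN a b k * (jacobiP a b k (2*x-1))^2 := by
  unfold phiB xN
  rw [show a+b+1-(b+1) = a by omega, show b+1-1 = b by omega, show k+(a+b+1)-1 = k+a+b by omega,
    show k+(a+b+1)-(b+1) = k+a by omega, show k+(b+1)-1 = k+b by omega]
  rw [mul_pow, mul_pow, Real.sq_sqrt (by positivity), Real.sq_sqrt (by positivity)]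
  push_cast; ring

lemma xphi_sup (a b k : ℕ) (hk : 1 ≤ k) (x : ℝ) (h0 : 0 ≤ x) (h1 : x ≤ 1) :
    (phiB (a+b+1) (b+1) k x)^2 ≤ 2 * (a+b+1).factorial * ((k+(a+b+1) : ℕ) : ℝ)^(2*(a+b+1)-1) := by
  rw [xphi_sq]
  by_cases hw : (1-(2*x-1))^a * (1+(2*x-1))^b = 0
  · have : jacobiP a b k (2*x-1) = 0 := by unfold jacobiP; rw [hw]; simp
    rw [this]; simp; positivity
  · rw [xB_jac a b k x hw, xB_RT, mul_pow, ← pow_mul, mul_comm k 2, pow_mul]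
    simp only [even_two, Even.neg_pow, one_pow, one_mul]
    have h := mul_le_mul_of_nonneg_left (xT_sup a b k hk x h0 h1) (xN_pos a b k).le
    refine h.trans ?_
    rw [mul_max_of_nonneg _ _ (xN_pos a b k).le]
    apply max_le (xN_bound a b k)
    have := xN_bound b a k
    rw [xN_symm, add_comm b a] at this
    exact this

lemma xphi_eq (a b k : ℕ) (x : ℝ) (h0 : x ≠ 0) (h1 : x ≠ 1) :
    phiB (a+b+1) (b+1) k x = √(xN a b k) * ((-1)^k * xT (a+b) b k x) := by
  rw [← xB_RT, ← xB_jac]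
  · unfold phiB xN
    rw [show a+b+1-(b+1) = a by omega, show b+1-1 = b by omega, show k+(a+b+1)-1 = k+a+b by omega,
      show k+(a+b+1)-(b+1) = k+a by omega, show k+(b+1)-1 = k+b by omega, ← Real.sqrt_mul (by positivity)]
    push_cast; rfl
  · apply mul_ne_zero <;> apply pow_ne_zero
    · intro h; apply h1; linarith
    · intro h; apply h0; linarith

def xS (d : ℕ) (t : ℝ) : Set (Fin d → ℝ) :=
  {x | (∀ i, 0 ≤ x i ∧ x i ≤ t) ∧ ∀ i j : Fin d, i ≤ j → x i ≤ x j}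

lemma xS_one (d : ℕ) : simplexD d = xS d 1 := by
  ext x; simp [simplexD, xS]

lemma xS_closed (d : ℕ) (t : ℝ) : IsClosed (xS d t) := by
  have : xS d t = (⋂ i, {x | 0 ≤ x i} ∩ {x | x i ≤ t}) ∩ ⋂ i, ⋂ j, ⋂ (_ : i ≤ j), {x | x i ≤ x j} := by
    ext x; simp [xS]
  rw [this]
  refine IsClosed.inter (isClosed_iInter fun i => IsClosed.inter ?_ ?_) (isClosed_iInter fun i => isClosed_iInter fun j => isClosed_iInter fun _ => ?_)
  · exact isClosed_le continuous_const (continuous_apply i)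
  · exact isClosed_le (continuous_apply i) continuous_const
  · exact isClosed_le (continuous_apply i) (continuous_apply j)

lemma xS_compact (d : ℕ) (t : ℝ) : IsCompact (xS d t) := by
  refine IsCompact.of_isClosed_subset (isCompact_univ_pi (fun _ : Fin d => isCompact_Icc (a := (0:ℝ)) (b := t))) (xS_closed d t) ?_
  intro x hx i _
  exact hx.1 i

lemma xS_snoc (d : ℕ) (t s : ℝ) (y : Fin d → ℝ) :
    (Fin.snoc y s : Fin (d+1) → ℝ) ∈ xS (d+1) t ↔ s ∈ Set.Icc 0 t ∧ y ∈ xS d s := by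
  simp only [xS, Set.mem_ofPred_eq, Fin.forall_fin_succ', Fin.snoc_castSucc, Fin.snoc_last, Set.mem_Icc]
  constructor
  · rintro ⟨⟨h1, h2⟩, h3, h4⟩
    exact ⟨h2, fun i => ⟨(h1 i).1, (h3 i).2 (Fin.le_last _)⟩, fun i j hij => (h3 i).1 j (by simpa using hij)⟩
  · rintro ⟨h2, h1, h3⟩
    refine ⟨⟨fun i => ⟨(h1 i).1, (h1 i).2.trans h2.2⟩, h2⟩, fun i => ⟨fun j hij => h3 i j (by simpa using hij), fun _ => (h1 i).2⟩, fun j hj => ?_, fun _ => le_refl _⟩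
    exact absurd hj (by simp [Fin.le_def]; )

noncomputable def xE (e : ℕ → ℕ) (D : ℕ) : ℕ := ∑ r ∈ Finset.range D, (e r + 1)

lemma xD_int (e : ℕ → ℕ) (d : ℕ) : ∀ t : ℝ, 0 ≤ t →
    ∫ x in xS d t, ∏ i : Fin d, x i ^ e i = t ^ xE e d / ∏ r ∈ Finset.range d, (xE e (r+1) : ℝ) := by
  induction d with
  | zero =>
    intro t _
    have : xS 0 t = Set.univ := by ext x; simp [xS]
    rw [this, volume_pi, Measure.pi_of_empty]
    simp [xE]
  | succ d ih =>
    intro t ht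
    have hmp := (volume_preserving_piFinSuccAbove (fun _ : Fin (d+1) => ℝ) (Fin.last d)).symm
    set F : (Fin (d+1) → ℝ) → ℝ := fun x => ∏ i : Fin (d+1), x i ^ e i with hF
    have hFc : Continuous F := by fun_prop
    have hFi : Integrable ((xS (d+1) t).indicator F) volume :=
      (integrable_indicator_iff (xS_closed _ _).measurableSet).2 (hFc.continuousOn.integrableOn_compact (xS_compact _ _))
    rw [← integral_indicator (xS_closed _ _).measurableSet, ← hmp.integral_comp' (g := (xS (d+1) t).indicator F)]
    rw [Measure.volume_eq_prod, integral_prod]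
    rotate_left
    · exact (hmp.integrable_comp_emb (MeasurableEquiv.measurableEmbedding _)).2 hFi
    have hin : ∀ s : ℝ, ∫ y : Fin d → ℝ, (xS (d+1) t).indicator F ((MeasurableEquiv.piFinSuccAbove (fun _ : Fin (d+1) => ℝ) (Fin.last d)).symm (s, y))
        = (Set.Icc 0 t).indicator (fun s => s^(e d + xE e d) / ∏ r ∈ Finset.range d, (xE e (r+1) : ℝ)) s := by
      intro s
      have hs : ∀ y : Fin d → ℝ, (MeasurableEquiv.piFinSuccAbove (fun _ : Fin (d+1) => ℝ) (Fin.last d)).symm (s, y) = Fin.snoc y s := by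
        intro y
        simp [MeasurableEquiv.piFinSuccAbove, Fin.insertNthEquiv]
      simp_rw [hs]
      by_cases hst : s ∈ Set.Icc 0 t
      · rw [Set.indicator_of_mem hst]
        have : ∀ y : Fin d → ℝ, (xS (d+1) t).indicator F (Fin.snoc y s) = (xS d s).indicator (fun y => s^(e d) * ∏ i : Fin d, y i ^ e i) y := by
          intro y
          by_cases hy : y ∈ xS d s
          · rw [Set.indicator_of_mem hy, Set.indicator_of_mem ((xS_snoc d t s y).2 ⟨hst, hy⟩)]
            simp [hF, Fin.prod_univ_castSucc, mul_comm]
          · rw [Set.indicator_of_notMem hy, Set.indicator_of_notMem (fun h => hy ((xS_snoc d t s y).1 h).2)]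
        simp_rw [this]
        rw [integral_indicator (xS_closed _ _).measurableSet, integral_const_mul, ih s hst.1, pow_add]
        ring
      · rw [Set.indicator_of_notMem hst]
        have : ∀ y : Fin d → ℝ, (xS (d+1) t).indicator F (Fin.snoc y s) = 0 := by
          intro y
          rw [Set.indicator_of_notMem (fun h => hst ((xS_snoc d t s y).1 h).1)]
        simp_rw [this]; simp
    simp_rw [hin]
    rw [integral_indicator measurableSet_Icc, integral_Icc_eq_integral_Ioc, ← intervalIntegral.integral_of_le ht,
      intervalIntegral.integral_div, integral_pow]
    have hE : xE e (d+1) = e d + xE e d + 1 := by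
      unfold xE; rw [Finset.sum_range_succ]; ring
    rw [Finset.prod_range_succ, hE]
    push_cast
    simp only [ne_eq, Nat.add_eq_zero_iff, one_ne_zero, and_false, not_false_eq_true, zero_pow, sub_zero]
    rw [div_div, mul_comm (_ + _ + 1 : ℝ)]

lemma xD_prod (i j n l : ℕ) (hij : i ≤ j) (d : ℕ) (hd : j ≤ d) :
    (∏ r ∈ Finset.range d, (xE (fun r => (if r = i then n else 0) + (if r = j then l else 0)) (r+1) : ℝ))
     = i.factorial * ((j+n).factorial / (i+n).factorial) * ((d+n+l).factorial / (j+n+l).factorial) := by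
  set e : ℕ → ℕ := fun r => (if r = i then n else 0) + (if r = j then l else 0)
  have hE : ∀ D, xE e D = D + (if i < D then n else 0) + (if j < D then l else 0) := by
    intro D
    unfold xE
    induction D with
    | zero => simp
    | succ D ih =>
      rw [Finset.sum_range_succ, ih]
      simp only [e]
      split_ifs <;> omega
  have s1 : ∀ D, D ≤ i → (∏ r ∈ Finset.range D, (xE e (r+1) : ℝ)) = D.factorial := by
    intro D
    induction D with
    | zero => simp
    | succ D ih =>
      intro h
      rw [Finset.prod_range_succ, ih (by omega), hE, if_neg (by omega), if_neg (by omega), Nat.factorial_succ]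
      push_cast; ring
  have s2 : ∀ D, i ≤ D → D ≤ j → (∏ r ∈ Finset.range D, (xE e (r+1) : ℝ)) = i.factorial * ((D+n).factorial / (i+n).factorial) := by
    intro D hD
    induction D, hD using Nat.le_induction with
    | base => intro _; rw [s1 i le_rfl, div_self (by positivity), mul_one]
    | succ D hD ih =>
      intro h
      rw [Finset.prod_range_succ, ih (by omega), hE, if_pos (by omega), if_neg (by omega), show D+1+n = D+n+1 by ring, Nat.factorial_succ]
      push_cast; ring
  induction d, hd using Nat.le_induction with
  | base => rw [s2 j hij le_rfl, div_self (a := ((j+n+l).factorial : ℝ)) (by positivity), mul_one]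
  | succ D hD ih =>
    rw [Finset.prod_range_succ, ih, hE, if_pos (by omega), if_pos (by omega), show D+1+n+l = D+n+l+1 by ring, Nat.factorial_succ]
    push_cast; ring

lemma xD_moment (d : ℕ) (i j : Fin d) (hij : i ≤ j) (n l : ℕ) :
    ∫ x in simplexD d, x i ^ n * x j ^ l =
      ((i.1+n).factorial / i.1.factorial : ℝ) * ((j.1+n+l).factorial / (j.1+n).factorial) / (d+n+l).factorial := by
  have h := xD_int (fun r => (if r = i.1 then n else 0) + (if r = j.1 then l else 0)) d 1 zero_le_one
  rw [xD_prod i j n l hij d j.2.le] at h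
  have h2 : ∀ x : Fin d → ℝ, ∏ r : Fin d, x r ^ ((if r.1 = i.1 then n else 0) + (if r.1 = j.1 then l else 0)) = x i ^ n * x j ^ l := by
    intro x
    simp_rw [pow_add, Finset.prod_mul_distrib, Fin.val_inj]
    congr 1
    · rw [Finset.prod_eq_single i] <;> simp +contextual
    · rw [Finset.prod_eq_single j] <;> simp +contextual
  simp_rw [h2] at h
  rw [xS_one, h, one_pow]
  have : (i.1.factorial : ℝ) ≠ 0 := by positivity
  have : ((i.1+n).factorial : ℝ) ≠ 0 := by positivity
  have : ((j.1+n).factorial : ℝ) ≠ 0 := by positivity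
  have : ((j.1+n+l).factorial : ℝ) ≠ 0 := by positivity
  have : ((d+n+l).factorial : ℝ) ≠ 0 := by positivity
  field_simp

lemma xTc_eq (e b k n : ℕ) (hn : n ≤ k) : xTc e b k n =
    (-1:ℝ)^n * (k.choose n) * (((k+b).factorial : ℝ) / (k.factorial * (b+n).factorial) * ((k+n+e).factorial / (k+e).factorial)) := by
  obtain ⟨r, rfl⟩ := Nat.exists_eq_add_of_le hn
  unfold xTc
  rw [show n+r-n = r by omega, show n+r+b = r+(b+n) by ring, show n+r+n+e = n+(n+r+e) by ring,
    Nat.cast_add_choose, Nat.cast_add_choose, Nat.cast_add_choose]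
  have : (n.factorial : ℝ) ≠ 0 := by positivity
  have : (r.factorial : ℝ) ≠ 0 := by positivity
  have : ((n+r).factorial : ℝ) ≠ 0 := by positivity
  have : ((b+n).factorial : ℝ) ≠ 0 := by positivity
  field_simp

noncomputable def xM (e i n j l : ℕ) : ℝ :=
  ((i+n).factorial / i.factorial : ℝ) * ((j+n+l).factorial / (j+n).factorial) / (e+1+n+l).factorial

lemma xE1_term (e i j k l n : ℕ) (hn : n ≤ k) : xTc e i k n * xM e i n j l =
    ((k+i).factorial / (k.factorial * (k+e).factorial * i.factorial) : ℝ) * ((-1:ℝ)^n * (k.choose n) *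
      ((((k+n+e).factorial : ℝ) / (e+1+n+l).factorial) * (((j+n+l).factorial : ℝ) / (j+n).factorial))) := by
  rw [xTc_eq e i k n hn]; unfold xM
  have : ((i+n).factorial : ℝ) ≠ 0 := by positivity
  field_simp

lemma xE1 (e i j k l : ℕ) (hl : l < k) :
    ∑ n ∈ Finset.range (k+1), xTc e i k n * xM e i n j l = 0 := by
  rw [Finset.sum_congr rfl fun n hn => xE1_term e i j k l n (by simpa [Nat.lt_succ_iff] using hn), ← Finset.mul_sum,
    xA_S0 k e j l hl, mul_zero]

lemma xE1' (a i j k : ℕ) :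
    ∑ n ∈ Finset.range (k+1), xTc (j+a) i k n * xM (j+a) i n j k =
     ((k+i).factorial / i.factorial : ℝ) * ((-1)^k * ((a+k).factorial / a.factorial : ℝ)) / (j+a+1+2*k).factorial := by
  rw [Finset.sum_congr rfl fun n hn => xE1_term (j+a) i j k k n (by simpa [Nat.lt_succ_iff] using hn), ← Finset.mul_sum,
    xA_S1 k a j, add_comm k (j+a)]
  have : (k.factorial : ℝ) ≠ 0 := by positivity
  have : ((j+a+k).factorial : ℝ) ≠ 0 := by positivity
  field_simp

lemma xE2 (e i j n l : ℕ) (hl : n < l) :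
    ∑ v ∈ Finset.range (l+1), xTc e j l v * xM e i n j v = 0 := by
  have ht : ∀ v ∈ Finset.range (l+1), xTc e j l v * xM e i n j v =
     ((l+j).factorial / (l.factorial * (l+e).factorial) * ((i+n).factorial / (i.factorial * (j+n).factorial)) : ℝ) * ((-1:ℝ)^v * (l.choose v) *
      ((((l+v+e).factorial : ℝ) / (e+1+v+n).factorial) * (((j+v+n).factorial : ℝ) / (j+v).factorial))) := by
    intro v hv
    rw [xTc_eq e j l v (by simpa [Nat.lt_succ_iff] using hv)]; unfold xM
    rw [show e+1+n+v = e+1+v+n by ring, show j+n+v = j+v+n by ring]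
    field_simp
  rw [Finset.sum_congr rfl ht, ← Finset.mul_sum, xA_S0 l e j n hl, mul_zero]

lemma xInt_cont (d : ℕ) (F : (Fin d → ℝ) → ℝ) (hF : Continuous F) : IntegrableOn F (simplexD d) := by
  rw [xS_one]
  exact hF.continuousOn.integrableOn_compact (xS_compact _ _)

lemma xE_expand (e : ℕ) (i j : Fin (e+1)) (hij : i ≤ j) (k l : ℕ) :
    ∫ x in simplexD (e+1), xT e i k (x i) * xT e j l (x j) =
      ∑ v ∈ Finset.range (l+1), xTc e j l v * ∑ n ∈ Finset.range (k+1), xTc e i k n * xM e i n j v := by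
  have h1 : ∀ x : Fin (e+1) → ℝ, xT e i k (x i) * xT e j l (x j) =
      ∑ v ∈ Finset.range (l+1), ∑ n ∈ Finset.range (k+1), xTc e j l v * xTc e i k n * (x i ^ n * x j ^ v) := by
    intro x
    have e1 : xT e i k (x i) = ∑ n ∈ Finset.range (k+1), xTc e i k n * x i ^ n := rfl
    have e2 : xT e j l (x j) = ∑ n ∈ Finset.range (l+1), xTc e j l n * x j ^ n := rfl
    rw [e1, e2, mul_comm, Finset.sum_mul_sum]
    refine Finset.sum_congr rfl fun v _ => Finset.sum_congr rfl fun n _ => ?_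
    ring
  simp_rw [h1]
  rw [integral_finsetSum]
  · refine Finset.sum_congr rfl fun v _ => ?_
    rw [integral_finsetSum, Finset.mul_sum]
    · refine Finset.sum_congr rfl fun n _ => ?_
      rw [integral_const_mul, xD_moment (e+1) i j hij]
      unfold xM; ring
    · intro n _; exact xInt_cont _ _ (by fun_prop)
  · intro v _; exact xInt_cont _ _ (by fun_prop)

lemma xE_orth (e : ℕ) (i j : Fin (e+1)) (hij : i ≤ j) (k l : ℕ) (hkl : k ≠ l) :
    ∫ x in simplexD (e+1), xT e i k (x i) * xT e j l (x j) = 0 := by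
  rw [xE_expand e i j hij]
  rcases lt_or_gt_of_ne hkl with h | h
  · simp_rw [Finset.mul_sum]
    rw [Finset.sum_comm]
    refine Finset.sum_eq_zero fun n hn => ?_
    have hn' : n ≤ k := by simpa [Nat.lt_succ_iff] using hn
    have := xE2 e i j n l (by omega)
    calc _ = xTc e i k n * ∑ v ∈ Finset.range (l+1), xTc e j l v * xM e i n j v := by
          rw [Finset.mul_sum]; exact Finset.sum_congr rfl fun v _ => by ring
      _ = 0 := by rw [this, mul_zero]
  · refine Finset.sum_eq_zero fun v hv => ?_
    have hv' : v ≤ l := by simpa [Nat.lt_succ_iff] using hv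
    rw [xE1 e i j k v (by omega), mul_zero]

/-- rising quotient -/
noncomputable def xP (k i : ℕ) : ℝ := (k+i).factorial / i.factorial

lemma xP_pos (k i : ℕ) : 0 < xP k i := by unfold xP; positivity

noncomputable def xCc (e k : ℕ) : ℝ := (2*k+e+1) * k.factorial * (k+e).factorial

lemma xCc_pos (e k : ℕ) : 0 < xCc e k := by unfold xCc; positivity

lemma xE_gram (e : ℕ) (i j : Fin (e+1)) (hij : i ≤ j) (k : ℕ) :
    ∫ x in simplexD (e+1), xT e i k (x i) * xT e j k (x j) = xP k i * xP k (e-j) / xCc e k := by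
  rw [xE_expand e i j hij, Finset.sum_range_succ, Finset.sum_eq_zero, zero_add]
  · obtain ⟨a, ha⟩ := Nat.exists_eq_add_of_le (Nat.lt_succ_iff.1 j.2)
    have h := xE1' a i j k
    rw [← ha] at h
    rw [h, show e - (j:ℕ) = a by omega]
    unfold xTc xP xCc
    rw [show k - k = 0 by simp, show k+k+e = k+(k+e) by ring, Nat.cast_add_choose, show e+1+2*k = k+(k+e)+1 by ring, Nat.factorial_succ, add_comm a k]
    have h2 : (-1:ℝ)^k * (-1)^k = 1 := by rw [← mul_pow]; simp
    have : (k.factorial : ℝ) ≠ 0 := by positivity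
    have : ((k+(k+e)).factorial : ℝ) ≠ 0 := by positivity
    have : ((k+e).factorial : ℝ) ≠ 0 := by positivity
    have : ((2:ℝ)*k+e+1) ≠ 0 := by positivity
    have h3 : (((k+(k+e)+1 : ℕ) : ℝ)) = 2*k+e+1 := by push_cast; ring
    rw [Nat.cast_mul, h3]
    simp only [Nat.choose_zero_right, Nat.cast_one, mul_one]
    field_simp
    linear_combination h2
  · intro v hv
    rw [xE1 e i j k v (Finset.mem_range.1 hv), mul_zero]

lemma xF_aux (s w : ℕ → ℝ) (d : ℕ) (hs : ∀ i, i < d → 0 < s i)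
    (hr : ∀ i, i + 1 < d → s i * ((i+2) * (d-i)) ≤ s (i+1) * ((i+1)*(d-i-1))) :
    ∀ n l, l + (n+1) = d →
     d * s l * (l/(l+1)) * (∑ i ∈ Finset.range (n+1), w (l+i))^2 ≤
      d * (∑ i ∈ Finset.range (n+1), ∑ j ∈ Finset.range (n+1), w (l+i) * w (l+j) * s (l + min i j))
        - ∑ i ∈ Finset.range (n+1), s (l+i) * (w (l+i))^2 := by
  intro n
  induction n with
  | zero =>
    intro l hl
    have : (d:ℝ) = l + 1 := by rw [← hl]; push_cast; ring
    simp [this]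
    apply le_of_eq
    field_simp
    ring
  | succ n ih =>
    intro l hl
    have IH := ih (l+1) (by omega)
    set V' := ∑ i ∈ Finset.range (n+1), w (l+1+i) with hV'
    set Q' := ∑ i ∈ Finset.range (n+1), ∑ j ∈ Finset.range (n+1), w (l+1+i) * w (l+1+j) * s (l + 1+ min i j) with hQ'
    set R' := ∑ i ∈ Finset.range (n+1), s (l+1+i) * (w (l+1+i))^2 with hR'
    have hV : ∑ i ∈ Finset.range (n+1+1), w (l+i) = V' + w l := by
      rw [Finset.sum_range_succ', hV']; congr 1
      refine Finset.sum_congr rfl fun i _ => by congr 1; ring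
    have hR : ∑ i ∈ Finset.range (n+1+1), s (l+i) * (w (l+i))^2 = R' + s l * (w l)^2 := by
      rw [Finset.sum_range_succ', hR']; congr 1
      refine Finset.sum_congr rfl fun i _ => by rw [show l + (i+1) = l+1+i by ring]
    have hQ : ∑ i ∈ Finset.range (n+1+1), ∑ j ∈ Finset.range (n+1+1), w (l+i) * w (l+j) * s (l + min i j)
        = Q' + 2 * s l * w l * V' + s l * (w l)^2 := by
      rw [Finset.sum_range_succ']
      have a1 : ∀ i ∈ Finset.range (n+1), ∑ j ∈ Finset.range (n+1+1), w (l+(i+1)) * w (l+j) * s (l + min (i+1) j)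
         = (∑ j ∈ Finset.range (n+1), w (l+1+i) * w (l+1+j) * s (l + 1+ min i j)) + w (l+1+i) * (w l * s l) := by
        intro i _
        rw [Finset.sum_range_succ']
        congr 1
        · refine Finset.sum_congr rfl fun j _ => ?_
          rw [show l + (i+1) = l+1+i by ring, show l + (j+1) = l+1+j by ring, show l + min (i+1) (j+1) = l+1+min i j by omega]
        · rw [show l + (i+1) = l+1+i by ring]; simp; ring
      rw [Finset.sum_congr rfl a1, Finset.sum_add_distrib, ← hQ', ← Finset.sum_mul, ← hV', Finset.sum_range_succ']
      have a2 : ∀ j ∈ Finset.range (n+1), w (l+0) * w (l+(j+1)) * s (l + min 0 (j+1)) = (w l * s l) * w (l+1+j) := by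
        intro j _
        rw [show l + (j+1) = l+1+j by ring]; simp; ring
      rw [Finset.sum_congr rfl a2, ← Finset.mul_sum, ← hV']
      simp; ring
    rw [hV, hR, hQ]
    set A : ℝ := (l:ℝ)+1 with hA
    set B : ℝ := (n:ℝ)+1 with hB
    have hd : (d:ℝ) = A + B := by rw [← hl]; push_cast; rw [hA, hB]; ring
    have hAp : 0 < A := by positivity
    have hBp : 0 < B := by positivity
    have hsl := hs l (by omega)
    have h1 := hr l (by omega)
    have h1' : s l * ((A+1)*(B+1)) ≤ s (l+1) * (A*B) := by
      convert h1 using 2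
      · rw [hd, hA]; ring
      · rw [hd, hA]; ring
    push_cast at IH
    rw [← hA] at IH
    have h2 : s l * ((B+1)/B) ≤ s (l+1) * (A/(A+1)) := by
      rw [mul_div_assoc', mul_div_assoc', div_le_div_iff₀ hBp (by positivity)]
      linarith
    have h3 : d * (s l * ((B+1)/B)) * V'^2 ≤ d * s (l+1) * (A/(A+1)) * V'^2 := by
      rw [mul_assoc (d:ℝ) (s (l+1))]
      gcongr
    have h4 : 0 ≤ s l * ((A*V' + B*(V' + w l))^2/(A*B)) := by positivity
    have h5 : d * (s l * ((B+1)/B)) * V'^2 + d * (2 * s l * w l * V' + s l * (w l)^2) - s l * (w l)^2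
       - d * s l * (l/A) * (V' + w l)^2 = s l * ((A*V' + B*(V' + w l))^2/(A*B)) := by
      rw [hd, show (l:ℝ) = A - 1 by rw [hA]; ring]
      field_simp
      ring
    linarith

lemma xF_quad (s w : ℕ → ℝ) (d : ℕ) (hs : ∀ i, i < d → 0 < s i)
    (hr : ∀ i, i + 1 < d → s i * ((i+2) * (d-i)) ≤ s (i+1) * ((i+1)*(d-i-1))) :
    ∑ i ∈ Finset.range d, s i * (w i)^2 ≤
      d * (∑ i ∈ Finset.range d, ∑ j ∈ Finset.range d, w i * w j * s (min i j)) := by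
  rcases d with _ | n
  · simp
  · have := xF_aux s w (n+1) hs hr n 0 (by omega)
    simp only [zero_add, Nat.cast_zero, zero_div, mul_zero, zero_mul] at this
    linarith

lemma xN_eq (e i k : ℕ) (hi : i ≤ e) : xN (e-i) i k = xCc e k / (xP k (e-i) * xP k i) := by
  obtain ⟨a, rfl⟩ := Nat.exists_eq_add_of_le hi
  rw [Nat.add_sub_cancel_left]
  unfold xN xCc xP
  rw [show k + a + i = k + (i+a) by ring]
  have : (k.factorial : ℝ) ≠ 0 := by positivity
  push_cast
  field_simp
  ring

noncomputable def xPhi (e i k : ℕ) (x : ℝ) : ℝ := √(xN (e-i) i k) * ((-1)^k * xT e i k x)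

lemma xT_cont (e i k : ℕ) : Continuous (xT e i k) := by unfold xT; fun_prop

lemma xPhi_cont (e i k : ℕ) : Continuous (xPhi e i k) := by
  have := xT_cont e i k
  unfold xPhi; fun_prop

lemma xPhi_eq (e i k : ℕ) (hi : i ≤ e) (x : ℝ) (h0 : x ≠ 0) (h1 : x ≠ 1) :
    phiB (e+1) (i+1) k x = xPhi e i k x := by
  obtain ⟨a, rfl⟩ := Nat.exists_eq_add_of_le' hi
  rw [xphi_eq a i k x h0 h1]
  unfold xPhi
  rw [Nat.add_sub_cancel]

lemma xphi_sup' (d i k : ℕ) (hi : i < d) (hk : 1 ≤ k) (x : ℝ) (h0 : 0 ≤ x) (h1 : x ≤ 1) :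
    (phiB d (i+1) k x)^2 ≤ 2 * d.factorial * ((k+d : ℕ) : ℝ)^(2*d-1) := by
  obtain ⟨a, rfl⟩ : ∃ a, d = a + i + 1 := ⟨d - i - 1, by omega⟩
  exact xphi_sup a i k hk x h0 h1

lemma xPhi_orth (e : ℕ) (i j : Fin (e+1)) (k l : ℕ) (hkl : k ≠ l) :
    ∫ x in simplexD (e+1), xPhi e i k (x i) * xPhi e j l (x j) = 0 := by
  have h : ∀ x : Fin (e+1) → ℝ, xPhi e i k (x i) * xPhi e j l (x j) =
      (√(xN (e-i) i k) * (-1)^k * √(xN (e-j) j l) * (-1)^l) * (xT e i k (x i) * xT e j l (x j)) := by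
    intro x; unfold xPhi; ring
  simp_rw [h]
  rw [integral_const_mul]
  rcases le_total i j with hij | hij
  · rw [xE_orth e i j hij k l hkl, mul_zero]
  · simp_rw [mul_comm (xT e i k _)]
    rw [xE_orth e j i hij l k hkl.symm, mul_zero]

lemma xPhi_gram (e : ℕ) (i j : Fin (e+1)) (k : ℕ) :
    ∫ x in simplexD (e+1), xPhi e i k (x i) * xPhi e j k (x j) =
      √(xN (e-i) i k) * √(xN (e-j) j k) * (xP k (min i.1 j.1) * xP k (e - max i.1 j.1) / xCc e k) := by
  have h2 : (-1:ℝ)^k * (-1)^k = 1 := by rw [← mul_pow]; simp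
  have h : ∀ x : Fin (e+1) → ℝ, xPhi e i k (x i) * xPhi e j k (x j) =
      (√(xN (e-i) i k) * √(xN (e-j) j k)) * (xT e i k (x i) * xT e j k (x j)) := by
    intro x; unfold xPhi
    linear_combination (√(xN (e-i) i k) * √(xN (e-j) j k)) * (xT e i k (x i) * xT e j k (x j)) * h2
  simp_rw [h]
  rw [integral_const_mul]
  congr 1
  rcases le_total i j with hij | hij
  · rw [xE_gram e i j hij k, min_eq_left (by exact_mod_cast hij), max_eq_right (by exact_mod_cast hij)]
  · simp_rw [mul_comm (xT e i k _)]
    rw [xE_gram e j i hij k, min_eq_right (by exact_mod_cast hij), max_eq_left (by exact_mod_cast hij)]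

lemma xPhi_norm (e : ℕ) (i : Fin (e+1)) (k : ℕ) :
    ∫ x in simplexD (e+1), xPhi e i k (x i) * xPhi e i k (x i) = 1 := by
  rw [xPhi_gram, Real.mul_self_sqrt (xN_pos _ _ _).le, min_self, max_self, xN_eq e i k (Nat.lt_succ_iff.1 i.2)]
  have := xP_pos k i
  have := xP_pos k (e-i)
  have := xCc_pos e k
  field_simp

lemma xPhi_mean (e : ℕ) (i : Fin (e+1)) (k : ℕ) (hk : 1 ≤ k) :
    ∫ x in simplexD (e+1), xPhi e i k (x i) = 0 := by
  have h := xE_orth e i i le_rfl k 0 (by omega)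
  have h0 : ∀ x, xT e i 0 x = 1 := by intro x; simp [xT]
  simp_rw [h0, mul_one] at h
  unfold xPhi
  simp_rw [integral_const_mul, h, mul_zero]

noncomputable def xH (e M : ℕ) (U : ℕ → ℕ → ℝ) (x : Fin (e+1) → ℝ) : ℝ :=
  ∑ i : Fin (e+1), ∑ k ∈ Finset.range M, U k i * xPhi e i (k+1) (x i)

lemma xH_cont (e M : ℕ) (U : ℕ → ℕ → ℝ) : Continuous (xH e M U) := by
  unfold xH
  have := fun i k => xPhi_cont e i k
  fun_prop

lemma xH_mean (e M : ℕ) (U : ℕ → ℕ → ℝ) : ∫ x in simplexD (e+1), xH e M U x = 0 := by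
  unfold xH
  have hc := fun i k => xPhi_cont e i k
  rw [integral_finsetSum]
  · refine Finset.sum_eq_zero fun i _ => ?_
    rw [integral_finsetSum]
    · refine Finset.sum_eq_zero fun k _ => ?_
      rw [integral_const_mul, xPhi_mean e i _ (by omega), mul_zero]
    · intro k _; exact xInt_cont _ _ (by fun_prop)
  · intro k _; exact xInt_cont _ _ (by fun_prop)

lemma xPair (e M : ℕ) (U : ℕ → ℕ → ℝ) (i j : Fin (e+1)) :
    ∫ x in simplexD (e+1), (∑ k ∈ Finset.range M, U k i * xPhi e i (k+1) (x i)) * (∑ k ∈ Finset.range M, U k j * xPhi e j (k+1) (x j))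
     = ∑ k ∈ Finset.range M, U k i * U k j * ∫ x in simplexD (e+1), xPhi e i (k+1) (x i) * xPhi e j (k+1) (x j) := by
  have hc := fun i k => xPhi_cont e i k
  simp_rw [Finset.sum_mul_sum]
  rw [integral_finsetSum]
  · refine Finset.sum_congr rfl fun k hk => ?_
    rw [integral_finsetSum]
    · have : ∀ l ∈ Finset.range M, ∫ x in simplexD (e+1), U k i * xPhi e i (k+1) (x i) * (U l j * xPhi e j (l+1) (x j))
        = U k i * U l j * ∫ x in simplexD (e+1), xPhi e i (k+1) (x i) * xPhi e j (l+1) (x j) := by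
        intro l _
        rw [← integral_const_mul]
        congr 1; ext x; ring
      rw [Finset.sum_congr rfl this, Finset.sum_eq_single k]
      · intro l _ hl
        rw [xPhi_orth e i j (k+1) (l+1) (by omega), mul_zero]
      · intro h; exact absurd hk h
    · intro k _; exact xInt_cont _ _ (by fun_prop)
  · intro k _; exact xInt_cont _ _ (by fun_prop)

lemma xH_upper (e M : ℕ) (U : ℕ → ℕ → ℝ) : ∫ x in simplexD (e+1), (xH e M U x)^2 ≤
    ((e+1 : ℕ):ℝ) * ∑ i : Fin (e+1), ∑ k ∈ Finset.range M, (U k i)^2 := by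
  have hc := fun i k => xPhi_cont e i k
  have hH := xH_cont e M U
  calc ∫ x in simplexD (e+1), (xH e M U x)^2 ≤ ∫ x in simplexD (e+1), ((e+1 : ℕ):ℝ) * ∑ i : Fin (e+1),
        (∑ k ∈ Finset.range M, U k i * xPhi e i (k+1) (x i)) * (∑ k ∈ Finset.range M, U k i * xPhi e i (k+1) (x i)) := by
        refine integral_mono (xInt_cont _ _ (by fun_prop)) (xInt_cont _ _ (by fun_prop)) fun x => ?_
        have := sq_sum_le_card_mul_sum_sq (s := (Finset.univ : Finset (Fin (e+1)))) (f := fun i => ∑ k ∈ Finset.range M, U k i * xPhi e i (k+1) (x i))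
        simpa [xH, sq] using this
    _ = _ := by
      rw [integral_const_mul, integral_finsetSum]
      · congr 1
        refine Finset.sum_congr rfl fun i _ => ?_
        rw [xPair]
        refine Finset.sum_congr rfl fun k _ => ?_
        rw [xPhi_norm]; ring
      · intro k _; exact xInt_cont _ _ (by fun_prop)

lemma xP_succ (k i : ℕ) : xP k (i+1) * (i+1) = xP k i * (k+i+1) := by
  unfold xP
  rw [← add_assoc, Nat.factorial_succ, Nat.factorial_succ]
  push_cast
  field_simp

lemma xG_quad (e k : ℕ) (hk : 1 ≤ k) (u : ℕ → ℝ) :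
    ∑ i : Fin (e+1), (u i)^2 ≤ ((e+1:ℕ):ℝ) * ∑ i : Fin (e+1), ∑ j : Fin (e+1), u i * u j * ∫ x in simplexD (e+1), xPhi e i k (x i) * xPhi e j k (x j) := by
  set s : ℕ → ℝ := fun i => xP k i / xP k (e-i) with hs
  set w : ℕ → ℝ := fun i => u i * √(xN (e-i) i k) * xP k (e-i) with hw
  have hc := xCc_pos e k
  have hspos : ∀ i, 0 < s i := fun i => div_pos (xP_pos _ _) (xP_pos _ _)
  have hq := xF_quad s w (e+1) (fun i _ => hspos i) (by
    intro i hi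
    obtain ⟨q, hq⟩ : ∃ q, e = i + 1 + q := ⟨e - i - 1, by omega⟩
    have e1 := xP_succ k i
    have e2 := xP_succ k q
    have p1 := xP_pos k i
    have p2 := xP_pos k q
    have hk' : (1:ℝ) ≤ k := by exact_mod_cast hk
    simp only [hs]
    rw [show e - i = q+1 by omega, show e - (i+1) = q by omega]
    have f1 : xP k (i+1) = xP k i * (k+i+1) / (i+1) := by rw [eq_div_iff (by positivity), e1]
    have f2 : xP k (q+1) = xP k q * (k+q+1) / (q+1) := by rw [eq_div_iff (by positivity), e2]
    rw [f1, f2, hq]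
    push_cast
    have g1 : xP k i / (xP k q * (k+q+1) / (q+1)) * (((i:ℝ)+2) * ((i:ℝ)+1+q+1-i)) = (xP k i / xP k q * (q+1) / (k+q+1)) * ((i+2)*(q+2)) := by
      field_simp; ring
    have g2 : xP k i * (k+i+1) / (i+1) / xP k q * (((i:ℝ)+1) * ((i:ℝ)+1+q+1-i-1)) = (xP k i / xP k q * (q+1) / (k+q+1)) * ((k+i+1)*(k+q+1)) := by
      field_simp; ring
    rw [g1, g2]
    refine mul_le_mul_of_nonneg_left ?_ (by positivity)
    refine mul_le_mul ?_ ?_ (by positivity) (by positivity) <;> linarith)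
  have hU : ∀ i : Fin (e+1), (u i)^2 = (s i * (w i)^2) / xCc e k := by
    intro i
    have hN := xN_eq e i k (Nat.lt_succ_iff.1 i.2)
    have p1 := xP_pos k i
    have p2 := xP_pos k (e-i)
    simp only [hs, hw]
    rw [mul_pow, mul_pow, Real.sq_sqrt (xN_pos _ _ _).le, hN]
    field_simp
  have hG : ∀ i j : Fin (e+1), u i * u j * ∫ x in simplexD (e+1), xPhi e i k (x i) * xPhi e j k (x j)
      = (w i * w j * s (min i.1 j.1)) / xCc e k := by
    intro i j
    rw [xPhi_gram]
    simp only [hs, hw]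
    have p1 := xP_pos k (e-i)
    have p2 := xP_pos k (e-j)
    rcases le_total i.1 j.1 with hij | hij
    · rw [min_eq_left hij, max_eq_right hij]; field_simp
    · rw [min_eq_right hij, max_eq_left hij]; field_simp
  simp_rw [hU, hG, ← Finset.sum_div]
  rw [← mul_div_assoc]
  refine div_le_div_of_nonneg_right ?_ hc.le
  simp_rw [Finset.sum_range] at hq
  exact hq

lemma xH_lower (e M : ℕ) (U : ℕ → ℕ → ℝ) : ∑ i : Fin (e+1), ∑ k ∈ Finset.range M, (U k i)^2 ≤
    ((e+1 : ℕ):ℝ) * ∫ x in simplexD (e+1), (xH e M U x)^2 := by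
  have hc := fun i k => xPhi_cont e i k
  have h1 : ∫ x in simplexD (e+1), (xH e M U x)^2 = ∑ k ∈ Finset.range M, ∑ i : Fin (e+1), ∑ j : Fin (e+1),
      U k i * U k j * ∫ x in simplexD (e+1), xPhi e i (k+1) (x i) * xPhi e j (k+1) (x j) := by
    unfold xH
    simp_rw [sq, Finset.sum_mul_sum (s := (Finset.univ : Finset (Fin (e+1))))]
    rw [integral_finsetSum, Finset.sum_comm]
    · refine Finset.sum_congr rfl fun i _ => ?_
      rw [integral_finsetSum, Finset.sum_comm]
      · exact Finset.sum_congr rfl fun j _ => xPair e M U i j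
      · intro k _; exact xInt_cont _ _ (by fun_prop)
    · intro k _; exact xInt_cont _ _ (by fun_prop)
  rw [h1, Finset.sum_comm, Finset.mul_sum]
  refine Finset.sum_le_sum fun k _ => ?_
  exact xG_quad e (k+1) (by omega) (U k)

lemma xK_H (x : ℝ) : (0 ≤ x → 0 ≤ (1+x)*exp (-x) + x^2/2 - 1) ∧ (x ≤ 0 → (1+x)*exp (-x) + x^2/2 - 1 ≤ 0) := by
  set H : ℝ → ℝ := fun x => (1+x)*exp (-x) + x^2/2 - 1 with hH
  have hd : ∀ x, HasDerivAt H (x * (1 - exp (-x))) x := by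
    intro x
    have d1 : HasDerivAt (fun x : ℝ => exp (-x)) (-exp (-x)) x := by
      simpa using (hasDerivAt_neg x).exp
    have d2 := ((hasDerivAt_id x).const_add 1).mul d1
    have d3 := (((hasDerivAt_pow 2 x).div_const 2).const_add 0)
    have d4 := (d2.add ((hasDerivAt_pow 2 x).div_const 2)).sub_const 1
    refine d4.congr_deriv ?_
    simp; ring
  have hm : Monotone H := by
    apply monotone_of_deriv_nonneg (fun x => (hd x).differentiableAt)
    intro x
    rw [(hd x).deriv]
    rcases le_total 0 x with h | h
    · exact mul_nonneg h (by linarith [exp_le_one_iff.2 (show -x ≤ 0 by linarith)])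
    · exact mul_nonneg_of_nonpos_of_nonpos h (by linarith [one_le_exp (show 0 ≤ -x by linarith)])
  have h0 : H 0 = 0 := by simp [hH]
  exact ⟨fun h => by have := hm h; rw [h0] at this; exact this, fun h => by have := hm h; rw [h0] at this; exact this⟩

lemma xK_up (g : ℝ) : exp g - 1 - g ≤ g^2/2 * exp |g| := by
  rcases le_total 0 g with h | h
  · rw [abs_of_nonneg h]
    have h1 := mul_le_mul_of_nonneg_right ((xK_H g).1 h) (exp_pos g).le
    have h2 : exp (-g) * exp g = 1 := by rw [← exp_add]; simp
    nlinarith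
  · have h1 := quadratic_le_exp_of_nonneg (show 0 ≤ -g by linarith)
    have h2 : exp (-g) * exp g = 1 := by rw [← exp_add]; simp
    have h3 : 1 ≤ exp |g| := one_le_exp (abs_nonneg g)
    have h4 : exp g ≤ 1 + g + g^2/2 := by
      have h5 : 0 < 1 - g + g^2/2 := by nlinarith
      have h6 : exp g * (1 - g + g^2/2) ≤ 1 := by
        rw [← h2, mul_comm]; refine mul_le_mul_of_nonneg_right ?_ (exp_pos g).le
        nlinarith
      have h7 : 1 ≤ (1 + g + g^2/2) * (1 - g + g^2/2) := by nlinarith [sq_nonneg (g^2)]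
      exact le_of_mul_le_mul_right (h6.trans h7) h5
    nlinarith [sq_nonneg g]

lemma xK_lo (r : ℝ) : r^2/2 * exp (-|r|) ≤ exp (-r) - 1 + r := by
  rcases le_total 0 r with h | h
  · rw [abs_of_nonneg h]
    have h1 := mul_le_mul_of_nonneg_right ((xK_H (-r)).2 (by linarith)) (exp_pos (-r)).le
    have h2 : exp (-r) * exp r = 1 := by rw [← exp_add]; simp
    rw [neg_neg] at h1
    nlinarith
  · have h1 := quadratic_le_exp_of_nonneg (show 0 ≤ -r by linarith)
    have h3 : exp (-|r|) ≤ 1 := exp_le_one_iff.2 (by linarith [abs_nonneg r])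
    nlinarith [sq_nonneg r]

lemma xKL {Ω : Type*} [MeasurableSpace Ω] (μ : Measure Ω) [IsFiniteMeasure μ] [NeZero μ]
    (h h' : Ω → ℝ) (hm : AEStronglyMeasurable h μ) (hm' : AEStronglyMeasurable h' μ)
    (C B L : ℝ) (hC : ∀ᵐ x ∂μ, |h x| ≤ C) (hC' : ∀ᵐ x ∂μ, |h' x| ≤ C)
    (hB : ∀ᵐ x ∂μ, |h' x - h x| ≤ B) (h0 : ∫ x, (h' x - h x) ∂μ = 0)
    (hL : ∀ᵐ x ∂μ, |h x - log (∫ x, exp (h x) ∂μ)| ≤ L) :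
    |log (∫ x, exp (h' x) ∂μ) - log (∫ x, exp (h x) ∂μ)| ≤ B ∧
    ∫ x, exp (h x - log (∫ x, exp (h x) ∂μ)) * ((h x - log (∫ x, exp (h x) ∂μ)) - (h' x - log (∫ x, exp (h' x) ∂μ))) ∂μ
      ≤ 1/2 * exp (L + B) * ∫ x, (h' x - h x)^2 ∂μ ∧
    1/2 * exp (-L - 2 * B) * ∫ x, (h' x - h x)^2 ∂μ ≤
    ∫ x, exp (h x - log (∫ x, exp (h x) ∂μ)) * ((h x - log (∫ x, exp (h x) ∂μ)) - (h' x - log (∫ x, exp (h' x) ∂μ))) ∂μ := by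
  have ie : Integrable (fun x => exp (h x)) μ := by
    refine Integrable.of_bound (continuous_exp.comp_aestronglyMeasurable hm) (exp C) ?_
    filter_upwards [hC] with x hx
    rw [norm_eq_abs, abs_of_pos (exp_pos _)]
    exact exp_le_exp.2 (le_of_abs_le hx)
  have ie' : Integrable (fun x => exp (h' x)) μ := by
    refine Integrable.of_bound (continuous_exp.comp_aestronglyMeasurable hm') (exp C) ?_
    filter_upwards [hC'] with x hx
    rw [norm_eq_abs, abs_of_pos (exp_pos _)]
    exact exp_le_exp.2 (le_of_abs_le hx)
  have hZ : 0 < ∫ x, exp (h x) ∂μ := integral_exp_pos ie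
  have hZ' : 0 < ∫ x, exp (h' x) ∂μ := integral_exp_pos ie'
  set Z := ∫ x, exp (h x) ∂μ with hZd
  set Z' := ∫ x, exp (h' x) ∂μ with hZd'
  set c := log Z' - log Z with hc
  have hcB : |c| ≤ B := by
    have k1 : Z' ≤ exp B * Z := by
      rw [hZd, ← integral_const_mul]
      refine integral_mono_ae ie' (ie.const_mul _) ?_
      filter_upwards [hB] with x hx
      rw [← exp_add]; exact exp_le_exp.2 (by linarith [le_of_abs_le hx])
    have k2 : Z ≤ exp B * Z' := by
      rw [hZd', ← integral_const_mul]
      refine integral_mono_ae ie (ie'.const_mul _) ?_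
      filter_upwards [hB] with x hx
      rw [← exp_add]; exact exp_le_exp.2 (by linarith [neg_le_of_abs_le hx])
    have k3 := log_le_log hZ' k1
    have k4 := log_le_log hZ k2
    rw [log_mul (exp_pos _).ne' hZ.ne', log_exp] at k3
    rw [log_mul (exp_pos _).ne' hZ'.ne', log_exp] at k4
    rw [abs_le]; constructor <;> linarith
  refine ⟨hcB, ?_⟩
  set g : Ω → ℝ := fun x => h' x - h x with hg
  set f : Ω → ℝ := fun x => exp (h x - log Z) with hf
  have hfe : ∀ x, f x = exp (h x) / Z := fun x => by simp only [hf]; rw [exp_sub, exp_log hZ]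
  have hfm : AEStronglyMeasurable f μ := continuous_exp.comp_aestronglyMeasurable (hm.sub aestronglyMeasurable_const)
  have hgm : AEStronglyMeasurable g μ := hm'.sub hm
  have hfL : ∀ᵐ x ∂μ, f x ≤ exp L := by
    filter_upwards [hL] with x hx
    exact exp_le_exp.2 (le_of_abs_le hx)
  have hfL' : ∀ᵐ x ∂μ, exp (-L) ≤ f x := by
    filter_upwards [hL] with x hx
    exact exp_le_exp.2 (neg_le_of_abs_le hx)
  have fpos : ∀ x, 0 < f x := fun x => exp_pos _
  have if1 : Integrable f μ := by
    refine Integrable.of_bound hfm (exp L) ?_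
    filter_upwards [hfL] with x hx
    rwa [norm_eq_abs, abs_of_pos (fpos x)]
  have ig : Integrable g μ := Integrable.of_bound hgm B hB
  have ig2 : Integrable (fun x => (g x)^2) μ := by
    refine Integrable.of_bound (hgm.pow 2) (B^2) ?_
    filter_upwards [hB] with x hx
    rw [norm_eq_abs, abs_pow]; exact pow_le_pow_left₀ (abs_nonneg _) hx 2
  have ifg : Integrable (fun x => f x * g x) μ := by
    refine Integrable.of_bound (hfm.mul hgm) (exp L * B) ?_
    filter_upwards [hB, hfL] with x hx hx2
    rw [norm_mul, norm_eq_abs, abs_of_pos (fpos x), norm_eq_abs]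
    exact mul_le_mul hx2 hx (abs_nonneg _) (exp_pos _).le
  have ifeg : Integrable (fun x => f x * exp (g x)) μ := by
    refine Integrable.of_bound (hfm.mul (continuous_exp.comp_aestronglyMeasurable hgm)) (exp L * exp B) ?_
    filter_upwards [hB, hfL] with x hx hx2
    rw [norm_mul, norm_eq_abs, abs_of_pos (fpos x), norm_eq_abs, abs_of_pos (exp_pos _)]
    exact mul_le_mul hx2 (exp_le_exp.2 (le_of_abs_le hx)) (exp_pos _).le (exp_pos _).le
  have hf1 : ∫ x, f x ∂μ = 1 := by
    simp_rw [hfe]; rw [integral_div, div_self hZ.ne']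
  have hfeg : ∫ x, f x * exp (g x) ∂μ = exp c := by
    have : ∀ x, f x * exp (g x) = exp (h' x) / Z := by
      intro x; rw [hfe, div_mul_eq_mul_div, ← exp_add]; simp [hg]
    simp_rw [this]; rw [integral_div, hc, exp_sub, exp_log hZ, exp_log hZ']
  have hKL : ∫ x, f x * ((h x - log Z) - (h' x - log Z')) ∂μ = c - ∫ x, f x * g x ∂μ := by
    have : ∀ x, f x * ((h x - log Z) - (h' x - log Z')) = c * f x - f x * g x := by
      intro x; simp only [hg, hc]; ring
    simp_rw [this]
    rw [integral_sub (if1.const_mul c) ifg, integral_const_mul, hf1, mul_one]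
  change ∫ x, f x * ((h x - log Z) - (h' x - log Z')) ∂μ ≤ _ ∧ _ ≤ ∫ x, f x * ((h x - log Z) - (h' x - log Z')) ∂μ
  rw [hKL]
  constructor
  · have k1 : c ≤ exp c - 1 := by linarith [add_one_le_exp c]
    have k2 : ∫ x, (f x * exp (g x) - f x - f x * g x) ∂μ = exp c - 1 - ∫ x, f x * g x ∂μ := by
      have i1 : Integrable (fun x => f x * exp (g x) - f x) μ := ifeg.sub if1
      rw [integral_sub i1 ifg, integral_sub ifeg if1, hfeg, hf1]
    have k3 : ∫ x, (f x * exp (g x) - f x - f x * g x) ∂μ ≤ ∫ x, 1/2 * exp (L+B) * (g x)^2 ∂μ := by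
      refine integral_mono_ae ((ifeg.sub if1).sub ifg) (ig2.const_mul _) ?_
      filter_upwards [hB, hfL] with x hx hx2
      have a1 := xK_up (g x)
      have a2 : exp |g x| ≤ exp B := exp_le_exp.2 hx
      calc f x * exp (g x) - f x - f x * g x = f x * (exp (g x) - 1 - g x) := by ring
        _ ≤ f x * ((g x)^2/2 * exp |g x|) := mul_le_mul_of_nonneg_left a1 (fpos x).le
        _ ≤ exp L * ((g x)^2/2 * exp B) := by gcongr
        _ = 1/2 * exp (L+B) * (g x)^2 := by rw [exp_add]; ring
    rw [integral_const_mul] at k3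
    linarith
  · have k1 : ∫ x, (exp (-c) * (f x * exp (g x)) - f x + (c * f x - f x * g x)) ∂μ = c - ∫ x, f x * g x ∂μ := by
      have j1 : Integrable (fun x => exp (-c) * (f x * exp (g x)) - f x) μ := (ifeg.const_mul _).sub if1
      have j2 : Integrable (fun x => c * f x - f x * g x) μ := (if1.const_mul c).sub ifg
      rw [integral_add j1 j2, integral_sub (ifeg.const_mul _) if1,
        integral_sub (if1.const_mul _) ifg, integral_const_mul, integral_const_mul, hfeg, hf1, ← exp_add]
      simp
    rw [← k1]
    have ir2 : Integrable (fun x => (g x)^2 - 2 * c * g x + c^2) μ :=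
      (ig2.sub (ig.const_mul _)).add (integrable_const _)
    have k2 : ∫ x, 1/2 * exp (-L-2*B) * ((g x)^2 - 2 * c * g x + c^2) ∂μ ≤ ∫ x, (exp (-c) * (f x * exp (g x)) - f x + (c * f x - f x * g x)) ∂μ := by
      refine integral_mono_ae (ir2.const_mul _) (((ifeg.const_mul _).sub if1).add ((if1.const_mul _).sub ifg)) ?_
      filter_upwards [hB, hfL'] with x hx hx2
      have a1 := xK_lo (c - g x)
      have a0 : |c - g x| ≤ 2 * B := by
        have := abs_sub c (g x)
        have hx' : |g x| ≤ B := hx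
        linarith
      have a2 : exp (-(2*B)) ≤ exp (-|c - g x|) := exp_le_exp.2 (by linarith)
      calc 1/2 * exp (-L-2*B) * ((g x)^2 - 2 * c * g x + c^2) = exp (-L) * ((c - g x)^2/2 * exp (-(2*B))) := by
            rw [sub_eq_add_neg (-L), exp_add]; ring
        _ ≤ f x * ((c - g x)^2/2 * exp (-|c - g x|)) := by gcongr
        _ ≤ f x * (exp (-(c - g x)) - 1 + (c - g x)) := mul_le_mul_of_nonneg_left a1 (fpos x).le
        _ = _ := by rw [show -(c - g x) = -c + g x by ring, exp_add]; ring
    refine le_trans ?_ k2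
    rw [integral_const_mul]
    refine mul_le_mul_of_nonneg_left ?_ (by positivity)
    have h0' : ∫ x, g x ∂μ = 0 := h0
    have j3 : Integrable (fun x => (g x)^2 - 2*c*g x) μ := ig2.sub (ig.const_mul _)
    change ∫ x, (g x)^2 ∂μ ≤ _
    rw [integral_add j3 (integrable_const _), integral_sub ig2 (ig.const_mul _), integral_const_mul, h0', integral_const]
    have : 0 ≤ μ.real Set.univ • c^2 := by rw [smul_eq_mul]; positivity
    linarith

lemma xLin_sup (d : ℕ) (hd : 1 ≤ d) (m : Fin d → ℕ) (η : (i : Fin d) → Fin (m i) → ℝ) (x : Fin d → ℝ) (hx : x ∈ simplexD d) :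
    |lincomb d m η x| ≤ (Real.sqrt (2 * (d.factorial : ℝ)) *
      Real.sqrt (∑ i, ((m i + d : ℕ) : ℝ)^(2*d))) * eunorm d m η := by
  unfold lincomb eunorm
  rw [← Real.sqrt_mul (by positivity), ← Real.sqrt_mul (by positivity)]
  refine Real.abs_le_sqrt ?_
  have cs := Finset.sum_mul_sq_le_sq_mul_sq (Finset.univ.sigma fun i : Fin d => (Finset.univ : Finset (Fin (m i))))
    (fun p => η p.1 p.2) (fun p => phiB d (p.1.1+1) (p.2.1+1) (x p.1))
  rw [Finset.sum_sigma, Finset.sum_sigma, Finset.sum_sigma] at cs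
  refine cs.trans ?_
  rw [mul_comm]
  refine mul_le_mul_of_nonneg_right ?_ (by positivity)
  rw [Finset.mul_sum]
  refine Finset.sum_le_sum fun i _ => ?_
  have h1 : ∀ k : Fin (m i), (phiB d (i.1+1) (k.1+1) (x i))^2 ≤ 2 * d.factorial * ((m i+d : ℕ) : ℝ)^(2*d-1) := by
    intro k
    refine (xphi_sup' d i (k+1) i.2 (by omega) (x i) (hx.1 i).1 (hx.1 i).2).trans ?_
    have : ((k.1+1+d : ℕ) : ℝ) ≤ ((m i + d : ℕ) : ℝ) := by
      exact_mod_cast (by have := k.2; omega)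
    gcongr
  refine (Finset.sum_le_sum fun k _ => h1 k).trans ?_
  rw [Finset.sum_const, Finset.card_univ, Fintype.card_fin, nsmul_eq_mul]
  have h2 : ((m i + d : ℕ) : ℝ)^(2*d) = ((m i + d : ℕ) : ℝ)^(2*d-1) * ((m i + d : ℕ) : ℝ) := by
    rw [← pow_succ]; congr 1; omega
  rw [h2]
  have h3 : (m i : ℝ) ≤ ((m i + d : ℕ) : ℝ) := by push_cast; linarith [(Nat.cast_nonneg d : (0:ℝ) ≤ d)]
  calc (m i : ℝ) * (2 * d.factorial * ((m i+d : ℕ) : ℝ)^(2*d-1)) ≤ ((m i + d : ℕ) : ℝ) * (2 * d.factorial * ((m i+d : ℕ) : ℝ)^(2*d-1)) := by gcongr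
    _ = _ := by ring

noncomputable def xU (d : ℕ) (m : Fin d → ℕ) (η : (i : Fin d) → Fin (m i) → ℝ) (k i : ℕ) : ℝ :=
  if h : i < d then (if h' : k < m ⟨i, h⟩ then η ⟨i, h⟩ ⟨k, h'⟩ else 0) else 0

lemma xU_sum (d : ℕ) (m : Fin d → ℕ) (η : (i : Fin d) → Fin (m i) → ℝ) (M : ℕ) (i : Fin d) (hM : m i ≤ M)
    (F : ℝ → ℕ → ℝ) (hF : ∀ k, F 0 k = 0) :
    ∑ k ∈ Finset.range M, F (xU d m η k i) k = ∑ k : Fin (m i), F (η i k) k := by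
  have h1 : ∑ k ∈ Finset.range (m i), F (xU d m η k i) k = ∑ k ∈ Finset.range M, F (xU d m η k i) k := by
    refine Finset.sum_subset (Finset.range_mono hM) fun k _ hk => ?_
    have : ¬ k < m i := by simpa using hk
    simp [xU, this, hF]
  rw [← h1, ← Fin.sum_univ_eq_sum_range (fun k => F (xU d m η k i) k)]
  refine Finset.sum_congr rfl fun k _ => ?_
  simp [xU]

lemma xLin_eq (e : ℕ) (m : Fin (e+1) → ℕ) (η : (i : Fin (e+1)) → Fin (m i) → ℝ) (M : ℕ) (hM : ∀ i, m i ≤ M)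
    (x : Fin (e+1) → ℝ) (hx : ∀ i, x i ≠ 0 ∧ x i ≠ 1) :
    lincomb (e+1) m η x = xH e M (xU (e+1) m η) x := by
  unfold lincomb xH
  refine Finset.sum_congr rfl fun i _ => ?_
  rw [xU_sum (e+1) m η M i (hM i) (fun u k => u * xPhi e i (k+1) (x i)) (by simp)]
  refine Finset.sum_congr rfl fun k _ => ?_
  rw [xPhi_eq e i (k+1) (by omega) (x i) (hx i).1 (hx i).2]

lemma xAE (d : ℕ) : ∀ᵐ x ∂(volume.restrict (simplexD d)), ∀ i, x i ≠ 0 ∧ x i ≠ 1 := by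
  refine ae_restrict_of_ae ?_
  rw [ae_all_iff]
  intro i
  have h : ∀ c : ℝ, ∀ᵐ x : Fin d → ℝ, x i ≠ c := fun c => by
    exact Measure.ae_eval_ne (fun _ : Fin d => (volume : Measure ℝ)) i c
  filter_upwards [h 0, h 1] with x h0 h1 using ⟨h0, h1⟩

/-- KL and sup-norm bounds between members of the additive exponential family. -/
theorem statement15 (d : ℕ) (hd : 2 ≤ d) (m : Fin d → ℕ) (hm : ∀ i, 1 ≤ m i)
    (θ θ' : (i : Fin d) → Fin (m i) → ℝ)
    (κ : ℝ) (hκ : κ = Real.sqrt (2 * (d.factorial : ℝ)) *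
      Real.sqrt (∑ i, ((m i + d : ℕ) : ℝ)^(2*d)))
    (Δ : ℝ) (hΔ : Δ = eunorm d m (fun i k => θ i k - θ' i k))
    (L : ℝ) (hL : ∀ x ∈ simplexD d, |Real.log (fdens d m θ x)| ≤ L) :
    (∀ x ∈ simplexD d,
      |Real.log (fdens d m θ x / fdens d m θ' x)| ≤ 2 * Real.sqrt d * κ * Δ) ∧
    (∫ x in simplexD d, fdens d m θ x * Real.log (fdens d m θ x / fdens d m θ' x))
      ≤ ((d:ℝ)/2) * Real.exp (L + Real.sqrt d * κ * Δ) * Δ^2 ∧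
    (1/(2*(d:ℝ))) * Real.exp (-L - 2 * Real.sqrt d * κ * Δ) * Δ^2
      ≤ ∫ x in simplexD d, fdens d m θ x * Real.log (fdens d m θ x / fdens d m θ' x) := by
  obtain ⟨e, rfl⟩ : ∃ e, d = e + 1 := ⟨d - 1, by omega⟩
  set μ : Measure (Fin (e+1) → ℝ) := volume.restrict (simplexD (e+1)) with hμ
  have hmeas : MeasurableSet (simplexD (e+1)) := by rw [xS_one]; exact (xS_closed _ _).measurableSet
  have hfin : IsFiniteMeasure μ := by
    refine ⟨?_⟩
    rw [hμ, Measure.restrict_apply_univ, xS_one]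
    exact (xS_compact _ _).measure_lt_top
  have hne : NeZero μ := by
    refine ⟨fun h0 => ?_⟩
    have h := xD_moment (e+1) 0 0 le_rfl 0 0
    rw [← hμ, h0, integral_zero_measure] at h
    have : (0:ℝ) < (((0 : Fin (e+1)).1+0).factorial / (0 : Fin (e+1)).1.factorial : ℝ) * (((0 : Fin (e+1)).1+0+0).factorial / ((0 : Fin (e+1)).1+0).factorial) / (e+1+0+0).factorial := by positivity
    exact absurd h this.ne
  have hmem : ∀ᵐ x ∂μ, x ∈ simplexD (e+1) := ae_restrict_mem hmeas
  set M := ∑ i, m i with hMdef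
  have hM : ∀ i, m i ≤ M := fun i => Finset.single_le_sum (f := m) (fun _ _ => Nat.zero_le _) (Finset.mem_univ i)
  have hae : ∀ η : (i : Fin (e+1)) → Fin (m i) → ℝ, lincomb (e+1) m η =ᵐ[μ] xH e M (xU (e+1) m η) := by
    intro η
    filter_upwards [xAE (e+1)] with x hx using xLin_eq e m η M hM x hx
  have hsm : ∀ η : (i : Fin (e+1)) → Fin (m i) → ℝ, AEStronglyMeasurable (lincomb (e+1) m η) μ := fun η =>
    (xH_cont e M (xU (e+1) m η)).aestronglyMeasurable.congr (hae η).symm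
  set η : (i : Fin (e+1)) → Fin (m i) → ℝ := fun i k => θ' i k - θ i k with hη
  have hsub : ∀ x, lincomb (e+1) m θ' x - lincomb (e+1) m θ x = lincomb (e+1) m η x := by
    intro x
    simp only [lincomb, hη, ← Finset.sum_sub_distrib, sub_mul]
  have hΔ2 : Δ = eunorm (e+1) m η := by
    rw [hΔ]; unfold eunorm; congr 1
    refine Finset.sum_congr rfl fun i _ => Finset.sum_congr rfl fun k _ => ?_
    simp only [hη]; ring
  have hΔ0 : 0 ≤ Δ := by rw [hΔ]; exact Real.sqrt_nonneg _
  have hκ0 : 0 ≤ κ := by rw [hκ]; positivity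
  have hsum : ∑ i : Fin (e+1), ∑ k ∈ Finset.range M, (xU (e+1) m η k i)^2 = Δ^2 := by
    rw [hΔ2, eunorm, Real.sq_sqrt (by positivity)]
    refine Finset.sum_congr rfl fun i _ => ?_
    exact xU_sum (e+1) m η M i (hM i) (fun u _ => u^2) (by simp)
  set d : ℝ := ((e+1 : ℕ) : ℝ) with hdd
  have hd1 : 1 ≤ d := by rw [hdd]; push_cast; linarith [(Nat.cast_nonneg e : (0:ℝ) ≤ e)]
  set B := √d * κ * Δ with hB
  have hBx : ∀ x ∈ simplexD (e+1), |lincomb (e+1) m θ' x - lincomb (e+1) m θ x| ≤ B := by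
    intro x hx
    rw [hsub]
    have h1 := xLin_sup (e+1) (by omega) m η x hx
    rw [← hκ, ← hΔ2] at h1
    have : 1 ≤ √d := Real.one_le_sqrt.2 hd1
    have h2 : 0 ≤ κ * Δ := by positivity
    rw [hB, mul_assoc]; nlinarith
  have h0 : ∫ x, (lincomb (e+1) m θ' x - lincomb (e+1) m θ x) ∂μ = 0 := by
    simp_rw [hsub]
    rw [integral_congr_ae (hae η)]
    exact xH_mean e M _
  have hI : ∫ x, (lincomb (e+1) m θ' x - lincomb (e+1) m θ x)^2 ∂μ = ∫ x, (xH e M (xU (e+1) m η) x)^2 ∂μ := by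
    simp_rw [hsub]
    refine integral_congr_ae ?_
    filter_upwards [hae η] with x hx
    rw [hx]
  have hlo := xH_lower e M (xU (e+1) m η)
  have hup := xH_upper e M (xU (e+1) m η)
  rw [← hμ, ← hI, hsum] at hlo hup
  have hbd : ∀ η' : (i : Fin (e+1)) → Fin (m i) → ℝ, eunorm (e+1) m η' ≤ eunorm (e+1) m θ + eunorm (e+1) m θ' →
      ∀ᵐ x ∂μ, |lincomb (e+1) m η' x| ≤ κ * (eunorm (e+1) m θ + eunorm (e+1) m θ') := by
    intro η' h
    filter_upwards [hmem] with x hx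
    have h1 := xLin_sup (e+1) (by omega) m η' x hx
    rw [← hκ] at h1
    exact h1.trans (mul_le_mul_of_nonneg_left h hκ0)
  have p1 : 0 ≤ eunorm (e+1) m θ := Real.sqrt_nonneg _
  have p2 : 0 ≤ eunorm (e+1) m θ' := Real.sqrt_nonneg _
  have hlogf : ∀ η' x, log (fdens (e+1) m η' x) = lincomb (e+1) m η' x - log (∫ x, exp (lincomb (e+1) m η' x) ∂μ) := by
    intro η' x
    rw [fdens, log_exp, psiFun]
  have hlog : ∀ x, log (fdens (e+1) m θ x / fdens (e+1) m θ' x) =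
      (lincomb (e+1) m θ x - log (∫ x, exp (lincomb (e+1) m θ x) ∂μ)) - (lincomb (e+1) m θ' x - log (∫ x, exp (lincomb (e+1) m θ' x) ∂μ)) := by
    intro x
    have q : ∀ η'', fdens (e+1) m η'' x ≠ 0 := fun η'' => (exp_pos _).ne'
    rw [log_div (q θ) (q θ'), hlogf, hlogf]
  obtain ⟨K1, K2, K3⟩ := xKL μ (lincomb (e+1) m θ) (lincomb (e+1) m θ') (hsm θ) (hsm θ')
    (κ * (eunorm (e+1) m θ + eunorm (e+1) m θ')) B L (hbd θ (by linarith)) (hbd θ' (by linarith))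
    (by filter_upwards [hmem] with x hx using hBx x hx) h0
    (by filter_upwards [hmem] with x hx; rw [← hlogf]; exact hL x hx)
  have hK : ∫ x, fdens (e+1) m θ x * log (fdens (e+1) m θ x / fdens (e+1) m θ' x) ∂μ =
      ∫ x, exp (lincomb (e+1) m θ x - log (∫ x, exp (lincomb (e+1) m θ x) ∂μ)) *
        ((lincomb (e+1) m θ x - log (∫ x, exp (lincomb (e+1) m θ x) ∂μ)) - (lincomb (e+1) m θ' x - log (∫ x, exp (lincomb (e+1) m θ' x) ∂μ))) ∂μ := by
    simp_rw [hlog]; rfl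
  have hB2 : 2 * √d * κ * Δ = 2 * B := by rw [hB]; ring
  rw [hK, hB2]
  refine ⟨fun x hx => ?_, K2.trans ?_, le_trans ?_ K3⟩
  · rw [hlog]
    have h1 := abs_le.1 (hBx x hx)
    have h2 := abs_le.1 K1
    rw [abs_le]
    constructor <;> linarith [h1.1, h1.2, h2.1, h2.2]
  · calc _ ≤ 1/2 * exp (L+B) * (d * Δ^2) := mul_le_mul_of_nonneg_left hup (by positivity)
      _ = _ := by ring
  · calc 1/(2*d) * exp (-L-2*B) * Δ^2 = 1/2 * exp (-L-2*B) * (1/d * Δ^2) := by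
          field_simp
      _ ≤ _ := by
          refine mul_le_mul_of_nonneg_left ?_ (by positivity)
          rw [one_div, inv_mul_le_iff₀ (by linarith)]
          exact hlo
end

section
/- Let A_m(θ) = ∫_△ φ_m f_θ. For θ ∈ ℝ^{|m|}, if α ∈ ℝ^{|m|} satisfies ‖A_m(θ) - α‖ ≤ exp(-(1+‖log f_θ‖_∞))/(6 d^{3/2} κ_m), then α ∈ A_m(ℝ^{|m|}), i.e. there exists θ* with A_m(θ*) = α; moreover, for any τ with 6 d^{3/2} exp(1+‖log f_θ‖_∞) κ_m ‖A_m(θ)-α‖ ≤ τ ≤ 1, one has ‖θ - θ*‖ ≤ 3d exp(τ + ‖log f_θ‖_∞) ‖A_m(θ)-α‖ and KL(f_θ‖f_{θ*}) ≤ 3d exp(τ + ‖log f_θ‖_∞) ‖A_m(θ)-α‖². -/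
open MeasureTheory Real

open Polynomial in
noncomputable def rpC (e b k s : ℕ) : ℝ :=
  (-1)^(k+s) * (k.choose s : ℝ) * ((k+b).factorial * (k+e+s).factorial) /
    (k.factorial * (k+e).factorial * (b+s).factorial)

open Polynomial in
noncomputable def rp (e b k : ℕ) : Polynomial ℝ :=
  ∑ s ∈ Finset.range (k+1), C (rpC e b k s) * X^s

open Polynomial in
lemma rp_shift (e b k : ℕ) :
    derivative (X^(b+1) * rp e (b+1) k) = C ((k:ℝ)+b+1) * (X^b * rp e b k) := by
  unfold rp
  simp only [Finset.mul_sum, derivative_sum]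
  refine Finset.sum_congr rfl fun s _ => ?_
  have h1 : (X:ℝ[X])^(b+1) * (C (rpC e (b+1) k s) * X^s) = C (rpC e (b+1) k s) * X^(b+1+s) := by ring
  rw [h1, derivative_C_mul_X_pow]
  have h2 : C ((k:ℝ)+b+1) * (X^b * (C (rpC e b k s) * X^s)) = C (((k:ℝ)+b+1) * rpC e b k s) * X^(b+s) := by
    rw [C_mul]; ring
  rw [h2]
  have h3 : b+1+s-1 = b+s := by omega
  rw [h3]
  congr 2
  unfold rpC
  have e1 : k+(b+1) = (k+b)+1 := by ring
  have e2 : b+1+s = (b+s)+1 := by ring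
  rw [e1, e2, Nat.factorial_succ, Nat.factorial_succ]
  have := Nat.factorial_ne_zero k
  have := Nat.factorial_ne_zero (k+e)
  have := Nat.factorial_ne_zero (b+s)
  push_cast
  have : (b:ℝ)+s+1 ≠ 0 := by positivity
  field_simp
  

open Polynomial in
lemma rod0 (b k : ℕ) : derivative^[k] ((X:ℝ[X])^(b+k) * (1-X)^k) =
    C ((-1)^k * (k.factorial:ℝ)) * (X^b * rp b b k) := by
  have h : ((1:ℝ[X])-X)^k = ∑ s ∈ Finset.range (k+1), C ((-1)^s * (k.choose s:ℝ)) * X^s := by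
    rw [sub_eq_neg_add, add_pow]
    refine Finset.sum_congr rfl fun s _ => ?_
    simp [neg_pow (X:ℝ[X]) s]; ring
  rw [h, Finset.mul_sum, iterate_derivative_sum]
  unfold rp
  simp only [Finset.mul_sum]
  refine Finset.sum_congr rfl fun s _ => ?_
  have h1 : (X:ℝ[X])^(b+k) * (C ((-1)^s * (k.choose s:ℝ)) * X^s) = C ((-1)^s * (k.choose s:ℝ)) * X^(b+k+s) := by ring
  rw [h1, iterate_derivative_C_mul, iterate_derivative_X_pow_eq_C_mul]
  have h3 : b+k+s-k = b+s := by omega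
  rw [h3]
  have h2 : C ((-1)^k * (k.factorial:ℝ)) * (X^b * (C (rpC b b k s) * X^s)) = C ((-1)^k * (k.factorial:ℝ) * rpC b b k s) * X^(b+s) := by
    rw [C_mul (a := (-1)^k * (k.factorial:ℝ))]; ring
  rw [h2, ← mul_assoc, ← C_mul]
  congr 2
  unfold rpC
  have hh : ((b+s).factorial:ℝ) * ((b+k+s).descFactorial k : ℝ) = (b+k+s).factorial := by
    have := Nat.factorial_mul_descFactorial (n := b+k+s) (k := k) (by omega)
    rw [h3] at this
    exact_mod_cast this
  have e1 : k+b+s = b+k+s := by ring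
  rw [e1, ← hh]
  have := Nat.factorial_ne_zero k
  have := Nat.factorial_ne_zero (k+b)
  have := Nat.factorial_ne_zero (b+s)
  field_simp
  have hs : ((-1:ℝ)^k) * (-1)^k = 1 := by rw [← mul_pow]; norm_num
  rw [pow_add]
  linear_combination (-((k.choose s : ℝ) * ((b+k+s).descFactorial k : ℝ) * (-1)^s)) * hs

open Polynomial in
lemma one_sub_der (a : ℕ) : (1-X) * derivative (((1:ℝ[X])-X)^a) = - C (a:ℝ) * (1-X)^a := by
  rcases a with _ | a
  · simp
  · rw [derivative_pow]; simp; ring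

open Polynomial in
lemma iter_one_sub (k : ℕ) (V : ℝ[X]) : derivative^[k] ((1 - X) * derivative V) =
    (1-X) * derivative^[k+1] V - (k:ℝ[X]) * derivative^[k] V := by
  induction k with
  | zero => simp
  | succ k ih =>
    rw [Function.iterate_succ_apply', ih, derivative_sub, derivative_mul, derivative_mul]
    simp only [derivative_sub, derivative_one, derivative_X, derivative_natCast, Function.iterate_succ_apply']
    push_cast
    ring

open Polynomial in
lemma rod (a : ℕ) : ∀ b k : ℕ, derivative^[k] ((X:ℝ[X])^(b+k) * (1-X)^(a+k)) =
    C ((-1)^k * (k.factorial:ℝ)) * (X^b * (1-X)^a * rp (a+b) b k) := by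
  induction a with
  | zero => intro b k; simpa using rod0 b k
  | succ a ih =>
    intro b k
    have H := ih (b+1) k
    have hab : a + 1 + b = a + (b+1) := by ring
    rw [hab]
    set ck := C ((-1)^k * (k.factorial:ℝ))
    set V : ℝ[X] := X^(b+1+k) * (1-X)^(a+k) with hV
    have h1 : derivative^[k] ((1 - X) * derivative V) = (1-X) * derivative^[k+1] V - (k:ℝ[X]) * derivative^[k] V := by
      exact iter_one_sub k V
    have h2 : (1-X) * derivative V = C ((b:ℝ)+1+k) * (X^(b+k) * (1-X)^(a+1+k)) - C ((a:ℝ)+k) * V := by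
      have h7 : (1-X) * derivative (((1:ℝ[X])-X)^(a+k)) = - C ((a:ℝ)+k) * (1-X)^(a+k) := by
        have := one_sub_der (a+k)
        push_cast at this ⊢
        exact this
      have e1 : b+1+k-1 = b+k := by omega
      rw [hV, derivative_mul, derivative_X_pow, e1]
      push_cast
      push_cast at h7
      linear_combination X^(b+1+k) * h7
    have h3 : C ((b:ℝ)+1+k) * derivative^[k] (X^(b+k) * (1-X)^(a+1+k)) =
      (1-X) * derivative (derivative^[k] V) + C (a:ℝ) * derivative^[k] V := by
      have := congrArg (derivative^[k]) h2
      rw [h1, iterate_derivative_sub, iterate_derivative_C_mul, iterate_derivative_C_mul, Function.iterate_succ_apply'] at this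
      simp only [C_add, C_eq_natCast] at this ⊢
      linear_combination -this
    have h4 := rp_shift (a+(b+1)) b k
    have h5 : C ((b:ℝ)+1+k) ≠ 0 := by
      rw [Ne, C_eq_zero]; positivity
    apply mul_left_cancel₀ h5
    rw [h3, H]
    have h6 : ck * (X ^ (b + 1) * (1 - X) ^ a * rp (a + (b + 1)) (b + 1) k) = ck * ((1-X)^a * (X ^ (b + 1) * rp (a + (b + 1)) (b + 1) k)) := by ring
    rw [h6, derivative_C_mul, derivative_mul, h4]
    have h7 : (1-X) * derivative (((1:ℝ[X])-X)^a) = - C (a:ℝ) * (1-X)^a := by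
      exact one_sub_der a
    have h8 : C ((b:ℝ)+1+k) = C ((k:ℝ)+b+1) := by congr 1; ring
    rw [h8]
    linear_combination ck * (X ^ (b + 1) * rp (a + (b + 1)) (b + 1) k) * h7


open Polynomial in
lemma rp_coeff (e b k n : ℕ) : (rp e b k).coeff n = rpC e b k n := by
  unfold rp
  simp only [finsetSum_coeff, coeff_C_mul, coeff_X_pow]
  simp only [mul_ite, mul_one, mul_zero]
  rw [Finset.sum_ite_eq]
  split_ifs with h
  · rfl
  · unfold rpC
    rw [Nat.choose_eq_zero_of_lt (by simpa using h)]; simp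

lemma rpC_rec (e b k s : ℕ) : ((s:ℝ)+1) * (s+b+1) * rpC e b k (s+1) =
    ((s:ℝ)-k) * (s+k+e+1) * rpC e b k s := by
  unfold rpC
  have e1 : k+e+(s+1) = (k+e+s)+1 := by ring
  have e2 : b+(s+1) = (b+s)+1 := by ring
  have hc : (k.choose (s+1) : ℝ) * (s+1) = k.choose s * ((k:ℝ) - s) := by
    rcases le_or_gt s k with h | h
    · have := Nat.choose_succ_right_eq k s
      rw [← Nat.cast_sub h]; exact_mod_cast this
    · rw [Nat.choose_eq_zero_of_lt h, Nat.choose_eq_zero_of_lt (by omega)]; simp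
  rw [e1, e2, Nat.factorial_succ, Nat.factorial_succ]
  have := Nat.factorial_ne_zero k
  have := Nat.factorial_ne_zero (k+e)
  have := Nat.factorial_ne_zero (b+s)
  push_cast
  have : (b:ℝ)+s+1 ≠ 0 := by positivity
  field_simp
  have e3 : (-1:ℝ)^(k+(s+1)) = - (-1)^(k+s) := by rw [← add_assoc, pow_succ]; ring
  rw [e3]
  linear_combination (-(-1:ℝ)^(k+s) * ((k:ℝ)+e+s+1) * (s+b+1)) * hc

open Polynomial in
lemma rp_ode (e b k : ℕ) : X * (1-X) * derivative (derivative (rp e b k)) +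
    (C ((b:ℝ)+1) - C ((e:ℝ)+2) * X) * derivative (rp e b k) +
    C ((k:ℝ)*(k+e+1)) * rp e b k = 0 := by
  have h : X * (1-X) * derivative (derivative (rp e b k)) +
    (C ((b:ℝ)+1) - C ((e:ℝ)+2) * X) * derivative (rp e b k) +
    C ((k:ℝ)*(k+e+1)) * rp e b k = X * derivative (derivative (rp e b k)) -
     X * (X * derivative (derivative (rp e b k))) + C ((b:ℝ)+1) * derivative (rp e b k)
     - C ((e:ℝ)+2) * (X * derivative (rp e b k)) + C ((k:ℝ)*(k+e+1)) * rp e b k := by ring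
  rw [h]
  ext n
  have hr := rpC_rec e b k n
  rcases n with _ | _ | n
  · simp [coeff_derivative, rp_coeff] at hr ⊢
    linear_combination hr
  · simp only [coeff_add, coeff_sub, coeff_C_mul, coeff_derivative, rp_coeff, coeff_X_mul, coeff_zero, coeff_X_mul_zero]
    push_cast at hr ⊢
    linear_combination hr
  · simp only [coeff_add, coeff_sub, coeff_C_mul, coeff_derivative, rp_coeff, coeff_X_mul, coeff_zero, coeff_X_mul_zero]
    push_cast at hr ⊢
    linear_combination hr

open Polynomial in
lemma rp_refl (a b k : ℕ) : (rp (a+b) b k).comp (1-X) = C ((-1)^k) * rp (a+b) a k := by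
  have h1 := congrArg (fun p => p.comp (1 - X)) (rod a b k)
  have h2 := rod b a k
  have h3 := iterate_derivative_comp_one_sub_X ((X:ℝ[X])^(b+k) * (1-X)^(a+k)) k
  simp only [mul_comp, pow_comp, sub_comp, X_comp, one_comp, C_comp, sub_sub_cancel] at h1 h3
  rw [mul_comm ((1-X)^(b+k)), h2, add_comm b a] at h3
  have h4 := h3.trans (congrArg (fun p => (-1)^k * p) h1)
  have h5 : (X:ℝ[X])^a * (1-X)^b * C ((-1)^k * (k.factorial:ℝ)) ≠ 0 := by
    have : (1-X:ℝ[X]) ≠ 0 := by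
      intro h; have := congrArg (eval 0) h; simp at this
    have h6 : C ((-1)^k * (k.factorial:ℝ)) ≠ 0 := by
      rw [Ne, C_eq_zero]; positivity
    exact mul_ne_zero (mul_ne_zero (pow_ne_zero _ X_ne_zero) (pow_ne_zero _ this)) h6
  apply mul_left_cancel₀ h5
  have hs : ((-1:ℝ[X])^k) * (-1)^k = 1 := by rw [← mul_pow]; norm_num
  have hs' : C ((-1:ℝ)^k) = (-1)^k := by simp
  rw [hs']
  linear_combination -((-1)^k) * h4 - (X^a * (1-X)^b * C ((-1)^k * (k.factorial:ℝ))) * (rp (a+b) b k).comp (1-X) * hs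

open Polynomial in
lemma rp_zero (a b k : ℕ) : ((rp (a+b) b k).eval 0)^2 = ((k+b).choose k:ℝ)^2 := by
  rw [← coeff_zero_eq_eval_zero, rp_coeff]
  unfold rpC
  rw [Nat.cast_choose ℝ (Nat.le_add_right k b)]
  have := Nat.factorial_ne_zero k
  have := Nat.factorial_ne_zero (k+(a+b))
  have := Nat.factorial_ne_zero b
  simp
  field_simp
  rw [← pow_mul, mul_comm k 2, pow_mul]; norm_num

open Polynomial in
lemma rp_one (a b k : ℕ) : ((rp (a+b) b k).eval 1)^2 = ((k+a).choose k:ℝ)^2 := by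
  have h := congrArg (eval 0) (rp_refl a b k)
  simp at h
  rw [h, mul_pow, ← pow_mul, mul_comm k 2, pow_mul]
  rw [add_comm a b, rp_zero b a k]; norm_num

open Polynomial in
lemma rp_sup (a b k : ℕ) (hk : 1 ≤ k) (t : ℝ) (ht : t ∈ Set.Icc (0:ℝ) 1) :
    ((rp (a+b) b k).eval t)^2 ≤ max (((k+b).choose k:ℝ)^2) (((k+a).choose k:ℝ)^2) := by
  set R := rp (a+b) b k with hR
  set K : ℝ := (k:ℝ)*(k+(a+b:ℕ)+1) with hK
  have hk' : (0:ℝ) < k := by exact_mod_cast hk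
  have hKpos : 0 < K := by positivity
  let G : ℝ[X] := C K * R^2 + X*(1-X)*(derivative R)^2
  have hG : derivative G = (C (2*((a:ℝ)+b+1)) * X - C (2*(b:ℝ)+1)) * (derivative R)^2 := by
    have ode := rp_ode (a+b) b k
    rw [← hR, ← hK] at ode
    simp only [G, derivative_add, derivative_mul, derivative_pow, derivative_C, derivative_X, derivative_sub, derivative_one]
    simp only [C_add, C_mul, C_eq_natCast, C_ofNat, Nat.cast_add] at ode ⊢
    simp
    simp at ode
    linear_combination (2 * derivative R) * ode
  have hd : ∀ x, deriv (fun y => G.eval y) x = (2*((a:ℝ)+b+1) * x - (2*(b:ℝ)+1)) * ((derivative R).eval x)^2 := by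
    intro x
    rw [Polynomial.deriv, hG]; simp
  have hle : K * (R.eval t)^2 ≤ G.eval t := by
    have : 0 ≤ t * (1-t) * ((derivative R).eval t)^2 :=
      mul_nonneg (mul_nonneg ht.1 (by linarith [ht.2])) (sq_nonneg _)
    simp [G]; linarith
  have hG0 : G.eval 0 = K * ((k+b).choose k:ℝ)^2 := by
    simp [G]; left; rw [hR, rp_zero]
  have hG1 : G.eval 1 = K * ((k+a).choose k:ℝ)^2 := by
    simp [G]; left; rw [hR, rp_one]
  have hc : (0:ℝ) < 2*((a:ℝ)+b+1) := by positivity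
  rcases le_or_gt (2*((a:ℝ)+b+1) * t) (2*(b:ℝ)+1) with h | h
  · have : AntitoneOn (fun y => G.eval y) (Set.Icc 0 t) := by
      apply antitoneOn_of_deriv_nonpos (convex_Icc _ _) (by fun_prop) (by fun_prop)
      intro x hx
      rw [interior_Icc] at hx
      rw [hd]
      apply mul_nonpos_of_nonpos_of_nonneg _ (sq_nonneg _)
      nlinarith [mul_le_mul_of_nonneg_left hx.2.le hc.le]
    have := this (Set.left_mem_Icc.2 ht.1) (Set.right_mem_Icc.2 ht.1) ht.1
    simp only [hG0] at this
    apply le_max_of_le_left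
    exact le_of_mul_le_mul_left (hle.trans this) hKpos
  · have : MonotoneOn (fun y => G.eval y) (Set.Icc t 1) := by
      apply monotoneOn_of_deriv_nonneg (convex_Icc _ _) (by fun_prop) (by fun_prop)
      intro x hx
      rw [interior_Icc] at hx
      rw [hd]
      apply mul_nonneg _ (sq_nonneg _)
      nlinarith [mul_le_mul_of_nonneg_left hx.1.le hc.le]
    have := this (Set.left_mem_Icc.2 ht.2) (Set.right_mem_Icc.2 ht.2) ht.2
    simp only [hG1] at this
    apply le_max_of_le_right
    exact le_of_mul_le_mul_left (hle.trans this) hKpos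


open Polynomial in
lemma int_der (p : ℝ[X]) : ∫ t in (0:ℝ)..1, (derivative p).eval t = p.eval 1 - p.eval 0 := by
  rw [intervalIntegral.integral_eq_sub_of_hasDerivAt (f := fun t => p.eval t)]
  · intro x _; exact p.hasDerivAt x
  · exact (Polynomial.continuous _).intervalIntegrable _ _

open Polynomial in
lemma beta_nat (q : ℕ) : ∀ p : ℕ, ∫ t in (0:ℝ)..1, t^p * (1-t)^q =
    (p.factorial * q.factorial : ℝ) / (p+q+1).factorial := by
  induction q with
  | zero =>
    intro p
    simp [Nat.factorial_succ]
    have := Nat.factorial_ne_zero p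
    field_simp
  | succ q ih =>
    intro p
    have h := int_der (X^(p+1) * (1-X)^(q+1))
    have e : ∀ t : ℝ, (derivative ((X:ℝ[X])^(p+1) * (1-X)^(q+1))).eval t =
       ((p:ℝ)+1) * (t^p * (1-t)^(q+1)) - ((q:ℝ)+1) * (t^(p+1) * (1-t)^q) := by
      intro t
      simp [derivative_mul, derivative_pow]; ring
    simp only [e] at h
    rw [intervalIntegral.integral_sub (by apply Continuous.intervalIntegrable; fun_prop)
      (by apply Continuous.intervalIntegrable; fun_prop), intervalIntegral.integral_const_mul,
      intervalIntegral.integral_const_mul, ih (p+1)] at h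
    simp at h
    have e1 : p+1+q+1 = p+(q+1)+1 := by ring
    rw [e1] at h
    have hp : (p:ℝ)+1 ≠ 0 := by positivity
    have := Nat.factorial_ne_zero (p+(q+1)+1)
    apply mul_left_cancel₀ hp
    rw [sub_eq_zero.1 h, Nat.factorial_succ p, Nat.factorial_succ q]
    push_cast
    ring

open Polynomial in
lemma ibp_iter (W : ℝ[X]) (k : ℕ) : ∀ (p : ℝ[X]), X^k ∣ W → (1-X)^k ∣ W →
    ∫ t in (0:ℝ)..1, (derivative^[k] W).eval t * p.eval t =
      (-1)^k * ∫ t in (0:ℝ)..1, W.eval t * (derivative^[k] p).eval t := by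
  induction k with
  | zero => intro p _ _; simp
  | succ k ih =>
    intro p h0 h1
    have z0 : (derivative^[k] W).eval 0 = 0 := by
      have := pow_sub_dvd_iterate_derivative_of_pow_dvd k h0
      rw [Nat.add_sub_cancel_left, pow_one] at this
      obtain ⟨c, hc⟩ := this
      rw [hc]; simp
    have z1 : (derivative^[k] W).eval 1 = 0 := by
      have := pow_sub_dvd_iterate_derivative_of_pow_dvd k h1
      rw [Nat.add_sub_cancel_left, pow_one] at this
      obtain ⟨c, hc⟩ := this
      rw [hc]; simp
    have h := int_der (derivative^[k] W * p)
    simp only [derivative_mul, eval_add, eval_mul, z0, z1] at h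
    rw [intervalIntegral.integral_add (by apply Continuous.intervalIntegrable; fun_prop)
      (by apply Continuous.intervalIntegrable; fun_prop)] at h
    have h2 := ih (derivative p) ((pow_dvd_pow _ (Nat.le_succ k)).trans h0) ((pow_dvd_pow _ (Nat.le_succ k)).trans h1)
    rw [Function.iterate_succ_apply', Function.iterate_succ_apply]
    rw [h2] at h
    rw [pow_succ]
    linarith

open Polynomial in
lemma rp_ibp (a b k : ℕ) (p : ℝ[X]) :
    ∫ t in (0:ℝ)..1, t^b * (1-t)^a * ((rp (a+b) b k).eval t * p.eval t) =
     (1/(k.factorial:ℝ)) * ∫ t in (0:ℝ)..1, t^(b+k) * (1-t)^(a+k) * (derivative^[k] p).eval t := by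
  have h := ibp_iter (X^(b+k) * (1-X)^(a+k)) k p
    (Dvd.dvd.mul_right (pow_dvd_pow _ (by omega)) _) (Dvd.dvd.mul_left (pow_dvd_pow _ (by omega)) _)
  rw [rod] at h
  have e : ∀ t : ℝ, eval t (C ((-1) ^ k * (k.factorial:ℝ)) * (X ^ b * (1 - X) ^ a * rp (a + b) b k)) * eval t p
     = ((-1) ^ k * (k.factorial:ℝ)) * (t^b * (1-t)^a * ((rp (a+b) b k).eval t * p.eval t)) := by
    intro t; simp; ring
  simp only [e] at h
  rw [intervalIntegral.integral_const_mul] at h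
  simp only [eval_mul, eval_pow, eval_X, eval_sub, eval_one] at h
  have hf : (k.factorial:ℝ) ≠ 0 := by positivity
  rw [mul_assoc] at h
  have := mul_left_cancel₀ (by positivity) h
  rw [← this]; field_simp

open Polynomial in
lemma rp_natDegree (e b k : ℕ) : (rp e b k).natDegree ≤ k := by
  rw [natDegree_le_iff_coeff_eq_zero]
  intro n hn
  rw [rp_coeff]; unfold rpC; rw [Nat.choose_eq_zero_of_lt hn]; simp

noncomputable def nrm (a b k : ℕ) : ℝ := ((k+a).factorial * (k+b).factorial : ℝ) /
  ((2*k+(a+b)+1) * k.factorial * (k+(a+b)).factorial * (a.factorial * b.factorial))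

open Polynomial in
lemma rp_orth_lt (a b k : ℕ) (p : ℝ[X]) (hp : p.natDegree < k) :
    ∫ t in (0:ℝ)..1, t^b * (1-t)^a * ((rp (a+b) b k).eval t * p.eval t) = 0 := by
  rw [rp_ibp, iterate_derivative_eq_zero hp]; simp

open Polynomial in
lemma rp_norm (a b k : ℕ) :
    ∫ t in (0:ℝ)..1, t^b * (1-t)^a * ((rp (a+b) b k).eval t * (rp (a+b) b k).eval t) =
     nrm a b k * (a.factorial * b.factorial) := by
  rw [rp_ibp]
  have h : derivative^[k] (rp (a+b) b k) = C ((k.factorial:ℝ) * rpC (a+b) b k k) := by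
    have h0 : (derivative^[k] (rp (a+b) b k)).natDegree ≤ 0 := by
      have := natDegree_iterate_derivative (rp (a+b) b k) k
      have h2 := rp_natDegree (a+b) b k
      omega
    rw [eq_C_of_natDegree_le_zero h0, coeff_iterate_derivative, Nat.zero_add, rp_coeff, Nat.descFactorial_self]
    simp
  rw [h]
  simp only [eval_C]
  rw [intervalIntegral.integral_mul_const, beta_nat]
  unfold rpC nrm
  have e1 : b+k+(a+k)+1 = (k+(a+b)+k)+1 := by ring
  rw [e1, Nat.factorial_succ, add_comm b k, add_comm a k]
  have h2 : (-1:ℝ)^(k+k) = 1 := by rw [← two_mul, pow_mul]; norm_num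
  rw [h2, Nat.choose_self]
  push_cast
  field_simp
  ring_nf

open Polynomial in
lemma rp_orth (a b k l : ℕ) (h : k ≠ l) :
    ∫ t in (0:ℝ)..1, t^b * (1-t)^a * ((rp (a+b) b k).eval t * (rp (a+b) b l).eval t) = 0 := by
  rcases lt_or_gt_of_ne h with h | h
  · simp only [mul_comm (eval _ (rp (a+b) b k))]
    exact rp_orth_lt _ _ _ _ ((rp_natDegree _ _ _).trans_lt h)
  · exact rp_orth_lt _ _ _ _ ((rp_natDegree _ _ _).trans_lt h)


def splx (n : ℕ) (t : ℝ) : Set (Fin n → ℝ) :=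
  {x | (∀ i, x i ∈ Set.Icc (0:ℝ) t) ∧ ∀ i j : Fin n, i ≤ j → x i ≤ x j}

lemma splx_compact (n : ℕ) (t : ℝ) : IsCompact (splx n t) := by
  have hc : IsCompact (Set.pi Set.univ (fun _ : Fin n => Set.Icc (0:ℝ) t)) :=
    isCompact_univ_pi fun _ => isCompact_Icc
  have hcl : IsClosed {x : Fin n → ℝ | ∀ i j : Fin n, i ≤ j → x i ≤ x j} := by
    simp only [Set.ofPred_forall]
    refine isClosed_iInter fun i => isClosed_iInter fun j => isClosed_iInter fun _ => ?_
    exact isClosed_le (continuous_apply i) (continuous_apply j)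
  have : splx n t = (Set.pi Set.univ (fun _ : Fin n => Set.Icc (0:ℝ) t)) ∩ {x : Fin n → ℝ | ∀ i j : Fin n, i ≤ j → x i ≤ x j} := by
    ext x
    constructor
    · rintro ⟨h1, h2⟩; exact ⟨fun i _ => h1 i, h2⟩
    · rintro ⟨h1, h2⟩; exact ⟨fun i => h1 i trivial, h2⟩
  rw [this]
  exact hc.inter_right hcl

lemma splx_int {n : ℕ} {t : ℝ} {F : (Fin n → ℝ) → ℝ} (hF : Continuous F) : IntegrableOn F (splx n t) :=
  hF.continuousOn.integrableOn_compact (splx_compact n t)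

lemma snoc_mem_splx (n : ℕ) (t s : ℝ) (y : Fin n → ℝ) :
    (Fin.snoc y s : Fin (n+1) → ℝ) ∈ splx (n+1) t ↔ s ∈ Set.Icc (0:ℝ) t ∧ y ∈ splx n s := by
  constructor
  · rintro ⟨h1, h2⟩
    have hs := h1 (Fin.last n)
    simp only [Fin.snoc_last] at hs
    refine ⟨hs, fun i => ?_, fun i j hij => ?_⟩
    · have a := h1 i.castSucc
      have b := h2 i.castSucc (Fin.last n) (Fin.le_last _)
      simp only [Fin.snoc_last, Fin.snoc_castSucc] at a b
      exact ⟨a.1, b⟩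
    · have b := h2 i.castSucc j.castSucc (by simpa using hij)
      simpa only [Fin.snoc_castSucc] using b
  · rintro ⟨hs, h1, h2⟩
    refine ⟨fun i => ?_, fun i j => ?_⟩
    · induction i using Fin.lastCases with
      | last => simpa using hs
      | cast i => simp only [Fin.snoc_castSucc]; exact ⟨(h1 i).1, (h1 i).2.trans hs.2⟩
    · induction i using Fin.lastCases with
      | last =>
        intro hij
        have : j = Fin.last n := le_antisymm (Fin.le_last _) hij
        rw [this]
      | cast i =>
        induction j using Fin.lastCases with
        | last => intro _; simp only [Fin.snoc_last, Fin.snoc_castSucc]; exact (h1 i).2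
        | cast j => intro hij; simp only [Fin.snoc_castSucc]; exact h2 i j (by simpa using hij)

lemma splx_slice (n : ℕ) (t : ℝ) (ht : 0 ≤ t) (F : (Fin (n+1) → ℝ) → ℝ) (hF : Continuous F) :
    ∫ x in splx (n+1) t, F x = ∫ s in (0:ℝ)..t, ∫ y in splx n s, F (Fin.snoc y s) := by
  have hm : ∀ n t, MeasurableSet (splx n t) := fun n t => (splx_compact n t).measurableSet
  rw [← integral_indicator (hm _ _)]
  have hmp := (volume_preserving_piFinSuccAbove (fun _ : Fin (n+1) => ℝ) (Fin.last n)).symm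
  have hfint : Integrable ((splx (n+1) t).indicator F) :=
    (integrable_indicator_iff (hm _ _)).2 (splx_int hF)
  rw [← hmp.integral_comp']
  have hfint2 := (hmp.integrable_comp_emb (MeasurableEquiv.measurableEmbedding _)).2 hfint
  rw [Measure.volume_eq_prod, show (∫ x : ℝ × (Fin n → ℝ), (splx (n + 1) t).indicator F ((MeasurableEquiv.piFinSuccAbove (fun _ => ℝ) (Fin.last n)).symm x) ∂volume.prod volume) = _ from integral_prod _ hfint2]
  rw [intervalIntegral.integral_of_le ht, ← integral_Icc_eq_integral_Ioc, ← integral_indicator measurableSet_Icc]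
  congr 1
  ext s
  have key : ∀ y : Fin n → ℝ, (MeasurableEquiv.piFinSuccAbove (fun _ : Fin (n+1) => ℝ) (Fin.last n)).symm (s, y) = (Fin.snoc y s : Fin (n+1) → ℝ) := by
    intro y
    simp [MeasurableEquiv.piFinSuccAbove, Fin.insertNthEquiv]
  by_cases hs : s ∈ Set.Icc (0:ℝ) t
  · rw [Set.indicator_of_mem hs, ← integral_indicator (hm _ _)]
    congr 1
    ext y
    rw [key]
    by_cases hy : y ∈ splx n s
    · rw [Set.indicator_of_mem hy, Set.indicator_of_mem ((snoc_mem_splx n t s y).2 ⟨hs, hy⟩)]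
    · rw [Set.indicator_of_notMem hy, Set.indicator_of_notMem (fun h => hy ((snoc_mem_splx n t s y).1 h).2)]
  · rw [Set.indicator_of_notMem hs]
    apply integral_eq_zero_of_ae
    refine Filter.Eventually.of_forall fun y => ?_
    simp only [key]
    rw [Set.indicator_of_notMem (fun h => hs ((snoc_mem_splx n t s y).1 h).1)]
    rfl

lemma int_pow_aux (t : ℝ) (c : ℝ) (n : ℕ) (f : ℝ → ℝ) (ht : 0 ≤ t) (h : ∀ s, 0 ≤ s → f s = c * s^n) :
    ∫ s in (0:ℝ)..t, f s = c / (n+1) * t^(n+1) := by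
  have : ∫ s in (0:ℝ)..t, f s = ∫ s in (0:ℝ)..t, c * s^n := by
    apply intervalIntegral.integral_congr
    intro s hs
    rw [Set.uIcc_of_le ht] at hs
    exact h s hs.1
  rw [this, intervalIntegral.integral_const_mul, integral_pow]
  simp; ring

lemma splx_vol (n : ℕ) : ∀ t : ℝ, 0 ≤ t → ∫ _x in splx n t, (1:ℝ) = 1 / n.factorial * t^n := by
  induction n with
  | zero =>
    intro t ht
    have : splx 0 t = Set.univ := by ext x; simp [splx]
    rw [this]
    simp [Measure.real, volume_pi]
  | succ n ih =>
    intro t ht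
    rw [splx_slice n t ht _ continuous_const, int_pow_aux t _ n _ ht ih, Nat.factorial_succ]
    push_cast; field_simp

lemma splx_mom (n : ℕ) : ∀ (t : ℝ), 0 ≤ t → ∀ i j : Fin n, i ≤ j → ∀ p q : ℕ,
    ∫ x in splx n t, (x i)^p * (x j)^q =
     ((i.1+p).factorial * (j.1+p+q).factorial : ℝ) / (i.1.factorial * (j.1+p).factorial * (n+p+q).factorial)
        * t^(n+p+q) := by
  induction n with
  | zero => intro t ht i; exact i.elim0
  | succ n ih =>
    intro t ht i j hij p q
    have hcont : Continuous fun x : Fin (n+1) → ℝ => (x i)^p * (x j)^q := by fun_prop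
    rw [splx_slice n t ht _ hcont]
    have hfac : n+1+p+q = n+p+q+1 := by ring
    induction j using Fin.lastCases with
    | last =>
      induction i using Fin.lastCases with
      | last =>
        rw [int_pow_aux t (1/n.factorial) (n+p+q) _ ht]
        · rw [hfac, Nat.factorial_succ]
          simp
          field_simp
          simp
        · intro s hs
          simp only [Fin.snoc_last]
          rw [← mul_one (s^p*s^q), integral_const_mul, splx_vol n s hs]
          ring
      | cast i =>
        rw [int_pow_aux t (((i.1+p).factorial:ℝ)/(i.1.factorial * (n+p).factorial)) (n+p+q) _ ht]
        · rw [hfac, Nat.factorial_succ]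
          simp
          field_simp
          simp
        · intro s hs
          simp only [Fin.snoc_last, Fin.snoc_castSucc]
          rw [integral_mul_const]
          have := ih s hs i i le_rfl p 0
          simp only [pow_zero, mul_one, add_zero] at this
          rw [this]
          field_simp
          ring
    | cast j =>
      induction i using Fin.lastCases with
      | last => exact absurd (le_antisymm (Fin.le_last _) hij) (Fin.castSucc_lt_last j).ne
      | cast i =>
        have hij' : i ≤ j := by simpa using hij
        rw [int_pow_aux t (((i.1+p).factorial * (j.1+p+q).factorial : ℝ) / (i.1.factorial * (j.1+p).factorial * (n+p+q).factorial)) (n+p+q) _ ht]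
        · rw [hfac, Nat.factorial_succ]
          simp
          field_simp
          simp
        · intro s hs
          simp only [Fin.snoc_castSucc]
          exact ih s hs i j hij' p q

open Polynomial in
lemma rp_eval (e b k : ℕ) (t : ℝ) : (rp e b k).eval t = ∑ s ∈ Finset.range (k+1), rpC e b k s * t^s := by
  simp [rp, eval_finsetSum]

open Polynomial in
lemma rp_joint (a e k : ℕ) (i j : Fin (e+1)) (hij : i ≤ j) (hj : a + j.1 = e) (Q : ℝ[X]) :
    ∫ x in splx (e+1) 1, (rp e i.1 k).eval (x i) * Q.eval (x j) =
     ((k+i.1).factorial : ℝ) / ((k+j.1).factorial * i.1.factorial * a.factorial) *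
      ∫ t in (0:ℝ)..1, t^(j.1) * (1-t)^a * ((rp e j.1 k).eval t * Q.eval t) := by
  induction Q using Polynomial.induction_on' with
  | add P Q hP hQ =>
    simp only [eval_add, mul_add]
    rw [integral_add (splx_int (by fun_prop)) (splx_int (by fun_prop)),
      intervalIntegral.integral_add (by apply Continuous.intervalIntegrable; fun_prop)
      (by apply Continuous.intervalIntegrable; fun_prop), hP, hQ, mul_add]
  | monomial q c =>
    simp only [rp_eval, eval_monomial, Finset.sum_mul, Finset.mul_sum]
    rw [integral_finsetSum _ (fun s _ => splx_int (by fun_prop)),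
      intervalIntegral.integral_finsetSum (fun s _ => by apply Continuous.intervalIntegrable; fun_prop),
      Finset.mul_sum]
    refine Finset.sum_congr rfl fun s _ => ?_
    have e1 : ∀ x : Fin (e+1) → ℝ, rpC e i.1 k s * x i ^ s * (c * x j ^ q) = (rpC e i.1 k s * c) * (x i^s * x j^q) := by
      intro x; ring
    have e2 : ∀ t : ℝ, t^j.1 * (1-t)^a * (rpC e j.1 k s * t^s * (c * t^q)) = (rpC e j.1 k s * c) * (t^(j.1+s+q) * (1-t)^a) := by
      intro x; ring
    simp only [e1, e2]
    rw [integral_const_mul, intervalIntegral.integral_const_mul, splx_mom _ 1 zero_le_one i j hij, beta_nat]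
    have e3 : j.1+s+q+a+1 = e+1+s+q := by omega
    rw [e3]
    unfold rpC
    field_simp
    simp


lemma quad_aux (u th : ℕ → ℝ) (C : ℝ) (hC0 : 0 < C) (d : ℕ) (hu : ∀ i, i ≤ d → 0 < u i)
    (h4 : ∀ i, i < d → 4 ≤ C * (1 - (u i / u (i+1))^2)) (n : ℕ) (hn : n ≤ d) :
    ∑ i ∈ Finset.range (n+1), (th i)^2 - 2 * ((∑ i ∈ Finset.range (n+1), th i * u i) / u n)^2 ≤
     C * (∑ i ∈ Finset.range (n+1), ∑ j ∈ Finset.range (n+1), th i * th j * (u (min i j) / u (max i j))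
       - ((∑ i ∈ Finset.range (n+1), th i * u i) / u n)^2) := by
  induction n with
  | zero =>
    have := (hu 0 (by omega)).ne'
    simp
    field_simp
    nlinarith [sq_nonneg (th 0)]
  | succ n ih =>
    have ih := ih (by omega)
    have h4 := h4 n (by omega)
    have hu1 := hu (n+1) (by omega)
    have hu0 := hu n (by omega)
    rw [Finset.sum_range_succ (fun i => (th i)^2) (n+1), Finset.sum_range_succ (fun i => th i * u i) (n+1)]
    set S := ∑ i ∈ Finset.range (n+1), th i * u i with hS
    set T := ∑ i ∈ Finset.range (n+1), (th i)^2 with hT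
    set Q := ∑ i ∈ Finset.range (n+1), ∑ j ∈ Finset.range (n+1), th i * th j * (u (min i j) / u (max i j)) with hQ
    have hQ' : ∑ i ∈ Finset.range (n+1+1), ∑ j ∈ Finset.range (n+1+1), th i * th j * (u (min i j) / u (max i j))
        = Q + 2 * th (n+1) * S / u (n+1) + (th (n+1))^2 := by
      rw [Finset.sum_range_succ]
      simp only [Finset.sum_range_succ _ (n+1)]
      rw [Finset.sum_add_distrib, ← hQ]
      have h1 : ∑ i ∈ Finset.range (n+1), th i * th (n+1) * (u (min i (n+1)) / u (max i (n+1))) = th (n+1) * S / u (n+1) := by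
        rw [hS, Finset.mul_sum, Finset.sum_div]
        refine Finset.sum_congr rfl fun i hi => ?_
        have : i ≤ n+1 := by have := Finset.mem_range.1 hi; omega
        rw [min_eq_left this, max_eq_right this]; ring
      have h2 : ∑ i ∈ Finset.range (n+1), th (n+1) * th i * (u (min (n+1) i) / u (max (n+1) i)) = th (n+1) * S / u (n+1) := by
        rw [← h1]
        refine Finset.sum_congr rfl fun i hi => ?_
        rw [min_comm, max_comm]; ring
      rw [h1, h2, min_self, max_self, div_self hu1.ne']
      ring
    rw [hQ']
    set r := u n / u (n+1) with hr
    set x := S / u n with hx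
    have hSx : S / u (n+1) = r * x := by rw [hr, hx]; field_simp
    have hy : (S + th (n+1) * u (n+1)) / u (n+1) = r * x + th (n+1) := by
      rw [add_div, hSx]; field_simp
    rw [hy]
    have e : 2 * th (n+1) * S / u (n+1) = 2 * th (n+1) * (r*x) := by rw [← hSx]; ring
    rw [e]
    have hmul : 4 * x^2 ≤ C * (1 - r^2) * x^2 := mul_le_mul_of_nonneg_right h4 (sq_nonneg x)
    have hCc : C * (Q + 2 * th (n+1) * (r*x) + th (n+1)^2 - (r*x+th (n+1))^2) = C * (Q - x^2) + C*(1-r^2)*x^2 := by ring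
    rw [hCc]
    have hr1 : r^2 ≤ 1 := by
      by_contra hcon
      push Not at hcon
      nlinarith [mul_pos hC0 (sub_pos.2 hcon)]
    have hrx : r^2 * x^2 ≤ x^2 := by nlinarith [sq_nonneg x]
    nlinarith [sq_nonneg (2 * (r * x) + th (n+1))]

noncomputable def phN (a b k : ℕ) (t : ℝ) : ℝ := (rp (a+b) b k).eval t / √(nrm a b k)

noncomputable def uu (e k i : ℕ) : ℝ := ((k+i).factorial : ℝ) / i.factorial / √(nrm (e-i) i k)

lemma nrm_pos (a b k : ℕ) : 0 < nrm a b k := by unfold nrm; positivity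

lemma phN_cont (a b k : ℕ) : Continuous (phN a b k) := by unfold phN; fun_prop

lemma gram_le (e k l : ℕ) (i j : Fin (e+1)) (hij : i ≤ j) :
    ∫ x in splx (e+1) 1, phN (e-i.1) i.1 k (x i) * phN (e-j.1) j.1 l (x j) =
     if k = l then uu e k i.1 / uu e k j.1 else 0 := by
  have hi : e - i.1 + i.1 = e := by have := i.2; omega
  have hj : e - j.1 + j.1 = e := by have := j.2; omega
  unfold phN
  rw [hi, hj]
  have : ∀ x : Fin (e+1) → ℝ, (rp e i.1 k).eval (x i) / √(nrm (e-i.1) i.1 k) * ((rp e j.1 l).eval (x j) / √(nrm (e-j.1) j.1 l))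
    = (1/√(nrm (e-i.1) i.1 k) * (1/√(nrm (e-j.1) j.1 l))) * ((rp e i.1 k).eval (x i) * (rp e j.1 l).eval (x j)) := by
    intro x; ring
  simp only [this]
  rw [integral_const_mul, rp_joint (e-j.1) e k i j hij hj]
  split_ifs with h
  · subst h
    have h1 := rp_norm (e-j.1) j.1 k
    rw [hj] at h1
    rw [h1]
    unfold uu
    have hNi := nrm_pos (e-i.1) i.1 k
    have hNj := nrm_pos (e-j.1) j.1 k
    have s1 := Real.sqrt_pos.2 hNi
    have s2 := Real.sqrt_pos.2 hNj
    have s3 := Real.sq_sqrt hNj.le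
    field_simp
    rw [s3]
  · have h1 := rp_orth (e-j.1) j.1 k l h
    rw [hj] at h1
    rw [h1]; ring

lemma gram (e k l : ℕ) (i j : Fin (e+1)) :
    ∫ x in splx (e+1) 1, phN (e-i.1) i.1 k (x i) * phN (e-j.1) j.1 l (x j) =
     if k = l then uu e k (min i.1 j.1) / uu e k (max i.1 j.1) else 0 := by
  rcases le_total i j with h | h
  · have h' : i.1 ≤ j.1 := h
    rw [gram_le e k l i j h, min_eq_left h', max_eq_right h']
  · have h' : j.1 ≤ i.1 := h
    simp only [mul_comm (phN (e-i.1) i.1 k _)]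
    rw [gram_le e l k j i h, min_eq_right h', max_eq_left h']
    by_cases hk : k = l
    · subst hk; simp
    · rw [if_neg hk, if_neg (Ne.symm hk)]

lemma phN_mean (e k : ℕ) (hk : 1 ≤ k) (i : Fin (e+1)) :
    ∫ x in splx (e+1) 1, phN (e-i.1) i.1 k (x i) = 0 := by
  have hi : e - i.1 + i.1 = e := by have := i.2; omega
  unfold phN
  rw [hi, integral_div]
  have h := rp_joint (e-i.1) e k i i le_rfl hi 1
  have h1 := rp_orth_lt (e-i.1) i.1 k 1 (by simp; omega)
  rw [hi] at h1
  rw [h1] at h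
  simp at h
  rw [h]; simp

lemma uu_pos (e k i : ℕ) : 0 < uu e k i := by
  unfold uu; have := nrm_pos (e-i) i k; positivity

lemma uu_ratio (e k i : ℕ) (hk : 1 ≤ k) (he : 1 ≤ e) (hi : i < e) :
    4 ≤ 3 * ((e:ℝ)+1) * (1 - (uu e k i / uu e k (i+1))^2) := by
  obtain ⟨q, rfl⟩ : ∃ q, e = i + 1 + q := ⟨e - (i+1), by omega⟩
  have key : (uu (i+1+q) k i / uu (i+1+q) k (i+1))^2 = ((i:ℝ)+1)/(k+i+1) * ((q+1)/(k+q+1)) := by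
    unfold uu
    have e1 : i+1+q-i = q+1 := by omega
    have e2 : i+1+q-(i+1) = q := by omega
    rw [e1, e2]
    have h1 := nrm_pos (q+1) i k
    have h2 := nrm_pos q (i+1) k
    simp only [div_pow]
    rw [Real.sq_sqrt h1.le, Real.sq_sqrt h2.le]
    unfold nrm
    have e3 : q+1+i = q+(i+1) := by ring
    have e4 : k + (q+1) = (k+q)+1 := by ring
    have e5 : k + (i+1) = (k+i)+1 := by ring
    rw [e3, e4, e5, Nat.factorial_succ (k+q), Nat.factorial_succ (k+i), Nat.factorial_succ q, Nat.factorial_succ i]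
    push_cast
    field_simp
    ring
  rw [key]
  have hk' : (1:ℝ) ≤ k := by exact_mod_cast hk
  have b1 : ((i:ℝ)+1)/(k+i+1) ≤ ((i:ℝ)+1)/(i+2) := by
    apply div_le_div_of_nonneg_left <;> first | positivity | linarith
  have b2 : ((q:ℝ)+1)/(k+q+1) ≤ ((q:ℝ)+1)/(q+2) := by
    apply div_le_div_of_nonneg_left <;> first | positivity | linarith
  have b3 : ((i:ℝ)+1)/(k+i+1) * ((q+1)/(k+q+1)) ≤ ((i:ℝ)+1)/(i+2) * (((q:ℝ)+1)/(q+2)) :=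
    mul_le_mul b1 b2 (by positivity) (by positivity)
  have b4 : (4:ℝ) ≤ 3 * ((i+1+q : ℕ)+1) * (1 - ((i:ℝ)+1)/(i+2) * (((q:ℝ)+1)/(q+2))) := by
    have : 3 * (((i+1+q : ℕ):ℝ)+1) * (1 - ((i:ℝ)+1)/(i+2) * (((q:ℝ)+1)/(q+2))) = 3 * ((i:ℝ)+q+2) * (i+q+3) / ((i+2)*(q+2)) := by
      push_cast; field_simp; ring
    rw [this, le_div_iff₀ (by positivity)]
    have hi0 : (0:ℝ) ≤ i := by positivity
    have hq0 : (0:ℝ) ≤ q := by positivity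
    nlinarith [sq_nonneg ((i:ℝ)-q), mul_nonneg hi0 hq0]
  refine b4.trans ?_
  apply mul_le_mul_of_nonneg_left _ (by positivity)
  linarith

lemma quad_lower (e k : ℕ) (hk : 1 ≤ k) (he : 1 ≤ e) (th : ℕ → ℝ) :
    ∑ i ∈ Finset.range (e+1), (th i)^2 ≤ 3 * ((e:ℝ)+1) *
      ∑ i ∈ Finset.range (e+1), ∑ j ∈ Finset.range (e+1), th i * th j * (uu e k (min i j) / uu e k (max i j)) := by
  have h := quad_aux (uu e k) th (3 * ((e:ℝ)+1)) (by positivity) e (fun i _ => uu_pos e k i) (fun i hi => uu_ratio e k i hk he hi) e le_rfl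
  have he' : (0:ℝ) ≤ e := by positivity
  nlinarith [sq_nonneg ((∑ i ∈ Finset.range (e+1), th i * uu e k i) / uu e k e)]

lemma l2_lower (e : ℕ) (he : 1 ≤ e) (N : ℕ) (th : ℕ → ℕ → ℝ) :
    ∑ i ∈ Finset.range (e+1), ∑ k ∈ Finset.range N, (th i k)^2 ≤ 3 * ((e:ℝ)+1) *
     ∫ x in splx (e+1) 1, (∑ i : Fin (e+1), ∑ k ∈ Finset.range N, th i k * phN (e-i.1) i.1 (k+1) (x i))^2 := by
  have hc := phN_cont
  have h : ∫ x in splx (e+1) 1, (∑ i : Fin (e+1), ∑ k ∈ Finset.range N, th i k * phN (e-i.1) i.1 (k+1) (x i))^2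
     = ∑ k ∈ Finset.range N, ∑ i ∈ Finset.range (e+1), ∑ j ∈ Finset.range (e+1), th i k * th j k * (uu e (k+1) (min i j) / uu e (k+1) (max i j)) := by
    have e1 : ∀ x : Fin (e+1) → ℝ, (∑ i : Fin (e+1), ∑ k ∈ Finset.range N, th i k * phN (e-i.1) i.1 (k+1) (x i))^2
      = ∑ i : Fin (e+1), ∑ k ∈ Finset.range N, ∑ j : Fin (e+1), ∑ l ∈ Finset.range N,
        (th i k * th j l) * (phN (e-i.1) i.1 (k+1) (x i) * phN (e-j.1) j.1 (l+1) (x j)) := by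
      intro x
      rw [sq]
      simp only [Finset.sum_mul, Finset.mul_sum]
      refine Finset.sum_congr rfl fun i _ => Finset.sum_congr rfl fun k _ => Finset.sum_congr rfl fun j _ => Finset.sum_congr rfl fun l _ => ?_
      ring
    simp only [e1]
    have hcc : ∀ (a b k : ℕ) (i : Fin (e+1)), Continuous fun x : Fin (e+1) → ℝ => phN a b k (x i) :=
      fun a b k i => (hc a b k).comp (continuous_apply i)
    have hfint : ∀ (i j : Fin (e+1)) (k l : ℕ), IntegrableOn (fun x : Fin (e+1) → ℝ =>
      (th i k * th j l) * (phN (e-i.1) i.1 (k+1) (x i) * phN (e-j.1) j.1 (l+1) (x j))) (splx (e+1) 1) := by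
      intro i j k l
      apply splx_int
      exact continuous_const.mul ((hcc _ _ _ _).mul (hcc _ _ _ _))
    rw [integral_finsetSum _ (fun i _ => integrable_finsetSum _ fun k _ => integrable_finsetSum _ fun j _ => integrable_finsetSum _ fun l _ => hfint i j k l)]
    have e2 : ∀ i : Fin (e+1), ∫ x in splx (e+1) 1, ∑ k ∈ Finset.range N, ∑ j : Fin (e+1), ∑ l ∈ Finset.range N,
        (th i k * th j l) * (phN (e-i.1) i.1 (k+1) (x i) * phN (e-j.1) j.1 (l+1) (x j)) =
        ∑ k ∈ Finset.range N, ∑ j : Fin (e+1), th i k * th j k * (uu e (k+1) (min i.1 j.1) / uu e (k+1) (max i.1 j.1)) := by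
      intro i
      rw [integral_finsetSum _ (fun k _ => integrable_finsetSum _ fun j _ => integrable_finsetSum _ fun l _ => hfint i j k l)]
      refine Finset.sum_congr rfl fun k hk => ?_
      rw [integral_finsetSum _ (fun j _ => integrable_finsetSum _ fun l _ => hfint i j k l)]
      refine Finset.sum_congr rfl fun j _ => ?_
      rw [integral_finsetSum _ (fun l _ => hfint i j k l)]
      simp only [integral_const_mul, gram, add_left_inj, mul_ite, mul_zero]
      rw [Finset.sum_ite_eq, if_pos hk]
    simp only [e2]
    rw [Finset.sum_comm]
    refine Finset.sum_congr rfl fun k _ => ?_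
    rw [Finset.sum_range]
    refine Finset.sum_congr rfl fun i _ => ?_
    rw [Finset.sum_range]
  rw [h, Finset.sum_comm, Finset.mul_sum]
  refine Finset.sum_le_sum fun k _ => ?_
  exact quad_lower e (k+1) (by omega) he (fun i => th i k)


open Polynomial in
lemma iteratedDeriv_poly (p : ℝ[X]) (k : ℕ) :
    iteratedDeriv k (fun s => p.eval s) = fun s => (derivative^[k] p).eval s := by
  induction k with
  | zero => simp
  | succ k ih =>
    rw [iteratedDeriv_succ, ih]
    ext s
    rw [Polynomial.deriv, Function.iterate_succ_apply']

open Polynomial in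
lemma iter_comp_aff (p : ℝ[X]) (k : ℕ) :
    derivative^[k] (p.comp (C 2 * X - 1)) = C (2^k) * (derivative^[k] p).comp (C 2 * X - 1) := by
  induction k with
  | zero => simp
  | succ k ih =>
    rw [Function.iterate_succ_apply', ih, derivative_C_mul, derivative_comp, Function.iterate_succ_apply']
    simp [pow_succ]
    ring

open Polynomial in
lemma jacobiP_eq (a b k : ℕ) (t : ℝ) (ht : t ∈ Set.Ioo (0:ℝ) 1) :
    jacobiP a b k (2*t-1) = (rp (a+b) b k).eval t := by
  unfold jacobiP
  set W : ℝ[X] := (1-X)^a * (1+X)^b * (1-X^2)^k with hW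
  have h1 : (fun s : ℝ => (1-s)^a * (1+s)^b * (1-s^2)^k) = fun s => W.eval s := by
    ext s; simp [hW]
  rw [h1, iteratedDeriv_poly]
  have h2 := congrArg (eval t) (iter_comp_aff W k)
  have h3 : W.comp (C 2 * X - 1) = C (2^(a+b+2*k)) * (X^(b+k) * (1-X)^(a+k)) := by
    simp only [hW, mul_comp, pow_comp, sub_comp, add_comp, X_comp, one_comp]
    have e1 : (1 - (C (2:ℝ) * X - 1)) = C 2 * (1-X) := by
      have : C (2:ℝ) = 2 := rfl
      rw [this]; ring
    have e2 : (1 + (C (2:ℝ) * X - 1)) = C 2 * X := by ring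
    have e3 : (1 - (C (2:ℝ) * X - 1)^2) = C 2 ^ 2 * (X*(1-X)) := by
      have : C (2:ℝ) = 2 := rfl
      rw [this]; ring
    rw [e1, e2, e3]
    simp only [C_pow, mul_pow]
    ring
  rw [h3, iterate_derivative_C_mul, rod] at h2
  simp only [eval_mul, eval_C, eval_comp, eval_sub, eval_X, eval_one, eval_pow] at h2
  have ht0 := ht.1
  have ht1 : 0 < 1 - t := by linarith [ht.2]
  have e1 : (1 - (2*t-1)) = 2*(1-t) := by ring
  have e2 : (1 + (2*t-1)) = 2*t := by ring
  rw [e1, e2]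
  have hD : eval (2*t-1) (derivative^[k] W) = 2^(a+b+k) * ((-1)^k * k.factorial * (t^b * (1-t)^a * (rp (a+b) b k).eval t)) := by
    have h2k : (2:ℝ)^k ≠ 0 := by positivity
    apply mul_left_cancel₀ h2k
    rw [← h2]; ring
  beta_reduce
  rw [hD, mul_pow, mul_pow]
  have hs : ((-1:ℝ)^k)^2 = 1 := by rw [← pow_mul, mul_comm, pow_mul]; norm_num
  field_simp
  rw [hs]
  ring

lemma phiB_eq (e b k : ℕ) (hb : b ≤ e) (t : ℝ) (ht : t ∈ Set.Ioo (0:ℝ) 1) :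
    phiB (e+1) (b+1) k t = phN (e-b) b k t := by
  obtain ⟨a, rfl⟩ : ∃ a, e = a + b := ⟨e - b, by omega⟩
  unfold phiB phN
  have e1 : a+b+1-(b+1) = a := by omega
  have e2 : b+1-1 = b := by omega
  have e3 : k+(a+b+1)-1 = k+(a+b) := by omega
  have e4 : k+(a+b+1)-(b+1) = k+a := by omega
  have e5 : k+(b+1)-1 = k+b := by omega
  have e6 : a+b-b = a := by omega
  rw [e1, e2, e3, e4, e5, e6, jacobiP_eq a b k t ht, ← Real.sqrt_mul (by positivity), div_eq_mul_inv _ (√_), ← Real.sqrt_inv, mul_comm]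
  congr 2
  unfold nrm
  push_cast
  field_simp
  ring

lemma sup_aux (a b k : ℕ) : ((k+a).choose k : ℝ)^2 / nrm a b k ≤ 2 * ((k:ℝ)+(a+b)+1)^(2*(a+b)+1) := by
  set B : ℝ := (k:ℝ)+(a+b)+1 with hB
  have hB1 : 1 ≤ B := by rw [hB]; linarith [show (0:ℝ) ≤ (k:ℝ)+(a+b) by positivity]
  have hasc : ∀ n, n ≤ a+b → (((k+1).ascFactorial n : ℕ):ℝ) ≤ B^(a+b) := by
    intro n hn
    have h1 := Nat.ascFactorial_le_pow_add k n
    have h2 : (((k+1).ascFactorial n : ℕ):ℝ) ≤ ((k:ℝ)+n)^n := by exact_mod_cast h1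
    refine h2.trans ?_
    have hn' : (n:ℝ) ≤ a+b := by exact_mod_cast hn
    calc ((k:ℝ)+n)^n ≤ B^n := by gcongr; rw [hB]; linarith
      _ ≤ B^(a+b) := pow_le_pow_right₀ hB1 hn
  have hf : ∀ n, ((k+n).factorial:ℝ) = k.factorial * ((k+1).ascFactorial n : ℕ) := by
    intro n; exact_mod_cast (Nat.factorial_mul_ascFactorial k n).symm
  have hch : ((k+a).choose k : ℝ) = ((k+1).ascFactorial a : ℕ) / a.factorial := by
    rw [Nat.cast_choose ℝ (Nat.le_add_right k a), hf]
    have : k + a - k = a := by omega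
    rw [this]; field_simp
  have hge : (b.factorial:ℝ) ≤ ((k+1).ascFactorial b : ℕ) := by
    have : b.factorial ≤ (k+1).ascFactorial b := by
      rw [Nat.ascFactorial_eq_factorial_mul_choose]
      exact Nat.le_mul_of_pos_right _ (Nat.choose_pos (by omega))
    exact_mod_cast this
  have key : ((k+a).choose k : ℝ)^2 / nrm a b k = (2*k+(a+b)+1) * ((k+1).ascFactorial (a+b) : ℕ) *
     (((k+1).ascFactorial a : ℕ) * (b.factorial / ((k+1).ascFactorial b : ℕ)) / a.factorial) := by
    rw [hch]
    unfold nrm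
    rw [hf, hf, hf]
    have p1 : (((k+1).ascFactorial a : ℕ):ℝ) ≠ 0 := by exact_mod_cast (Nat.ascFactorial_pos k a).ne'
    have p2 : (((k+1).ascFactorial b : ℕ):ℝ) ≠ 0 := by exact_mod_cast (Nat.ascFactorial_pos k b).ne'
    field_simp
  rw [key]
  have p2 : (0:ℝ) < ((k+1).ascFactorial b : ℕ) := by exact_mod_cast (Nat.ascFactorial_pos k b)
  have c1 : (b.factorial / ((k+1).ascFactorial b : ℕ) : ℝ) ≤ 1 := (div_le_one p2).2 hge
  have c2 : (((k+1).ascFactorial a : ℕ) * (b.factorial / ((k+1).ascFactorial b : ℕ)) / a.factorial : ℝ) ≤ B^(a+b) := by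
    have ha : (1:ℝ) ≤ a.factorial := by exact_mod_cast Nat.succ_le_of_lt (Nat.factorial_pos a)
    refine (div_le_self (by positivity) ha).trans ?_
    exact (mul_le_of_le_one_right (by positivity) c1).trans (hasc a (by omega))
  calc _ ≤ (2*B) * B^(a+b) * B^(a+b) := by
        gcongr
        · rw [hB]; linarith [show (0:ℝ) ≤ (a:ℝ)+b by positivity]
        · exact hasc _ le_rfl
    _ = 2 * B^(2*(a+b)+1) := by ring

lemma phN_sup (a b k : ℕ) (hk : 1 ≤ k) (t : ℝ) (ht : t ∈ Set.Icc (0:ℝ) 1) :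
    (phN a b k t)^2 ≤ 2 * ((k:ℝ)+(a+b)+1)^(2*(a+b)+1) := by
  have hN := nrm_pos a b k
  unfold phN
  rw [div_pow, Real.sq_sqrt hN.le]
  have h := rp_sup a b k hk t ht
  have hsym : nrm a b k = nrm b a k := by
    unfold nrm; rw [add_comm a b]; ring_nf
  refine (div_le_div_of_nonneg_right h hN.le).trans ?_
  rcases le_total (((k+b).choose k:ℝ)^2) (((k+a).choose k:ℝ)^2) with hle | hle
  · rw [max_eq_right hle]; exact sup_aux a b k
  · rw [max_eq_left hle, hsym]
    have := sup_aux b a k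
    rwa [add_comm (b:ℝ) a, add_comm b a] at this


section core
variable {ι : Type} [Fintype ι] {d : ℕ}

noncomputable def cN (v : ι → ℝ) : ℝ := √(∑ j, (v j)^2)
noncomputable def cLin (φ : ι → (Fin d → ℝ) → ℝ) (v : ι → ℝ) (x : Fin d → ℝ) : ℝ := ∑ j, v j * φ j x
noncomputable def cPsi (K : Set (Fin d → ℝ)) (φ : ι → (Fin d → ℝ) → ℝ) (v : ι → ℝ) : ℝ :=
  Real.log (∫ x in K, Real.exp (cLin φ v x))
noncomputable def cF (K : Set (Fin d → ℝ)) (φ : ι → (Fin d → ℝ) → ℝ) (v : ι → ℝ) (x : Fin d → ℝ) : ℝ :=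
  Real.exp (cLin φ v x - cPsi K φ v)
noncomputable def cA (K : Set (Fin d → ℝ)) (φ : ι → (Fin d → ℝ) → ℝ) (v : ι → ℝ) (j : ι) : ℝ :=
  ∫ x in K, φ j x * cF K φ v x

structure CoreHyp (K : Set (Fin d → ℝ)) (φ : ι → (Fin d → ℝ) → ℝ) : Prop where
  hK : IsCompact K
  hpos : volume K ≠ 0
  hφ : ∀ j, Continuous (φ j)

variable {K : Set (Fin d → ℝ)} {φ : ι → (Fin d → ℝ) → ℝ}

lemma cint (H : CoreHyp K φ) {g : (Fin d → ℝ) → ℝ} (hg : Continuous g) : IntegrableOn g K :=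
  hg.continuousOn.integrableOn_compact H.hK

lemma cLin_cont (H : CoreHyp K φ) (v : ι → ℝ) : Continuous (cLin φ v) := by
  unfold cLin
  exact continuous_finsetSum _ fun j _ => continuous_const.mul (H.hφ j)

lemma cLin_cont2 (H : CoreHyp K φ) : Continuous (fun p : (ι → ℝ) × (Fin d → ℝ) => cLin φ p.1 p.2) := by
  unfold cLin
  refine continuous_finsetSum _ fun j _ => ?_
  exact ((continuous_apply j).comp continuous_fst).mul ((H.hφ j).comp continuous_snd)

lemma cZ_pos (H : CoreHyp K φ) (v : ι → ℝ) : 0 < ∫ x in K, Real.exp (cLin φ v x) := by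
  have : NeZero (volume.restrict K) := ⟨by rw [Ne, Measure.restrict_eq_zero]; exact H.hpos⟩
  exact integral_exp_pos (cint H (Real.continuous_exp.comp (cLin_cont H v)))

lemma cF_cont (H : CoreHyp K φ) (v : ι → ℝ) : Continuous (cF K φ v) :=
  Real.continuous_exp.comp ((cLin_cont H v).sub continuous_const)

lemma cF_one (H : CoreHyp K φ) (v : ι → ℝ) : ∫ x in K, cF K φ v x = 1 := by
  unfold cF cPsi
  simp only [Real.exp_sub]
  rw [integral_div, Real.exp_log (cZ_pos H v), div_self (cZ_pos H v).ne']

lemma cPsi_cont (H : CoreHyp K φ) : Continuous (cPsi K φ) := by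
  unfold cPsi
  refine Continuous.log ?_ fun v => (cZ_pos H v).ne'
  refine continuous_parametric_integral_of_continuous ?_ H.hK
  exact Real.continuous_exp.comp (cLin_cont2 H)

lemma cA_cont (H : CoreHyp K φ) (j : ι) : Continuous (fun v => cA K φ v j) := by
  unfold cA
  refine continuous_parametric_integral_of_continuous ?_ H.hK
  exact ((H.hφ j).comp continuous_snd).mul
    (Real.continuous_exp.comp ((cLin_cont2 H).sub ((cPsi_cont H).comp continuous_fst)))

lemma cA_dot (H : CoreHyp K φ) (v η : ι → ℝ) :
    ∑ j, η j * cA K φ v j = ∫ x in K, cLin φ η x * cF K φ v x := by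
  unfold cA cLin
  simp only [Finset.sum_mul]
  rw [integral_finsetSum]
  · refine Finset.sum_congr rfl fun j _ => ?_
    rw [← integral_const_mul]
    simp only [mul_assoc]
  · intro j _
    exact cint H ((continuous_const.mul (H.hφ j)).mul (cF_cont H v))

lemma cF_rel (v w : ι → ℝ) (x : Fin d → ℝ) :
    cF K φ w x = cF K φ v x * Real.exp (cLin φ (w - v) x - (cPsi K φ w - cPsi K φ v)) := by
  unfold cF
  rw [← Real.exp_add]
  congr 1
  have : cLin φ (w - v) x = cLin φ w x - cLin φ v x := by
    simp [cLin, sub_mul]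
  rw [this]; ring

lemma int_lin_aux (H : CoreHyp K φ) (v η : ι → ℝ) (c : ℝ) :
    ∫ x in K, cF K φ v x * (cLin φ η x - c) = ∑ j, η j * cA K φ v j - c := by
  have h : ∀ x, cF K φ v x * (cLin φ η x - c) = cLin φ η x * cF K φ v x - c * cF K φ v x := by
    intro x; ring
  simp only [h]
  have hcf := cF_cont H v
  have hcl := cLin_cont H η
  rw [integral_sub (cint H (by fun_prop)) (cint H (by fun_prop)),
    integral_const_mul, cF_one H, cA_dot H]
  ring

lemma gibbs (H : CoreHyp K φ) (v w : ι → ℝ) :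
    ∑ j, (w - v) j * cA K φ v j ≤ cPsi K φ w - cPsi K φ v := by
  set c := cPsi K φ w - cPsi K φ v with hc
  have hcf := cF_cont H v
  have hcl := cLin_cont H (w-v)
  have h1 : ∫ x in K, (cF K φ v x + cF K φ v x * (cLin φ (w-v) x - c)) ≤ ∫ x in K, cF K φ w x := by
    apply integral_mono (cint H (by fun_prop)) (cint H (cF_cont H w))
    intro x
    have hp : 0 < cF K φ v x := Real.exp_pos _
    beta_reduce
    rw [cF_rel v w x, ← hc]
    nlinarith [Real.add_one_le_exp (cLin φ (w-v) x - c)]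
  rw [integral_add (cint H (by fun_prop)) (cint H (by fun_prop)), cF_one H, cF_one H, int_lin_aux H] at h1
  linarith

lemma cA_dot_bd (H : CoreHyp K φ) (v η : ι → ℝ) (M : ℝ) (hM : ∀ x ∈ K, |cLin φ η x| ≤ M) :
    |∑ j, η j * cA K φ v j| ≤ M := by
  rw [cA_dot H]
  have h0 : ∫ x in K, M * cF K φ v x = M := by rw [integral_const_mul, cF_one H, mul_one]
  rw [abs_le]
  constructor
  · have h1 : ∫ x in K, (-M) * cF K φ v x = -M := by rw [integral_const_mul, cF_one H, mul_one]
    rw [← h1]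
    apply setIntegral_mono_on (cint H (continuous_const.mul (cF_cont H v))) (cint H ((cLin_cont H _).mul (cF_cont H v))) H.hK.measurableSet
    intro x hx
    exact mul_le_mul_of_nonneg_right (abs_le.1 (hM x hx)).1 (Real.exp_pos _).le
  · conv_rhs => rw [← h0]
    apply setIntegral_mono_on (cint H ((cLin_cont H _).mul (cF_cont H v))) (cint H (continuous_const.mul (cF_cont H v))) H.hK.measurableSet
    intro x hx
    exact mul_le_mul_of_nonneg_right (abs_le.1 (hM x hx)).2 (Real.exp_pos _).le

lemma exp_aux (h M : ℝ) (hM : |h| ≤ M) : Real.exp (-M) * h^2 ≤ h * (Real.exp h - 1) := by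
  have hb := abs_le.1 hM
  rcases le_total 0 h with h0 | h0
  · have h1 : Real.exp (-M) ≤ 1 := Real.exp_le_one_iff.2 (by linarith)
    nlinarith [Real.add_one_le_exp h, sq_nonneg h, mul_le_mul_of_nonneg_right h1 (sq_nonneg h)]
  · have h1 : Real.exp (-M) ≤ Real.exp h := Real.exp_le_exp.2 hb.1
    have h2 : Real.exp h * (1 - h) ≤ 1 := by
      have := Real.add_one_le_exp (-h)
      have h3 : Real.exp h * Real.exp (-h) = 1 := by rw [← Real.exp_add]; simp
      nlinarith [Real.exp_pos h]
    have h4 := mul_le_mul_of_nonneg_right h1 (sq_nonneg h)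
    nlinarith

lemma mono_bd (H : CoreHyp K φ) (hmean : ∀ j, ∫ x in K, φ j x = 0) (lam kap L : ℝ)
    (hlam : ∀ v, lam * (cN v)^2 ≤ ∫ x in K, (cLin φ v x)^2)
    (hkap : ∀ v, ∀ x ∈ K, |cLin φ v x| ≤ kap * cN v) (v w : ι → ℝ)
    (hL : ∀ᵐ x ∂(volume.restrict K), Real.exp (-L) ≤ cF K φ v x) :
    Real.exp (-L - 2 * (kap * cN (w - v))) * (lam * (cN (w-v))^2) ≤
      ∑ j, (w - v) j * (cA K φ w j - cA K φ v j) := by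
  set c := cPsi K φ w - cPsi K φ v with hc
  set s := kap * cN (w - v) with hs
  have hg1 := gibbs H v w
  have hg2 := gibbs H w v
  have hb1 := abs_le.1 (cA_dot_bd H v (w-v) s (hkap _))
  have hb2 := abs_le.1 (cA_dot_bd H w (w-v) s (hkap _))
  have hneg : ∑ j, (v - w) j * cA K φ w j = - ∑ j, (w - v) j * cA K φ w j := by
    rw [← Finset.sum_neg_distrib]
    refine Finset.sum_congr rfl fun j _ => ?_
    simp; ring
  have hcs : |c| ≤ s := by
    rw [abs_le]; constructor <;> linarith
  have hcs' := abs_le.1 hcs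
  have e1 : ∑ j, (w - v) j * (cA K φ w j - cA K φ v j) =
      ∫ x in K, (cLin φ (w-v) x - c) * (Real.exp (cLin φ (w-v) x - c) - 1) * cF K φ v x := by
    have e2 : ∀ x, (cLin φ (w-v) x - c) * (Real.exp (cLin φ (w-v) x - c) - 1) * cF K φ v x =
       cF K φ w x * (cLin φ (w-v) x - c) - cF K φ v x * (cLin φ (w-v) x - c) := by
      intro x
      rw [cF_rel v w x]; ring
    simp only [e2]
    have hcf := cF_cont H v
    have hcf2 := cF_cont H w
    have hcl := cLin_cont H (w-v)
    rw [integral_sub (cint H (by fun_prop)) (cint H (by fun_prop)), int_lin_aux H, int_lin_aux H]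
    simp only [mul_sub, Finset.sum_sub_distrib]
    ring
  rw [e1]
  have hcl := cLin_cont H (w-v)
  have e3 : ∫ x in K, Real.exp (-L - 2*s) * (cLin φ (w-v) x - c)^2 ≤
      ∫ x in K, (cLin φ (w-v) x - c) * (Real.exp (cLin φ (w-v) x - c) - 1) * cF K φ v x := by
    have hcf := cF_cont H v
    apply integral_mono_ae (cint H (by fun_prop)) (cint H (by fun_prop))
    filter_upwards [hL, ae_restrict_mem H.hK.measurableSet] with x hx hxK
    have hh : |cLin φ (w-v) x - c| ≤ 2*s := by
      have := abs_le.1 (hkap (w-v) x hxK)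
      rw [abs_le]; constructor <;> linarith
    have h1 := exp_aux _ _ hh
    have h2 : 0 ≤ Real.exp (-(2*s)) * (cLin φ (w-v) x - c)^2 := by positivity
    have h3 : Real.exp (-L - 2*s) = Real.exp (-(2*s)) * Real.exp (-L) := by
      rw [← Real.exp_add]; ring_nf
    rw [h3]
    calc _ = (Real.exp (-(2*s)) * (cLin φ (w-v) x - c)^2) * Real.exp (-L) := by ring
      _ ≤ _ := mul_le_mul h1 hx (Real.exp_pos _).le (h2.trans h1)
  refine le_trans ?_ e3
  rw [integral_const_mul]
  apply mul_le_mul_of_nonneg_left _ (Real.exp_pos _).le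
  refine (hlam (w-v)).trans ?_
  have hm : ∫ x in K, cLin φ (w-v) x = 0 := by
    unfold cLin
    rw [integral_finsetSum _ fun j _ => cint H (by have := H.hφ j; fun_prop)]
    simp [integral_const_mul, hmean]
  have e4 : ∀ x, (cLin φ (w-v) x - c)^2 = (cLin φ (w-v) x)^2 - 2*c*(cLin φ (w-v) x) + c^2 := by
    intro x; ring
  simp only [e4]
  rw [integral_add (cint H (by fun_prop)) (cint H (by fun_prop)), integral_sub (cint H (by fun_prop)) (cint H (by fun_prop)),
    integral_const_mul, hm]
  have : 0 ≤ ∫ _x in K, c^2 := integral_nonneg fun _ => sq_nonneg c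
  linarith

lemma cN_cont : Continuous (cN : (ι → ℝ) → ℝ) := by unfold cN; fun_prop

lemma cN_smul (t : ℝ) (v : ι → ℝ) : cN (t • v) = |t| * cN v := by
  unfold cN
  rw [← Real.sqrt_sq_eq_abs, ← Real.sqrt_mul (sq_nonneg t), Finset.mul_sum]
  simp [mul_pow]

lemma abs_le_cN (v : ι → ℝ) (j : ι) : |v j| ≤ cN v := by
  unfold cN
  apply Real.abs_le_sqrt
  exact Finset.single_le_sum (f := fun j => (v j)^2) (fun i _ => sq_nonneg _) (Finset.mem_univ j)

lemma cN_nonneg (v : ι → ℝ) : 0 ≤ cN v := Real.sqrt_nonneg _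

lemma cN_cs (v w : ι → ℝ) : |∑ j, v j * w j| ≤ cN v * cN w := by
  unfold cN
  rw [abs_le]
  constructor
  · have := Real.sum_mul_le_sqrt_mul_sqrt Finset.univ (fun j => - v j) w
    simp at this
    linarith
  · exact Real.sum_mul_le_sqrt_mul_sqrt _ _ _

lemma core_exists (H : CoreHyp K φ) (hmean : ∀ j, ∫ x in K, φ j x = 0) (lam kap L : ℝ)
    (hlam : ∀ v, lam * (cN v)^2 ≤ ∫ x in K, (cLin φ v x)^2)
    (hkap : ∀ v, ∀ x ∈ K, |cLin φ v x| ≤ kap * cN v) (v α : ι → ℝ)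
    (hL : ∀ᵐ x ∂(volume.restrict K), Real.exp (-L) ≤ cF K φ v x) (ρ : ℝ) (hρ : 0 < ρ)
    (hε : cN (cA K φ v - α) < lam * Real.exp (-L - 2 * (kap * ρ)) * ρ) :
    ∃ w, cA K φ w = α ∧ cN (v - w) ≤ ρ := by
  let B : Set (ι → ℝ) := {w | cN (w - v) ≤ ρ}
  have hB : IsCompact B := by
    have hc : IsCompact (Set.pi Set.univ (fun j : ι => Set.Icc (v j - ρ) (v j + ρ))) :=
      isCompact_univ_pi fun _ => isCompact_Icc
    refine hc.of_isClosed_subset ?_ ?_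
    · exact isClosed_le (cN_cont.comp (continuous_id.sub continuous_const)) continuous_const
    · intro w hw j _
      have h1 := (abs_le_cN (w - v) j).trans hw
      have h2 := abs_le.1 h1
      simp only [Pi.sub_apply] at h2
      exact ⟨by linarith, by linarith⟩
  have hne : B.Nonempty := ⟨v, by simp [B, cN]; exact hρ.le⟩
  have hFc : Continuous fun w => cPsi K φ w - ∑ j, w j * α j := by
    have := cPsi_cont H
    fun_prop
  obtain ⟨w, hwB, hmin⟩ := hB.exists_isMinOn hne hFc.continuousOn
  have hdir : ∀ η : ι → ℝ, (∀ᶠ t in nhdsWithin (0:ℝ) (Set.Ioi 0), w + t • η ∈ B) →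
      0 ≤ ∑ j, η j * (cA K φ w j - α j) := by
    intro η hη
    have hcont : Continuous fun t : ℝ => ∑ j, η j * (cA K φ (w + t • η) j - α j) := by
      refine continuous_finsetSum _ fun j _ => continuous_const.mul (Continuous.sub ?_ continuous_const)
      exact (cA_cont H j).comp (by fun_prop)
    have htend : Filter.Tendsto (fun t : ℝ => ∑ j, η j * (cA K φ (w + t • η) j - α j))
        (nhdsWithin (0:ℝ) (Set.Ioi 0)) (nhds (∑ j, η j * (cA K φ w j - α j))) := by
      have := (hcont.tendsto 0).mono_left (nhdsWithin_le_nhds (s := Set.Ioi 0))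
      simpa using this
    refine ge_of_tendsto htend ?_
    filter_upwards [hη, self_mem_nhdsWithin] with t ht ht0
    have ht0' : (0:ℝ) < t := ht0
    have h1 := isMinOn_iff.1 hmin _ ht
    have h2 := gibbs H (w + t • η) w
    have h3 : ∑ j, (w - (w + t • η)) j * cA K φ (w + t • η) j = - (t * ∑ j, η j * cA K φ (w + t • η) j) := by
      rw [Finset.mul_sum, ← Finset.sum_neg_distrib]
      refine Finset.sum_congr rfl fun j _ => ?_
      simp; ring
    have h4 : ∑ j, (w + t • η) j * α j = ∑ j, w j * α j + t * ∑ j, η j * α j := by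
      rw [Finset.mul_sum, ← Finset.sum_add_distrib]
      refine Finset.sum_congr rfl fun j _ => ?_
      simp; ring
    rw [h3] at h2
    rw [h4] at h1
    simp only [mul_sub, Finset.sum_sub_distrib]
    have h5 : 0 ≤ t * (∑ j, η j * cA K φ (w + t • η) j - ∑ j, η j * α j) := by
      rw [mul_sub]; linarith
    exact nonneg_of_mul_nonneg_right h5 ht0'
  have hsym : cN (v - w) = cN (w - v) := by
    have := cN_smul (-1) (w - v)
    simpa using this
  refine ⟨w, ?_, by rw [hsym]; exact hwB⟩
  have hwB' : cN (w - v) ≤ ρ := hwB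
  rcases lt_or_eq_of_le hwB' with hlt | heq
  · have hall : ∀ η : ι → ℝ, 0 ≤ ∑ j, η j * (cA K φ w j - α j) := by
      intro η
      apply hdir
      have hcont : Continuous fun t : ℝ => cN (w + t • η - v) := cN_cont.comp (by fun_prop)
      have : ∀ᶠ t in nhds (0:ℝ), cN (w + t • η - v) < ρ := by
        apply hcont.continuousAt.eventually_lt continuousAt_const
        simpa using hlt
      filter_upwards [nhdsWithin_le_nhds this] with t ht
      exact le_of_lt ht
    have h1 := hall (fun j => -(cA K φ w j - α j))
    have h2 : ∑ j, (cA K φ w j - α j)^2 ≤ 0 := by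
      have : ∑ j, -(cA K φ w j - α j) * (cA K φ w j - α j) = - ∑ j, (cA K φ w j - α j)^2 := by
        rw [← Finset.sum_neg_distrib]
        refine Finset.sum_congr rfl fun j _ => by ring
      linarith
    ext j
    have h3 := (Finset.sum_eq_zero_iff_of_nonneg (fun i _ => sq_nonneg (cA K φ w i - α i))).1
      (le_antisymm h2 (Finset.sum_nonneg fun i _ => sq_nonneg _)) j (Finset.mem_univ j)
    have := pow_eq_zero_iff (two_ne_zero) |>.1 h3
    linarith
  · exfalso
    have h1 := hdir (-(w - v)) (by
      have : ∀ᶠ t in nhdsWithin (0:ℝ) (Set.Ioi 0), t < 1 := nhdsWithin_le_nhds (gt_mem_nhds zero_lt_one)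
      filter_upwards [this, self_mem_nhdsWithin] with t ht1 ht0
      have ht0' : (0:ℝ) < t := ht0
      show cN _ ≤ ρ
      have e : w + t • (-(w - v)) - v = (1 - t) • (w - v) := by
        ext j; simp; ring
      rw [e, cN_smul, heq, abs_of_pos (by linarith)]
      nlinarith)
    have h2 := mono_bd H hmean lam kap L hlam hkap v w hL
    rw [heq] at h2
    have h3 := (abs_le.1 (cN_cs (w - v) (cA K φ v - α))).1
    rw [heq] at h3
    have h4 : ∑ j, (-(w - v)) j * (cA K φ w j - α j) = - (∑ j, (w - v) j * (cA K φ w j - cA K φ v j))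
        - ∑ j, (w-v) j * (cA K φ v - α) j := by
      rw [← Finset.sum_neg_distrib, ← Finset.sum_sub_distrib]
      refine Finset.sum_congr rfl fun j _ => ?_
      simp; ring
    rw [h4] at h1
    have h5 := mul_lt_mul_of_pos_left hε hρ
    nlinarith

lemma core_kl (H : CoreHyp K φ) (v w : ι → ℝ) :
    ∫ x in K, cF K φ v x * Real.log (cF K φ v x / cF K φ w x) ≤
      cN (cA K φ v - cA K φ w) * cN (v - w) := by
  have h1 : ∀ x, cF K φ v x * Real.log (cF K φ v x / cF K φ w x) =
      cF K φ v x * (cLin φ (v - w) x - (cPsi K φ v - cPsi K φ w)) := by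
    intro x
    have hw : cF K φ w x ≠ 0 := (Real.exp_pos _).ne'
    have h0 : Real.log (cF K φ v x / cF K φ w x) = cLin φ (v - w) x - (cPsi K φ v - cPsi K φ w) := by
      rw [cF_rel w v x, mul_comm (cF K φ w x), mul_div_assoc, div_self hw, mul_one, Real.log_exp]
    rw [h0]
  simp only [h1]
  rw [int_lin_aux H]
  have h2 := gibbs H w v
  have h3 := (abs_le.1 (cN_cs (cA K φ v - cA K φ w) (v - w))).2
  have h4 : ∑ j, (cA K φ v - cA K φ w) j * (v - w) j = ∑ j, (v - w) j * cA K φ v j - ∑ j, (v - w) j * cA K φ w j := by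
    rw [← Finset.sum_sub_distrib]
    refine Finset.sum_congr rfl fun j _ => ?_
    simp; ring
  linarith

end core


section final
variable {e : ℕ} {m : Fin (e+1) → ℕ}

noncomputable def fphi (e : ℕ) (m : Fin (e+1) → ℕ) (j : (i : Fin (e+1)) × Fin (m i)) (x : Fin (e+1) → ℝ) : ℝ :=
  phN (e - j.1.1) j.1.1 (j.2.1+1) (x j.1)

def unc (θ : (i : Fin (e+1)) → Fin (m i) → ℝ) (j : (i : Fin (e+1)) × Fin (m i)) : ℝ := θ j.1 j.2

lemma unc_sub (θ η : (i : Fin (e+1)) → Fin (m i) → ℝ) :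
    unc (fun i k => θ i k - η i k) = unc θ - unc η := rfl

lemma eunorm_eq (θ : (i : Fin (e+1)) → Fin (m i) → ℝ) : eunorm (e+1) m θ = cN (unc θ) := by
  unfold eunorm cN unc
  rw [Fintype.sum_sigma]

lemma core_hyp (e : ℕ) (m : Fin (e+1) → ℕ) : CoreHyp (simplexD (e+1)) (fphi e m) where
  hK := splx_compact (e+1) 1
  hpos := by
    intro h
    have h1 := splx_vol (e+1) 1 zero_le_one
    have h2 : volume (splx (e+1) 1) = 0 := h
    rw [Measure.restrict_eq_zero.2 h2] at h1
    simp at h1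
    exact absurd h1.symm (by exact_mod_cast Nat.factorial_ne_zero (e+1))
  hφ := fun j => (phN_cont _ _ _).comp (continuous_apply j.1)

lemma ae_Ioo (e : ℕ) : ∀ᵐ x ∂(volume.restrict (simplexD (e+1))), ∀ i, x i ∈ Set.Ioo (0:ℝ) 1 := by
  have hms : MeasurableSet (simplexD (e+1)) := (splx_compact (e+1) 1).measurableSet
  have h : ∀ (i : Fin (e+1)) (c : ℝ), ∀ᵐ x ∂(volume.restrict (simplexD (e+1))), x i ≠ c := by
    intro i c
    apply ae_restrict_of_ae
    rw [ae_iff]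
    simp only [not_not]
    exact Measure.pi_hyperplane (fun _ : Fin (e+1) => (volume : Measure ℝ)) i c
  rw [ae_all_iff]
  intro i
  filter_upwards [h i 0, h i 1, ae_restrict_mem hms] with x h0 h1 hx
  have := hx.1 i
  exact ⟨lt_of_le_of_ne this.1 h0.symm, lt_of_le_of_ne this.2 h1⟩

lemma lincomb_eq (θ : (i : Fin (e+1)) → Fin (m i) → ℝ) (x : Fin (e+1) → ℝ)
    (hx : ∀ i, x i ∈ Set.Ioo (0:ℝ) 1) : lincomb (e+1) m θ x = cLin (fphi e m) (unc θ) x := by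
  unfold lincomb cLin unc fphi
  rw [Fintype.sum_sigma]
  refine Finset.sum_congr rfl fun i _ => Finset.sum_congr rfl fun k _ => ?_
  rw [phiB_eq e i.1 (k.1+1) (Nat.lt_succ_iff.1 i.2) _ (hx i)]

lemma psi_eq (θ : (i : Fin (e+1)) → Fin (m i) → ℝ) :
    psiFun (e+1) m θ = cPsi (simplexD (e+1)) (fphi e m) (unc θ) := by
  unfold psiFun cPsi
  congr 1
  apply integral_congr_ae
  filter_upwards [ae_Ioo e] with x hx
  rw [lincomb_eq θ x hx]

lemma fdens_eq (θ : (i : Fin (e+1)) → Fin (m i) → ℝ) (x : Fin (e+1) → ℝ)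
    (hx : ∀ i, x i ∈ Set.Ioo (0:ℝ) 1) :
    fdens (e+1) m θ x = cF (simplexD (e+1)) (fphi e m) (unc θ) x := by
  unfold fdens cF
  rw [lincomb_eq θ x hx, psi_eq]

lemma Amap_eq (θ : (i : Fin (e+1)) → Fin (m i) → ℝ) :
    unc (Amap (e+1) m θ) = cA (simplexD (e+1)) (fphi e m) (unc θ) := by
  ext ⟨i, k⟩
  unfold unc Amap cA
  apply integral_congr_ae
  filter_upwards [ae_Ioo e] with x hx
  rw [fdens_eq θ x hx, phiB_eq e i.1 (k.1+1) (Nat.lt_succ_iff.1 i.2) _ (hx i)]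
  rfl

lemma f_mean (j : (i : Fin (e+1)) × Fin (m i)) : ∫ x in simplexD (e+1), fphi e m j x = 0 :=
  phN_mean e (j.2.1+1) (Nat.succ_le_succ (Nat.zero_le _)) j.1

lemma f_lam (he : 1 ≤ e) (v : ((i : Fin (e+1)) × Fin (m i)) → ℝ) :
    1 / (3 * ((e:ℝ)+1)) * (cN v)^2 ≤ ∫ x in simplexD (e+1), (cLin (fphi e m) v x)^2 := by
  set N := Finset.univ.sup m with hN
  have hmN : ∀ i, m i ≤ N := fun i => Finset.le_sup (f := m) (Finset.mem_univ i)
  let th : ℕ → ℕ → ℝ := fun i k => if h : ∃ hi : i < e+1, k < m ⟨i, hi⟩ then v ⟨⟨i, h.1⟩, ⟨k, h.2⟩⟩ else 0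
  have hth : ∀ (i : Fin (e+1)) (k : Fin (m i)), th i.1 k.1 = v ⟨i, k⟩ := by
    intro i k
    have : ∃ hi : i.1 < e+1, k.1 < m ⟨i.1, hi⟩ := ⟨i.2, k.2⟩
    simp only [th]
    rw [dif_pos this]
  have hsum : ∀ (i : Fin (e+1)) (g : ℕ → ℝ → ℝ), (∀ k, g k 0 = 0) →
      ∑ k ∈ Finset.range N, g k (th i.1 k) = ∑ k : Fin (m i), g k.1 (v ⟨i, k⟩) := by
    intro i g hg
    have h1 : ∑ k : Fin (m i), g k.1 (v ⟨i, k⟩) = ∑ k ∈ Finset.range (m i), g k (th i.1 k) := by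
      rw [← Fin.sum_univ_eq_sum_range (fun k => g k (th i.1 k))]
      exact Finset.sum_congr rfl fun k _ => by rw [hth]
    rw [h1]
    symm
    apply Finset.sum_subset (Finset.range_subset_range.2 (hmN i))
    intro k _ hk
    have : ¬ ∃ hi : i.1 < e+1, k < m ⟨i.1, hi⟩ := by
      rintro ⟨_, h⟩
      exact hk (Finset.mem_range.2 h)
    simp only [th]
    rw [dif_neg this, hg]
  have key := l2_lower e he N th
  have hl : ∑ i ∈ Finset.range (e+1), ∑ k ∈ Finset.range N, (th i k)^2 = (cN v)^2 := by
    unfold cN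
    rw [Real.sq_sqrt (Finset.sum_nonneg fun _ _ => sq_nonneg _), Fintype.sum_sigma,
      ← Fin.sum_univ_eq_sum_range (fun i => ∑ k ∈ Finset.range N, (th i k)^2)]
    exact Finset.sum_congr rfl fun i _ => hsum i (fun _ t => t^2) (by simp)
  have hr : ∀ x : Fin (e+1) → ℝ, ∑ i : Fin (e+1), ∑ k ∈ Finset.range N, th i k * phN (e-i.1) i.1 (k+1) (x i)
      = cLin (fphi e m) v x := by
    intro x
    unfold cLin fphi
    rw [Fintype.sum_sigma]
    exact Finset.sum_congr rfl fun i _ => hsum i (fun k t => t * phN (e-i.1) i.1 (k+1) (x i)) (by simp)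
  rw [hl] at key
  simp only [hr] at key
  have hp : (0:ℝ) < 3 * ((e:ℝ)+1) := by positivity
  rw [one_div, inv_mul_le_iff₀ hp]
  exact key

lemma f_kap (κ : ℝ) (hκ : κ = Real.sqrt (2 * ((e+1).factorial : ℝ)) *
      Real.sqrt (∑ i, ((m i + (e+1) : ℕ) : ℝ)^(2*(e+1))))
    (v : ((i : Fin (e+1)) × Fin (m i)) → ℝ) (x : Fin (e+1) → ℝ) (hx : x ∈ simplexD (e+1)) :
    |cLin (fphi e m) v x| ≤ κ * cN v := by
  have h1 := cN_cs v (fun j => fphi e m j x)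
  refine le_trans h1 ?_
  rw [mul_comm]
  apply mul_le_mul_of_nonneg_right _ (cN_nonneg v)
  rw [hκ, ← Real.sqrt_mul (by positivity)]
  apply Real.sqrt_le_sqrt
  rw [Fintype.sum_sigma, Finset.mul_sum]
  apply Finset.sum_le_sum
  intro i _
  have hb : ∀ k : Fin (m i), (fphi e m ⟨i, k⟩ x)^2 ≤ 2 * ((m i + (e+1) : ℕ) : ℝ)^(2*e+1) := by
    intro k
    have h2 := phN_sup (e - i.1) i.1 (k.1+1) (Nat.succ_le_succ (Nat.zero_le _)) (x i) (hx.1 i)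
    have h3 : e - i.1 + i.1 = e := Nat.sub_add_cancel (Nat.lt_succ_iff.1 i.2)
    have h3' : ((e - i.1 : ℕ) : ℝ) + (i.1:ℝ) = e := by exact_mod_cast h3
    rw [h3, h3'] at h2
    refine h2.trans ?_
    have h4 : ((k.1 + 1 : ℕ) : ℝ) ≤ m i := by exact_mod_cast k.2
    have h5 : ((k.1 + 1 : ℕ) : ℝ) + e + 1 ≤ ((m i + (e+1) : ℕ) : ℝ) := by
      push_cast at h4 ⊢; linarith
    have h6 := pow_le_pow_left₀ (by positivity) h5 (2*e+1)
    linarith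
  have h7 := Finset.sum_le_card_nsmul Finset.univ _ _ (fun k _ => hb k)
  refine h7.trans ?_
  simp only [Finset.card_univ, Fintype.card_fin, nsmul_eq_mul]
  have hf : (1:ℝ) ≤ ((e+1).factorial : ℝ) := by exact_mod_cast Nat.one_le_iff_ne_zero.2 (Nat.factorial_ne_zero _)
  set M : ℝ := ((m i + (e+1) : ℕ) : ℝ) with hM
  have hM0 : 0 ≤ M := Nat.cast_nonneg _
  have hmM : (m i : ℝ) ≤ M := by rw [hM]; exact_mod_cast Nat.le_add_right _ _
  have h8 : (m i : ℝ) * M^(2*e+1) ≤ M * M^(2*e+1) := mul_le_mul_of_nonneg_right hmM (by positivity)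
  have h9 : M^(2*(e+1)) = M * M^(2*e+1) := by ring
  rw [h9]
  have h10 : 0 ≤ M * M^(2*e+1) := by positivity
  nlinarith

end final

/-- Local inverse bounds for the mean-value map `A_m`. -/
theorem statement16 (d : ℕ) (hd : 2 ≤ d) (m : Fin d → ℕ) (hm : ∀ i, 1 ≤ m i)
    (θ α : (i : Fin d) → Fin (m i) → ℝ)
    (κ : ℝ) (hκ : κ = Real.sqrt (2 * (d.factorial : ℝ)) *
      Real.sqrt (∑ i, ((m i + d : ℕ) : ℝ)^(2*d)))
    (L : ℝ) (hL : ∀ x ∈ simplexD d, |Real.log (fdens d m θ x)| ≤ L)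
    (hclose : eunorm d m (fun i k => Amap d m θ i k - α i k)
      ≤ Real.exp (-(1+L)) / (6 * (d:ℝ)^((3:ℝ)/2) * κ)) :
    ∃ θstar : (i : Fin d) → Fin (m i) → ℝ, Amap d m θstar = α ∧
      ∀ τ : ℝ,
        6 * (d:ℝ)^((3:ℝ)/2) * Real.exp (1+L) * κ *
          eunorm d m (fun i k => Amap d m θ i k - α i k) ≤ τ → τ ≤ 1 →
        eunorm d m (fun i k => θ i k - θstar i k)
          ≤ 3 * d * Real.exp (τ + L) * eunorm d m (fun i k => Amap d m θ i k - α i k) ∧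
        (∫ x in simplexD d,
            fdens d m θ x * Real.log (fdens d m θ x / fdens d m θstar x))
          ≤ 3 * d * Real.exp (τ + L) *
            (eunorm d m (fun i k => Amap d m θ i k - α i k))^2 := by
  obtain ⟨e, rfl⟩ : ∃ e, d = e + 1 := ⟨d - 1, by omega⟩
  have he : 1 ≤ e := by omega
  have H := core_hyp e m
  have hms : MeasurableSet (simplexD (e+1)) := H.hK.measurableSet
  have hLae : ∀ᵐ x ∂(volume.restrict (simplexD (e+1))),
      Real.exp (-L) ≤ cF (simplexD (e+1)) (fphi e m) (unc θ) x := by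
    filter_upwards [ae_Ioo e, ae_restrict_mem hms] with x hx hxK
    have h1 := (abs_le.1 (hL x hxK)).1
    rw [← fdens_eq θ x hx]
    have hp : 0 < fdens (e+1) m θ x := Real.exp_pos _
    rwa [Real.le_log_iff_exp_le hp] at h1
  have hkl : ∀ η : (i : Fin (e+1)) → Fin (m i) → ℝ, (∫ x in simplexD (e+1),
            fdens (e+1) m θ x * Real.log (fdens (e+1) m θ x / fdens (e+1) m η x)) ≤
      cN (cA (simplexD (e+1)) (fphi e m) (unc θ) - cA (simplexD (e+1)) (fphi e m) (unc η)) *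
        cN (unc θ - unc η) := by
    intro η
    refine le_trans (le_of_eq ?_) (core_kl H (unc θ) (unc η))
    apply integral_congr_ae
    filter_upwards [ae_Ioo e] with x hx
    rw [fdens_eq θ x hx, fdens_eq η x hx]
  set D : ℝ := ((e+1 : ℕ) : ℝ) with hD
  have hD2 : (2:ℝ) ≤ D := by rw [hD]; exact_mod_cast hd
  have hDr : D < D^((3:ℝ)/2) := by
    have := Real.rpow_lt_rpow_of_exponent_lt (x := D) (by linarith) (show (1:ℝ) < 3/2 by norm_num)
    rwa [Real.rpow_one] at this
  set R : ℝ := D^((3:ℝ)/2) with hR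
  have hκ0 : 0 < κ := by
    rw [hκ]
    apply mul_pos
    · apply Real.sqrt_pos.2; positivity
    · apply Real.sqrt_pos.2
      apply Finset.sum_pos _ Finset.univ_nonempty
      intro i _
      positivity
  set ε := eunorm (e+1) m (fun i k => Amap (e+1) m θ i k - α i k) with hε
  have hεeq : ε = cN (cA (simplexD (e+1)) (fphi e m) (unc θ) - unc α) := by
    rw [hε, eunorm_eq, unc_sub, Amap_eq]
  have hε0 : 0 ≤ ε := by rw [hεeq]; exact cN_nonneg _
  set τ0 := 6 * R * Real.exp (1+L) * κ * ε with hτ0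
  have hτ1 : τ0 ≤ 1 := by
    have hp : 0 < 6 * R * κ := by positivity
    rw [le_div_iff₀ hp] at hclose
    have h1 := mul_le_mul_of_nonneg_right hclose (Real.exp_pos (1+L)).le
    rw [← Real.exp_add, neg_add_cancel, Real.exp_zero] at h1
    rw [hτ0]; linarith
  obtain ⟨w, hw, hwn⟩ : ∃ w, cA (simplexD (e+1)) (fphi e m) w = unc α ∧
      cN (unc θ - w) ≤ 3 * D * Real.exp (τ0 + L) * ε := by
    rcases eq_or_lt_of_le hε0 with h0 | hpos
    · refine ⟨unc θ, ?_, ?_⟩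
      · ext j
        have h1 := abs_le_cN (cA (simplexD (e+1)) (fphi e m) (unc θ) - unc α) j
        rw [← hεeq, ← h0] at h1
        have h2 := abs_nonpos_iff.1 h1
        simpa [sub_eq_zero] using h2
      · rw [← h0]; simp [cN]
    · have hρ : 0 < 3 * D * Real.exp (τ0 + L) * ε := by positivity
      refine core_exists H f_mean (1 / (3 * ((e:ℝ)+1))) κ L (f_lam he) (f_kap κ hκ) (unc θ) (unc α) hLae _ hρ ?_
      rw [← hεeq]
      have hDe : (e:ℝ) + 1 = D := by rw [hD]; push_cast; rfl
      rw [hDe]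
      have h1 : 2 * (κ * (3 * D * Real.exp (τ0 + L) * ε)) < τ0 := by
        have h2 : Real.exp (τ0 + L) ≤ Real.exp (1 + L) := Real.exp_le_exp.2 (by linarith)
        have h3 : D * Real.exp (τ0 + L) < R * Real.exp (1 + L) :=
          mul_lt_mul hDr h2 (Real.exp_pos _) (by linarith)
        have h4 := mul_lt_mul_of_pos_right h3 (show 0 < 6 * κ * ε by positivity)
        rw [hτ0]
        rw [← hτ0]
        calc _ = D * Real.exp (τ0 + L) * (6 * κ * ε) := by ring
          _ < _ := h4
          _ = _ := by rw [hτ0]; ring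
      set s := 2 * (κ * (3 * D * Real.exp (τ0 + L) * ε)) with hs
      have h5 : 1 / (3 * D) * Real.exp (-L - s) * (3 * D * Real.exp (τ0 + L) * ε) =
          Real.exp (τ0 - s) * ε := by
        have : Real.exp (τ0 - s) = Real.exp (-L - s) * Real.exp (τ0 + L) := by
          rw [← Real.exp_add]; ring_nf
        rw [this]
        field_simp
      rw [h5]
      have h6 : 1 < Real.exp (τ0 - s) := Real.one_lt_exp_iff.2 (by linarith)
      nlinarith
  let θs : (i : Fin (e+1)) → Fin (m i) → ℝ := fun i k => w ⟨i, k⟩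
  have hθs : unc θs = w := rfl
  refine ⟨θs, ?_, ?_⟩
  · have h1 := Amap_eq θs
    rw [hθs, hw] at h1
    ext i k
    exact congrFun h1 ⟨i, k⟩
  · intro τ hτ _
    have h1 : Real.exp (τ0 + L) ≤ Real.exp (τ + L) := Real.exp_le_exp.2 (by linarith)
    have h2 : cN (unc θ - w) ≤ 3 * D * Real.exp (τ + L) * ε := by
      refine hwn.trans ?_
      gcongr
    refine ⟨?_, ?_⟩
    · rw [eunorm_eq, unc_sub, hθs]
      exact h2
    · refine (hkl θs).trans ?_
      rw [hθs, hw, ← hεeq]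
      calc _ ≤ ε * (3 * D * Real.exp (τ + L) * ε) := mul_le_mul_of_nonneg_left h2 hε0
        _ = _ := by ring
end
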